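/- (Rubin) Let T be a complete theory in the first-order language with one binary relation symbol such that every model of T is a (strict) linear order, and suppose T has infinite models. Then I(T,ω), the number of isomorphism classes of countably infinite models of T, is either 1 or 2^ℵ₀. -/

import Mathlib

open FirstOrder Cardinal

universe u v w w' x


/-- The isomorphism classes of models of `T` with domain `ℕ`. -/
def CountableModelClasses (L : FirstOrder.Language.{u, v}) (T : L.Theory) : Type (max u v) :=
  Quot (fun S₁ S₂ : {S : L.Structure ℕ // @FirstOrder.Language.Theory.Model L ℕ S T} =>
    Nonempty (@FirstOrder.Language.Equiv L ℕ ℕ S₁.1 S₂.1))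

/-- `I(T,ω)`: the number of isomorphism classes of models of `T` with domain `ℕ`
(equivalently, of countably infinite models of `T`, when `T` has only infinite models). -/
noncomputable def numCountableModels (L : FirstOrder.Language.{u, v}) (T : L.Theory) :
    Cardinal.{max u v} :=
  Cardinal.mk (CountableModelClasses L T)

namespace LinOrdTheory

open Set

/-- Ehrenfeucht-Fraïssé types of rank `k` of linear orders. -/
def EF : ℕ → Type
  | 0 => Unit
  | k + 1 => Set (EF k × EF k)

instance instFiniteEF : ∀ k, Finite (EF k)
  | 0 => inferInstanceAs (Finite Unit)
  | k + 1 =>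
    haveI := instFiniteEF k
    inferInstanceAs (Finite (Set (EF k × EF k)))

namespace EF

/-- The type of the empty order. -/
def zero : ∀ k, EF k
  | 0 => ()
  | k + 1 => (∅ : Set (EF k × EF k))

/-- Restriction of a type to the previous rank. -/
def trunc : ∀ {k}, EF (k + 1) → EF k
  | 0, _ => ()
  | _ + 1, S => (fun p => (trunc p.1, trunc p.2)) '' S

instance (k : ℕ) : Membership (EF k × EF k) (EF (k + 1)) :=
  inferInstanceAs (Membership (EF k × EF k) (Set (EF k × EF k)))

/-- The type of an ordered sum in terms of the types of the summands. -/
def add : ∀ {k}, EF k → EF k → EF k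
  | 0, _, _ => ()
  | k + 1, S, T =>
    ({p | ∃ q : EF k × EF k, q ∈ S ∧ p = (q.1, add q.2 (trunc T))} ∪
      {p | ∃ q : EF k × EF k, q ∈ T ∧ p = (add (trunc S) q.1, q.2)} :
        Set (EF k × EF k))

instance (k : ℕ) : Zero (EF k) := ⟨zero k⟩
instance (k : ℕ) : Add (EF k) := ⟨add⟩

@[ext] theorem ext {k : ℕ} {S T : EF (k + 1)} (h : ∀ p : EF k × EF k, p ∈ S ↔ p ∈ T) : S = T :=
  Set.ext h

instance : Subsingleton (EF 0) := inferInstanceAs (Subsingleton Unit)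

theorem not_mem_zero {k : ℕ} (p : EF k × EF k) : p ∉ (0 : EF (k + 1)) := fun h => h

theorem mem_add {k : ℕ} {S T : EF (k + 1)} {p : EF k × EF k} :
    p ∈ S + T ↔ (∃ q ∈ S, p = (q.1, q.2 + trunc T)) ∨ ∃ q ∈ T, p = (trunc S + q.1, q.2) :=
  Iff.rfl

theorem mem_trunc {k : ℕ} {S : EF (k + 2)} {p : EF k × EF k} :
    p ∈ trunc S ↔ ∃ q ∈ S, p = (trunc q.1, trunc q.2) := by
  constructor
  · rintro ⟨q, hq, rfl⟩; exact ⟨q, hq, rfl⟩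
  · rintro ⟨q, hq, rfl⟩; exact ⟨q, hq, rfl⟩

theorem trunc_zero : ∀ {k : ℕ}, trunc (0 : EF (k + 1)) = 0
  | 0 => rfl
  | k + 1 => by
    ext p
    rw [mem_trunc]
    exact ⟨fun ⟨q, hq, _⟩ => (not_mem_zero _ hq).elim, fun h => (not_mem_zero _ h).elim⟩

theorem trunc_add : ∀ {k : ℕ} (S T : EF (k + 1)), trunc (S + T) = trunc S + trunc T
  | 0, _, _ => rfl
  | k + 1, S, T => by
    ext p
    rw [mem_trunc, mem_add]
    constructor
    · rintro ⟨q, hq, rfl⟩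
      rcases mem_add.1 hq with ⟨r, hr, rfl⟩ | ⟨r, hr, rfl⟩
      · exact Or.inl ⟨_, mem_trunc.2 ⟨r, hr, rfl⟩, by rw [trunc_add]⟩
      · exact Or.inr ⟨_, mem_trunc.2 ⟨r, hr, rfl⟩, by rw [trunc_add]⟩
    · rintro (⟨q, hq, rfl⟩ | ⟨q, hq, rfl⟩) <;> obtain ⟨r, hr, rfl⟩ := mem_trunc.1 hq
      · exact ⟨_, mem_add.2 (Or.inl ⟨r, hr, rfl⟩), by rw [trunc_add]⟩
      · exact ⟨_, mem_add.2 (Or.inr ⟨r, hr, rfl⟩), by rw [trunc_add]⟩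

protected theorem zero_add : ∀ {k : ℕ} (S : EF k), 0 + S = S
  | 0, _ => Subsingleton.elim _ _
  | k + 1, S => by
    ext p
    have ih : ∀ T : EF k, 0 + T = T := fun T => EF.zero_add T
    simp only [mem_add, trunc_zero, ih, not_mem_zero, false_and, exists_false, false_or]
    exact ⟨by rintro ⟨q, hq, rfl⟩; exact hq, fun h => ⟨p, h, rfl⟩⟩

protected theorem add_zero : ∀ {k : ℕ} (S : EF k), S + 0 = S
  | 0, _ => Subsingleton.elim _ _
  | k + 1, S => by
    ext p
    have ih : ∀ T : EF k, T + 0 = T := fun T => EF.add_zero T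
    simp only [mem_add, trunc_zero, ih, not_mem_zero, false_and, exists_false, or_false]
    exact ⟨by rintro ⟨q, hq, rfl⟩; exact hq, fun h => ⟨p, h, rfl⟩⟩

protected theorem add_assoc : ∀ {k : ℕ} (S T R : EF k), S + T + R = S + (T + R)
  | 0, _, _, _ => Subsingleton.elim _ _
  | k + 1, S, T, R => by
    ext p
    simp only [mem_add, trunc_add]
    constructor
    · rintro (⟨q, ⟨r, hr, rfl⟩ | ⟨r, hr, rfl⟩, rfl⟩ | ⟨q, hq, rfl⟩)
      · exact Or.inl ⟨r, hr, by rw [EF.add_assoc]⟩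
      · exact Or.inr ⟨_, Or.inl ⟨r, hr, rfl⟩, rfl⟩
      · exact Or.inr ⟨_, Or.inr ⟨q, hq, rfl⟩, by rw [EF.add_assoc]⟩
    · rintro (⟨q, hq, rfl⟩ | ⟨q, ⟨r, hr, rfl⟩ | ⟨r, hr, rfl⟩, rfl⟩)
      · exact Or.inl ⟨_, Or.inl ⟨q, hq, rfl⟩, by rw [EF.add_assoc]⟩
      · exact Or.inl ⟨_, Or.inr ⟨r, hr, rfl⟩, rfl⟩
      · exact Or.inr ⟨r, hr, by rw [EF.add_assoc]⟩

instance (k : ℕ) : AddMonoid (EF k) where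
  add_assoc := EF.add_assoc
  zero_add := EF.zero_add
  add_zero := EF.add_zero
  nsmul := nsmulRec

end EF

/-- The rank `k` type of a subset of a linear order. -/
def tp {α : Type*} [LinearOrder α] : (k : ℕ) → Set α → EF k
  | 0, _ => ()
  | k + 1, s => ({p | ∃ x ∈ s, p = (tp k (s ∩ Iio x), tp k (s ∩ Ioi x))} : Set (EF k × EF k))

/-- The complete theory of a subset of a linear order, as the sequence of its types. -/
def Th {α : Type*} [LinearOrder α] (s : Set α) : ∀ k, EF k := fun k => tp k s

section

variable {α β : Type*} [LinearOrder α] [LinearOrder β]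

theorem mem_tp {k : ℕ} {s : Set α} {p : EF k × EF k} :
    p ∈ tp (k + 1) s ↔ ∃ x ∈ s, p = (tp k (s ∩ Iio x), tp k (s ∩ Ioi x)) := Iff.rfl

theorem mk_mem_tp {k : ℕ} {s : Set α} {x : α} (hx : x ∈ s) :
    (tp k (s ∩ Iio x), tp k (s ∩ Ioi x)) ∈ tp (k + 1) s := ⟨x, hx, rfl⟩

theorem tp_succ_eq_iff {k : ℕ} {s : Set α} {t : Set β} :
    tp (k + 1) s = tp (k + 1) t ↔
      (∀ x ∈ s, ∃ y ∈ t, tp k (t ∩ Iio y) = tp k (s ∩ Iio x) ∧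
        tp k (t ∩ Ioi y) = tp k (s ∩ Ioi x)) ∧
      (∀ y ∈ t, ∃ x ∈ s, tp k (s ∩ Iio x) = tp k (t ∩ Iio y) ∧
        tp k (s ∩ Ioi x) = tp k (t ∩ Ioi y)) := by
  constructor
  · intro h
    refine ⟨fun x hx => ?_, fun y hy => ?_⟩
    · obtain ⟨y, hy, he⟩ := mem_tp.1 (h ▸ mk_mem_tp (k := k) hx)
      exact ⟨y, hy, (Prod.ext_iff.1 he).1.symm, (Prod.ext_iff.1 he).2.symm⟩
    · obtain ⟨x, hx, he⟩ := mem_tp.1 (h.symm ▸ mk_mem_tp (k := k) hy)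
      exact ⟨x, hx, (Prod.ext_iff.1 he).1.symm, (Prod.ext_iff.1 he).2.symm⟩
  · rintro ⟨h₁, h₂⟩
    ext p
    constructor
    · rintro ⟨x, hx, rfl⟩
      obtain ⟨y, hy, e₁, e₂⟩ := h₁ x hx
      exact ⟨y, hy, by rw [e₁, e₂]⟩
    · rintro ⟨y, hy, rfl⟩
      obtain ⟨x, hx, e₁, e₂⟩ := h₂ y hy
      exact ⟨x, hx, by rw [e₁, e₂]⟩

theorem trunc_tp : ∀ {k : ℕ} (s : Set α), EF.trunc (tp (k + 1) s) = tp k s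
  | 0, _ => rfl
  | k + 1, s => by
    ext p
    rw [EF.mem_trunc, mem_tp]
    constructor
    · rintro ⟨q, ⟨x, hx, rfl⟩, rfl⟩
      exact ⟨x, hx, by simp only [trunc_tp]⟩
    · rintro ⟨x, hx, rfl⟩
      exact ⟨_, mk_mem_tp hx, by simp only [trunc_tp]⟩

theorem tp_eq_of_le {k m : ℕ} (hkm : k ≤ m) {s : Set α} {t : Set β} (h : tp m s = tp m t) :
    tp k s = tp k t := by
  induction m, hkm using Nat.le_induction with
  | base => exact h
  | succ m _ ih => exact ih (by rw [← trunc_tp, h, trunc_tp])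

theorem tp_empty : ∀ k, tp k (∅ : Set α) = 0
  | 0 => rfl
  | k + 1 => by
    ext p
    exact ⟨fun ⟨_, hx, _⟩ => hx.elim, fun h => (EF.not_mem_zero _ h).elim⟩

theorem tp_union : ∀ (k : ℕ) {s t : Set α}, (∀ x ∈ s, ∀ y ∈ t, x < y) →
    tp k (s ∪ t) = tp k s + tp k t
  | 0, _, _, _ => Subsingleton.elim _ _
  | k + 1, s, t, h => by
    have hs : ∀ x ∈ s, (s ∪ t) ∩ Iio x = s ∩ Iio x ∧ (s ∪ t) ∩ Ioi x = (s ∩ Ioi x) ∪ t := by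
      intro x hx
      constructor <;> ext y
      · simp only [mem_inter_iff, mem_union, mem_Iio]
        exact ⟨fun ⟨h₁, h₂⟩ => ⟨h₁.resolve_right fun h₃ => (h x hx y h₃).not_gt h₂, h₂⟩,
          fun ⟨h₁, h₂⟩ => ⟨Or.inl h₁, h₂⟩⟩
      · simp only [mem_inter_iff, mem_union, mem_Ioi]
        exact ⟨fun ⟨h₁, h₂⟩ => h₁.imp (fun h₃ => ⟨h₃, h₂⟩) id,
          fun h₁ => h₁.elim (fun h₃ => ⟨Or.inl h₃.1, h₃.2⟩) fun h₃ => ⟨Or.inr h₃, h x hx y h₃⟩⟩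
    have ht : ∀ x ∈ t, (s ∪ t) ∩ Ioi x = t ∩ Ioi x ∧ (s ∪ t) ∩ Iio x = s ∪ (t ∩ Iio x) := by
      intro x hx
      constructor <;> ext y
      · simp only [mem_inter_iff, mem_union, mem_Ioi]
        exact ⟨fun ⟨h₁, h₂⟩ => ⟨h₁.resolve_left fun h₃ => (h y h₃ x hx).not_gt h₂, h₂⟩,
          fun ⟨h₁, h₂⟩ => ⟨Or.inr h₁, h₂⟩⟩
      · simp only [mem_inter_iff, mem_union, mem_Iio]
        exact ⟨fun ⟨h₁, h₂⟩ => h₁.imp id (fun h₃ => ⟨h₃, h₂⟩),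
          fun h₁ => h₁.elim (fun h₃ => ⟨Or.inl h₃, h y h₃ x hx⟩) fun h₃ => ⟨Or.inr h₃.1, h₃.2⟩⟩
    ext p
    rw [EF.mem_add, mem_tp, trunc_tp, trunc_tp]
    constructor
    · rintro ⟨x, hx | hx, rfl⟩
      · refine Or.inl ⟨_, mk_mem_tp hx, ?_⟩
        rw [(hs x hx).1, (hs x hx).2, tp_union k fun a ha b hb => h a ha.1 b hb]
      · refine Or.inr ⟨_, mk_mem_tp hx, ?_⟩
        rw [(ht x hx).1, (ht x hx).2, tp_union k fun a ha b hb => h a ha b hb.1]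
    · rintro (⟨_, ⟨x, hx, rfl⟩, rfl⟩ | ⟨_, ⟨x, hx, rfl⟩, rfl⟩)
      · refine ⟨x, Or.inl hx, ?_⟩
        rw [(hs x hx).1, (hs x hx).2, tp_union k fun a ha b hb => h a ha.1 b hb]
      · refine ⟨x, Or.inr hx, ?_⟩
        rw [(ht x hx).1, (ht x hx).2, tp_union k fun a ha b hb => h a ha b hb.1]

theorem tp_image : ∀ (k : ℕ) {s : Set α} {f : α → β}, StrictMonoOn f s → tp k (f '' s) = tp k s
  | 0, _, _, _ => rfl
  | k + 1, s, f, hf => by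
    have h₁ : ∀ x ∈ s, f '' s ∩ Iio (f x) = f '' (s ∩ Iio x) := by
      intro x hx
      ext y
      constructor
      · rintro ⟨⟨z, hz, rfl⟩, h⟩
        exact ⟨z, ⟨hz, (hf.lt_iff_lt hz hx).1 h⟩, rfl⟩
      · rintro ⟨z, ⟨hz, h⟩, rfl⟩
        exact ⟨⟨z, hz, rfl⟩, (hf.lt_iff_lt hz hx).2 h⟩
    have h₂ : ∀ x ∈ s, f '' s ∩ Ioi (f x) = f '' (s ∩ Ioi x) := by
      intro x hx
      ext y
      constructor
      · rintro ⟨⟨z, hz, rfl⟩, h⟩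
        exact ⟨z, ⟨hz, (hf.lt_iff_lt hx hz).1 h⟩, rfl⟩
      · rintro ⟨z, ⟨hz, h⟩, rfl⟩
        exact ⟨⟨z, hz, rfl⟩, (hf.lt_iff_lt hx hz).2 h⟩
    have h₃ : ∀ x ∈ s, (tp k (f '' s ∩ Iio (f x)), tp k (f '' s ∩ Ioi (f x))) =
        (tp k (s ∩ Iio x), tp k (s ∩ Ioi x)) := fun x hx => by
      rw [h₁ x hx, h₂ x hx, tp_image k (hf.mono inter_subset_left),
        tp_image k (hf.mono inter_subset_left)]
    ext p
    constructor
    · rintro ⟨_, ⟨x, hx, rfl⟩, rfl⟩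
      exact ⟨x, hx, h₃ x hx⟩
    · rintro ⟨x, hx, rfl⟩
      exact ⟨f x, ⟨x, hx, rfl⟩, (h₃ x hx).symm⟩

/-- The rank `k` type of a one-point order. -/
def pt (k : ℕ) : EF k := tp k (univ : Set Unit)

theorem tp_singleton (k : ℕ) (x : α) : tp k ({x} : Set α) = pt k := by
  have : ({x} : Set α) = (fun _ : Unit => x) '' univ := by simp
  rw [this, pt, tp_image]
  intro a _ b _ h
  exact absurd h (by simp)

theorem tp_split (k : ℕ) {s : Set α} {x : α} (hx : x ∈ s) :
    tp k s = tp k (s ∩ Iio x) + (pt k + tp k (s ∩ Ioi x)) := by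
  have h : s = (s ∩ Iio x) ∪ ({x} ∪ (s ∩ Ioi x)) := by
    ext y
    rcases lt_trichotomy y x with h | rfl | h
    · simp [h, h.ne, h.not_gt]
    · simp [hx]
    · simp [h, h.ne', h.not_gt]
  conv_lhs => rw [h]
  rw [tp_union, tp_union, tp_singleton]
  · rintro _ rfl y hy; exact hy.2
  · rintro a ha b (rfl | hb)
    · exact ha.2
    · exact lt_trans ha.2 hb.2

theorem tp_univ_eq (k : ℕ) (x : α) : tp k (univ : Set α) = tp k (Iio x) + (pt k + tp k (Ioi x)) := by
  simpa using tp_split k (mem_univ x)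

theorem tp_Iio_eq (k : ℕ) {x y : α} (h : x < y) :
    tp k (Iio y) = tp k (Iio x) + (pt k + tp k (Ioo x y)) := by
  have h₁ : Iio y ∩ Iio x = Iio x := inter_eq_right.2 (Iio_subset_Iio h.le)
  have h₂ : Iio y ∩ Ioi x = Ioo x y := by rw [inter_comm]; rfl
  rw [tp_split k (show x ∈ Iio y from h), h₁, h₂]

theorem tp_Ioi_eq (k : ℕ) {x y : α} (h : x < y) :
    tp k (Ioi x) = tp k (Ioo x y) + (pt k + tp k (Ioi y)) := by
  have h₁ : Ioi x ∩ Iio y = Ioo x y := rfl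
  have h₂ : Ioi x ∩ Ioi y = Ioi y := inter_eq_right.2 (Ioi_subset_Ioi h.le)
  rw [tp_split k (show y ∈ Ioi x from h), h₁, h₂]

theorem tp_Ioo_eq (k : ℕ) {x y z : α} (h : x < y) (h' : y < z) :
    tp k (Ioo x z) = tp k (Ioo x y) + (pt k + tp k (Ioo y z)) := by
  have h₁ : Ioo x z ∩ Iio y = Ioo x y := by
    ext w; exact ⟨fun hz => ⟨hz.1.1, hz.2⟩, fun hz => ⟨⟨hz.1, lt_trans hz.2 h'⟩, hz.2⟩⟩
  have h₂ : Ioo x z ∩ Ioi y = Ioo y z := by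
    ext w; exact ⟨fun hz => ⟨hz.2, hz.1.2⟩, fun hz => ⟨⟨lt_trans h hz.1, hz.2⟩, hz.1⟩⟩
  rw [tp_split k (show y ∈ Ioo x z from ⟨h, h'⟩), h₁, h₂]

theorem tp_coe (k : ℕ) (S : Set α) (t : Set S) : tp k (Subtype.val '' t) = tp k t :=
  tp_image k fun _ _ _ _ h => h

theorem tp_subtype_univ (k : ℕ) (S : Set α) : tp k (univ : Set S) = tp k S := by
  rw [← tp_coe, image_univ, Subtype.range_coe]

theorem tp_orderIso (k : ℕ) (f : α ≃o β) (s : Set α) : tp k (f '' s) = tp k s :=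
  tp_image k (f.strictMono.strictMonoOn s)

end

section

variable {α β γ : Type*} [LinearOrder α] [LinearOrder β] [LinearOrder γ]

/-- The open interval with possibly infinite end points. -/
def itv (e : WithBot α) (f : WithTop α) : Set α := {x | e < x ∧ x < f}

theorem mem_itv {e : WithBot α} {f : WithTop α} {x : α} : x ∈ itv e f ↔ e < x ∧ x < f := Iff.rfl

theorem itv_bot_top : itv (⊥ : WithBot α) ⊤ = Set.univ := by ext; simp [mem_itv]
theorem itv_bot_coe (x : α) : itv (⊥ : WithBot α) x = Iio x := by ext; simp [mem_itv]
theorem itv_coe_top (x : α) : itv (x : WithBot α) ⊤ = Ioi x := by ext; simp [mem_itv]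
theorem itv_coe_coe (x y : α) : itv (x : WithBot α) y = Ioo x y := by ext; simp [mem_itv]

theorem itv_inter_Iio {e : WithBot α} {f : WithTop α} {x : α} (h : x < f) :
    itv e f ∩ Iio x = itv e x := by
  ext y
  simp only [mem_inter_iff, mem_itv, mem_Iio, WithTop.coe_lt_coe]
  exact ⟨fun hy => ⟨hy.1.1, hy.2⟩, fun hy => ⟨⟨hy.1, (WithTop.coe_lt_coe.2 hy.2).trans h⟩, hy.2⟩⟩

theorem itv_inter_Ioi {e : WithBot α} {f : WithTop α} {x : α} (h : e < x) :
    itv e f ∩ Ioi x = itv x f := by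
  ext y
  simp only [mem_inter_iff, mem_itv, mem_Ioi, WithBot.coe_lt_coe]
  exact ⟨fun hy => ⟨hy.2, hy.1.2⟩, fun hy => ⟨⟨h.trans (WithBot.coe_lt_coe.2 hy.1), hy.2⟩, hy.1⟩⟩

theorem tp_itv_split (k : ℕ) {e : WithBot α} {f : WithTop α} {x : α} (h : x ∈ itv e f) :
    tp k (itv e f) = tp k (itv e x) + (pt k + tp k (itv x f)) := by
  rw [tp_split k h, itv_inter_Iio h.2, itv_inter_Ioi h.1]

theorem tp_itv_succ_ext {k : ℕ} {e : WithBot α} {f : WithTop α} {e' : WithBot β} {f' : WithTop β}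
    (h : tp (k + 1) (itv e f) = tp (k + 1) (itv e' f')) {x : α} (hx : x ∈ itv e f) :
    ∃ y ∈ itv e' f', tp k (itv e' y) = tp k (itv e x) ∧ tp k (itv y f') = tp k (itv x f) := by
  obtain ⟨y, hy, h₁, h₂⟩ := (tp_succ_eq_iff.1 h).1 x hx
  rw [itv_inter_Iio hx.2, itv_inter_Iio hy.2] at h₁
  rw [itv_inter_Ioi hx.1, itv_inter_Ioi hy.1] at h₂
  exact ⟨y, hy, h₁, h₂⟩

theorem tp_itv_congr_left {k : ℕ} {e : WithBot α} {c : α} {f : WithTop α}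
    {e' : WithBot β} {c' : β} {f' : WithTop β} (hec : e ≤ c) (hec' : e' ≤ c')
    (hcf : c < f) (hcf' : c' < f') (h : e = c ↔ e' = c')
    (h₁ : tp k (itv e c) = tp k (itv e' c')) (h₂ : tp k (itv c f) = tp k (itv c' f')) :
    tp k (itv e f) = tp k (itv e' f') := by
  by_cases h₃ : e = c
  · rw [h₃, h.1 h₃, h₂]
  · rw [tp_itv_split k (x := c) ⟨lt_of_le_of_ne hec h₃, hcf⟩,
      tp_itv_split k (x := c') ⟨lt_of_le_of_ne hec' fun h₄ => h₃ (h.2 h₄), hcf'⟩, h₁, h₂]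

theorem tp_itv_congr_right {k : ℕ} {e : WithBot α} {c : α} {f : WithTop α}
    {e' : WithBot β} {c' : β} {f' : WithTop β} (hec : e < c) (hec' : e' < c')
    (hcf : c ≤ f) (hcf' : c' ≤ f') (h : f = c ↔ f' = c')
    (h₁ : tp k (itv e c) = tp k (itv e' c')) (h₂ : tp k (itv c f) = tp k (itv c' f')) :
    tp k (itv e f) = tp k (itv e' f') := by
  by_cases h₃ : f = c
  · rw [h₃, h.1 h₃, h₁]
  · rw [tp_itv_split k (x := c) ⟨hec, lt_of_le_of_ne hcf (Ne.symm h₃)⟩,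
      tp_itv_split k (x := c') ⟨hec', lt_of_le_of_ne hcf' fun h₄ => h₃ (h.2 h₄.symm)⟩, h₁, h₂]

theorem tp_itv_empty {k : ℕ} {x y : α} (h : y ≤ x) :
    tp k (itv (x : WithBot α) (y : WithTop α)) = 0 := by
  rw [itv_coe_coe, Ioo_eq_empty h.not_gt, tp_empty]

variable {ι κ : Type*}

/-- The rank `k` type of a family of elements of a linear order. -/
def typ (k : ℕ) (a : ι → α) : (ι → ι → Prop) × (WithBot ι → WithTop ι → EF k) :=
  (fun i j => a i < a j, fun e f => tp k (itv (e.map a) (f.map a)))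

theorem typ_eq_iff {k : ℕ} {a : ι → α} {b : ι → β} : typ k a = typ k b ↔
    (∀ i j, a i < a j ↔ b i < b j) ∧
      ∀ e f, tp k (itv (e.map a) (f.map a)) = tp k (itv (WithBot.map b e) (WithTop.map b f)) := by
  simp [typ, Prod.ext_iff, funext_iff]

theorem typ_lt {k : ℕ} {a : ι → α} {b : ι → β} (h : typ k a = typ k b) {i j : ι} :
    a i < a j ↔ b i < b j := (typ_eq_iff.1 h).1 i j

theorem typ_le {k : ℕ} {a : ι → α} {b : ι → β} (h : typ k a = typ k b) {i j : ι} :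
    a i ≤ a j ↔ b i ≤ b j := by
  rw [← not_lt, ← not_lt, typ_lt h]

theorem typ_eq {k : ℕ} {a : ι → α} {b : ι → β} (h : typ k a = typ k b) {i j : ι} :
    a i = a j ↔ b i = b j := by
  rw [le_antisymm_iff, le_antisymm_iff, typ_le h, typ_le h]

theorem typ_tp {k : ℕ} {a : ι → α} {b : ι → β} (h : typ k a = typ k b) (e : WithBot ι)
    (f : WithTop ι) : tp k (itv (e.map a) (f.map a)) = tp k (itv (e.map b) (f.map b)) :=
  (typ_eq_iff.1 h).2 e f

theorem typ_Iio {k : ℕ} {a : ι → α} {b : ι → β} (h : typ k a = typ k b) (i : ι) :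
    tp k (Iio (a i)) = tp k (Iio (b i)) := by
  have := typ_tp h ⊥ i
  rwa [WithBot.map_bot, WithBot.map_bot, WithTop.map_coe, WithTop.map_coe, itv_bot_coe,
    itv_bot_coe] at this

theorem typ_Ioi {k : ℕ} {a : ι → α} {b : ι → β} (h : typ k a = typ k b) (i : ι) :
    tp k (Ioi (a i)) = tp k (Ioi (b i)) := by
  have := typ_tp h i ⊤
  rwa [WithTop.map_top, WithTop.map_top, WithBot.map_coe, WithBot.map_coe, itv_coe_top,
    itv_coe_top] at this

theorem typ_Ioo {k : ℕ} {a : ι → α} {b : ι → β} (h : typ k a = typ k b) (i j : ι) :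
    tp k (Ioo (a i) (a j)) = tp k (Ioo (b i) (b j)) := by
  have := typ_tp h i j
  rwa [WithTop.map_coe, WithTop.map_coe, WithBot.map_coe, WithBot.map_coe, itv_coe_coe,
    itv_coe_coe] at this

theorem typ_univ {k : ℕ} {a : ι → α} {b : ι → β} (h : typ k a = typ k b) :
    tp k (univ : Set α) = tp k (univ : Set β) := by
  have := typ_tp h ⊥ ⊤
  rwa [WithTop.map_top, WithTop.map_top, WithBot.map_bot, WithBot.map_bot, itv_bot_top,
    itv_bot_top] at this

theorem typ_iff {k : ℕ} {a : ι → α} {b : ι → β} : typ k a = typ k b ↔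
    (∀ i j, a i < a j ↔ b i < b j) ∧ tp k (univ : Set α) = tp k (univ : Set β) ∧
    (∀ i, tp k (Iio (a i)) = tp k (Iio (b i))) ∧ (∀ i, tp k (Ioi (a i)) = tp k (Ioi (b i))) ∧
    ∀ i j, a i < a j → tp k (Ioo (a i) (a j)) = tp k (Ioo (b i) (b j)) := by
  refine ⟨fun h => ⟨fun _ _ => typ_lt h, typ_univ h, typ_Iio h, typ_Ioi h,
    fun i j _ => typ_Ioo h i j⟩, ?_⟩
  rintro ⟨h, h₁, h₂, h₃, h₄⟩
  refine typ_eq_iff.2 ⟨h, fun e f => ?_⟩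
  induction e using WithBot.recBotCoe with
  | bot =>
    induction f using WithTop.recTopCoe with
    | top => simpa [itv_bot_top] using h₁
    | coe j => simpa [itv_bot_coe] using h₂ j
  | coe i =>
    induction f using WithTop.recTopCoe with
    | top => simpa [itv_coe_top] using h₃ i
    | coe j =>
      by_cases hij : a i < a j
      · simpa [itv_coe_coe] using h₄ i j hij
      · rw [WithBot.map_coe, WithTop.map_coe, tp_itv_empty (not_lt.1 hij), WithBot.map_coe,
          WithTop.map_coe, tp_itv_empty (not_lt.1 fun h₅ => hij ((h i j).2 h₅))]

instance [Finite ι] (k : ℕ) : Finite ((ι → ι → Prop) × (WithBot ι → WithTop ι → EF k)) := by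
  have : Finite (WithBot ι) := inferInstanceAs (Finite (Option ι))
  have : Finite (WithTop ι) := inferInstanceAs (Finite (Option ι))
  infer_instance

theorem typ_comp {k : ℕ} {a : ι → α} {b : ι → β} (h : typ k a = typ k b) (σ : κ → ι) :
    typ k (a ∘ σ) = typ k (b ∘ σ) := by
  refine typ_iff.2 ⟨fun _ _ => typ_lt h, typ_univ h, fun _ => typ_Iio h _, fun _ => typ_Ioi h _,
    fun i j _ => typ_Ioo h _ _⟩

theorem typ_mono {k m : ℕ} (hkm : k ≤ m) {a : ι → α} {b : ι → β} (h : typ m a = typ m b) :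
    typ k a = typ k b :=
  typ_eq_iff.2 ⟨fun _ _ => typ_lt h, fun e f => tp_eq_of_le hkm (typ_tp h e f)⟩

theorem exists_nearest_below [Finite ι] (a : ι → α) (x : α) :
    ∃ e : WithBot ι, e.map a < x ∧ ∀ i, a i < x → ((a i : α) : WithBot α) ≤ e.map a := by
  have : Finite (WithBot ι) := inferInstanceAs (Finite (Option ι))
  obtain ⟨e, he, hm⟩ := Set.Finite.exists_maximalFor (fun e : WithBot ι => e.map a)
    {e | e.map a < x} (Set.toFinite _) ⟨⊥, by simp⟩
  refine ⟨e, he, fun i hi => ?_⟩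
  rcases le_total ((a i : α) : WithBot α) (e.map a) with h | h
  · exact h
  · exact hm (j := (i : WithBot ι)) (by simpa using hi) h

theorem exists_nearest_above [Finite ι] (a : ι → α) (x : α) :
    ∃ f : WithTop ι, x < f.map a ∧ ∀ i, x < a i → f.map a ≤ ((a i : α) : WithTop α) := by
  have : Finite (WithTop ι) := inferInstanceAs (Finite (Option ι))
  obtain ⟨e, he, hm⟩ := Set.Finite.exists_minimalFor (fun e : WithTop ι => e.map a)
    {e | x < e.map a} (Set.toFinite _) ⟨⊤, by simp⟩
  refine ⟨e, he, fun i hi => ?_⟩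
  rcases le_total (e.map a) ((a i : α) : WithTop α) with h | h
  · exact h
  · exact hm (j := (i : WithTop ι)) (by simpa using hi) h

/-- A point in the same cut over two equivalent families, dividing the gap equivalently, extends
the equivalence. -/
theorem typ_extend {k : ℕ} {a : ι → α} {b : ι → β} (h : typ k a = typ k b)
    {e : WithBot ι} {f : WithTop ι} {x : α} {y : β}
    (hx : x ∈ itv (e.map a) (f.map a)) (hy : y ∈ itv (e.map b) (f.map b))
    (hcut : ∀ i, (a i : WithBot α) ≤ e.map a ∨ f.map a ≤ (a i : WithTop α))
    (h₁ : tp k (itv (e.map b) y) = tp k (itv (e.map a) x))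
    (h₂ : tp k (itv y (f.map b)) = tp k (itv x (f.map a))) :
    typ k (fun o : Option ι => o.elim x a) = typ k (fun o : Option ι => o.elim y b) := by
  have lo : ∀ i, (a i : WithBot α) ≤ e.map a ↔ (b i : WithBot β) ≤ e.map b := by
    intro i
    induction e using WithBot.recBotCoe with
    | bot => simp
    | coe j => simpa using typ_le h
  have up : ∀ i, f.map a ≤ (a i : WithTop α) ↔ f.map b ≤ (b i : WithTop β) := by
    intro i
    induction f using WithTop.recTopCoe with
    | top => simp
    | coe j => simpa using typ_le h
  have lt₁ : ∀ i, (a i : WithBot α) ≤ e.map a → a i < x ∧ b i < y := fun i hi =>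
    ⟨WithBot.coe_lt_coe.1 (hi.trans_lt hx.1), WithBot.coe_lt_coe.1 (((lo i).1 hi).trans_lt hy.1)⟩
  have lt₂ : ∀ i, f.map a ≤ (a i : WithTop α) → x < a i ∧ y < b i := fun i hi =>
    ⟨WithTop.coe_lt_coe.1 (hx.2.trans_le hi), WithTop.coe_lt_coe.1 (hy.2.trans_le ((up i).1 hi))⟩
  have key₁ : ∀ g : WithBot ι, g.map a ≤ e.map a →
      tp k (itv (g.map a) x) = tp k (itv (g.map b) y) := by
    intro g hg
    induction e using WithBot.recBotCoe with
    | bot =>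
      have : g.map a = ⊥ := by simpa using hg
      have : g = ⊥ := by
        induction g using WithBot.recBotCoe with
        | bot => rfl
        | coe j => simp at this
      subst this
      exact h₁.symm
    | coe i =>
      refine tp_itv_congr_left (c := a i) (c' := b i) hg ?_ (WithTop.coe_lt_coe.2 (lt₁ i le_rfl).1)
        (WithTop.coe_lt_coe.2 (lt₁ i le_rfl).2) ?_ (typ_tp h g i) h₁.symm
      · induction g using WithBot.recBotCoe with
        | bot => simp
        | coe j => exact WithBot.coe_le_coe.2 ((typ_le h).1 (WithBot.coe_le_coe.1 hg))
      · induction g using WithBot.recBotCoe with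
        | bot => simp
        | coe j => simpa using typ_eq h
  have key₂ : ∀ g : WithTop ι, f.map a ≤ g.map a →
      tp k (itv x (g.map a)) = tp k (itv y (g.map b)) := by
    intro g hg
    induction f using WithTop.recTopCoe with
    | top =>
      have : g.map a = ⊤ := by simpa using hg
      have : g = ⊤ := by
        induction g using WithTop.recTopCoe with
        | top => rfl
        | coe j => simp at this
      subst this
      exact h₂.symm
    | coe i =>
      refine tp_itv_congr_right (c := a i) (c' := b i) (WithBot.coe_lt_coe.2 (lt₂ i le_rfl).1)
        (WithBot.coe_lt_coe.2 (lt₂ i le_rfl).2) hg ?_ ?_ h₂.symm (typ_tp h i g)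
      · induction g using WithTop.recTopCoe with
        | top => simp
        | coe j => exact WithTop.coe_le_coe.2 ((typ_le h).1 (WithTop.coe_le_coe.1 hg))
      · induction g using WithTop.recTopCoe with
        | top => simp
        | coe j => simpa using typ_eq h
  refine typ_iff.2 ⟨?_, typ_univ h, ?_, ?_, ?_⟩
  · rintro (_ | i) (_ | j)
    · simp
    · rcases hcut j with hj | hj
      · simp [(lt₁ j hj).1.not_gt, (lt₁ j hj).2.not_gt]
      · simp [(lt₂ j hj).1, (lt₂ j hj).2]
    · rcases hcut i with hj | hj
      · simp [(lt₁ i hj).1, (lt₁ i hj).2]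
      · simp [(lt₂ i hj).1.not_gt, (lt₂ i hj).2.not_gt]
    · exact typ_lt h
  · rintro (_ | i)
    · simpa [itv_bot_coe] using key₁ ⊥ (by simp)
    · exact typ_Iio h i
  · rintro (_ | i)
    · simpa [itv_coe_top] using key₂ ⊤ (by simp)
    · exact typ_Ioi h i
  · rintro (_ | i) (_ | j) hij
    · exact absurd hij (lt_irrefl _)
    · rcases hcut j with hj | hj
      · exact absurd hij (lt₁ j hj).1.not_gt
      · simpa [itv_coe_coe] using key₂ j hj
    · rcases hcut i with hj | hj
      · simpa [itv_coe_coe] using key₁ i hj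
      · exact absurd hij (lt₂ i hj).1.not_gt
    · exact typ_Ioo h i j

theorem typ_ext [Finite ι] {k : ℕ} {a : ι → α} {b : ι → β} (h : typ (k + 1) a = typ (k + 1) b)
    (x : α) : ∃ y, typ k (fun o : Option ι => o.elim x a) =
      typ k (fun o : Option ι => o.elim y b) := by
  by_cases hx : ∃ i, a i = x
  · obtain ⟨i, rfl⟩ := hx
    refine ⟨b i, ?_⟩
    convert typ_comp (typ_mono k.le_succ h) (fun o : Option ι => o.elim i id) using 2 <;>
    · ext o; cases o <;> rfl
  · obtain ⟨e, he, he'⟩ := exists_nearest_below a x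
    obtain ⟨f, hf, hf'⟩ := exists_nearest_above a x
    obtain ⟨y, hy, h₁, h₂⟩ := tp_itv_succ_ext (typ_tp h e f) ⟨he, hf⟩
    refine ⟨y, typ_extend (typ_mono k.le_succ h) ⟨he, hf⟩ hy (fun i => ?_) h₁ h₂⟩
    rcases lt_or_gt_of_ne fun hi => hx ⟨i, hi⟩ with hi | hi
    · exact Or.inl (he' i hi)
    · exact Or.inr (hf' i hi)

theorem typ_glue {k : ℕ} {a : ι → α} {b : κ → α} {a' : ι → β} {b' : κ → β}
    (ha : typ k a = typ k a') (hb : typ k b = typ k b') {c : ι} {d : κ}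
    (hc : ∀ i, a i ≤ a c) (hd : ∀ j, b d ≤ b j) (hlt : a c < b d) (hlt' : a' c < b' d)
    (h : tp k (Ioo (a c) (b d)) = tp k (Ioo (a' c) (b' d))) :
    typ k (Sum.elim a b) = typ k (Sum.elim a' b') := by
  have hc' : ∀ i, a' i ≤ a' c := fun i => (typ_le ha).1 (hc i)
  have hd' : ∀ i, b' d ≤ b' i := fun i => (typ_le hb).1 (hd i)
  have hij : ∀ i j, a i < b j := fun i j => ((hc i).trans_lt hlt).trans_le (hd j)
  have hij' : ∀ i j, a' i < b' j := fun i j => ((hc' i).trans_lt hlt').trans_le (hd' j)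
  refine typ_iff.2 ⟨?_, typ_univ ha, ?_, ?_, ?_⟩
  · rintro (i | i) (j | j)
    · exact typ_lt ha
    · simp [hij, hij']
    · simp [(hij _ _).not_gt, (hij' _ _).not_gt]
    · exact typ_lt hb
  · rintro (i | i)
    · exact typ_Iio ha i
    · exact typ_Iio hb i
  · rintro (i | i)
    · exact typ_Ioi ha i
    · exact typ_Ioi hb i
  · rintro (i | i) (j | j) hlt
    · exact typ_Ioo ha i j
    · simp only [Sum.elim_inl, Sum.elim_inr, ← itv_coe_coe] at h ⊢
      refine tp_itv_congr_left (c := a c) (c' := a' c) (WithBot.coe_le_coe.2 (hc i))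
        (WithBot.coe_le_coe.2 (hc' i)) (WithTop.coe_lt_coe.2 (hij _ _))
        (WithTop.coe_lt_coe.2 (hij' _ _)) (by simpa using typ_eq ha) (typ_tp ha i c) ?_
      exact tp_itv_congr_right (c := b d) (c' := b' d) (WithBot.coe_lt_coe.2 (hij _ _))
        (WithBot.coe_lt_coe.2 (hij' _ _)) (WithTop.coe_le_coe.2 (hd j))
        (WithTop.coe_le_coe.2 (hd' j)) (by simpa using typ_eq hb) h (typ_tp hb d j)
    · exact absurd hlt (hij _ _).not_gt
    · exact typ_Ioo hb i j

end

section

open Filter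

variable {α β V : Type*} [LinearOrder α] [LinearOrder β] [LinearOrder V] {ι : Type*}

/-- The rank `n` type of the first `n` terms of a sequence. -/
def sty (n : ℕ) (c : ℕ → α) := typ n fun i : Fin n => c i

theorem sty_mono {n m : ℕ} (h : n ≤ m) {a : ℕ → α} {b : ℕ → β} (hab : sty m a = sty m b) :
    sty n a = sty n b :=
  typ_mono h (typ_comp hab (Fin.castLE h))

variable (V) in
/-- Countable saturation, in sequential form. -/
def Sat : Prop := ∀ c : ℕ → ℕ → V, ∃ b : ℕ → V,
  (∀ n, ∀ᶠ k in (hyperfilter ℕ : Filter ℕ), sty n (c k) = sty n b) ∧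
    ∀ i v, (∀ k, c k i = v) → b i = v

theorem exists_eventually_eq {X : Type*} [Finite X] (f : ℕ → X) :
    ∃ x, ∀ᶠ s in (hyperfilter ℕ : Filter ℕ), f s = x := by
  obtain ⟨x, hx⟩ := Ultrafilter.eq_pure_of_finite ((hyperfilter ℕ).map f)
  refine ⟨x, ?_⟩
  have : {x} ∈ (hyperfilter ℕ).map f := by rw [hx]; exact Ultrafilter.mem_pure.2 rfl
  exact Ultrafilter.mem_map.1 this

theorem eventually_ge (k : ℕ) : ∀ᶠ s in (hyperfilter ℕ : Filter ℕ), k ≤ s :=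
  Nat.hyperfilter_le_atTop (eventually_ge_atTop k)

theorem Sat.finite (hV : Sat V) [Finite ι] (c : ℕ → ι → V) : ∃ b : ι → V,
    (∀ n, ∀ᶠ k in (hyperfilter ℕ : Filter ℕ), typ n (c k) = typ n b) ∧
      ∀ i v, (∀ k, c k i = v) → b i = v := by
  rcases isEmpty_or_nonempty ι with h | h
  · refine ⟨isEmptyElim, fun n => Eventually.of_forall fun k => ?_, fun i => isEmptyElim i⟩
    congr 1; ext i; exact isEmptyElim i
  obtain ⟨g, hg⟩ := exists_surjective_nat ι
  obtain ⟨s, hs⟩ := hg.hasRightInverse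
  obtain ⟨b, hb, hb'⟩ := hV fun k j => c k (g j)
  refine ⟨b ∘ s, fun n => ?_, fun i v hv => hb' _ _ fun k => by rw [hs i]; exact hv k⟩
  obtain ⟨N, hN⟩ : ∃ N, ∀ i, s i < N := by
    obtain ⟨N, hN⟩ := (Set.finite_range s).bddAbove
    exact ⟨N + 1, fun i => Nat.lt_succ_of_le (hN ⟨i, rfl⟩)⟩
  filter_upwards [hb (max n N)] with k hk
  have := typ_comp (typ_mono (le_max_left n N) hk)
    fun i => (⟨s i, (hN i).trans_le (le_max_right n N)⟩ : Fin (max n N))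
  convert this using 2
  · ext i
    simp [hs i]
  · rfl

theorem Sat.ext (hV : Sat V) [Finite ι] {a : ι → α} {a' : ι → V} (h : ∀ k, typ k a = typ k a')
    (x : α) : ∃ y, ∀ k, typ k (fun o : Option ι => o.elim x a) =
      typ k (fun o : Option ι => o.elim y a') := by
  choose y hy using fun k => typ_ext (h (k + 1)) x
  obtain ⟨b, hb, hb'⟩ := hV.finite fun k (o : Option ι) => o.elim (y k) a'
  refine ⟨b none, fun k => ?_⟩
  have hab : b = fun o : Option ι => o.elim (b none) a' := by
    ext (_ | i)
    · rfl
    · exact hb' (some i) _ fun k => rfl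
  rw [← hab]
  obtain ⟨m, hm, hkm⟩ := ((hb k).and (eventually_ge k)).exists
  rw [← hm]
  exact typ_mono hkm (hy m)

end

section Ultrapower

open Filter

variable {A : Type*} [LinearOrder A]

variable (A) in
/-- An ultrapower of a linear order. -/
abbrev Upow := Germ (hyperfilter ℕ : Filter ℕ) A

/-- The class of a sequence in the ultrapower. -/
noncomputable def cls (x : ℕ → A) : Upow A := (x : Germ (hyperfilter ℕ : Filter ℕ) A)

theorem mem_itv_cls {e : WithBot (ℕ → A)} {f : WithTop (ℕ → A)} {x : ℕ → A} :
    cls x ∈ itv (e.map cls) (f.map cls) ↔ ∀ᶠ s in (hyperfilter ℕ : Filter ℕ),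
      x s ∈ itv (e.map (· s)) (f.map (· s)) := by
  simp only [mem_itv, eventually_and]
  refine and_congr ?_ ?_
  · induction e using WithBot.recBotCoe with
    | bot => simp
    | coe e => simp [cls, Germ.coe_lt]
  · induction f using WithTop.recTopCoe with
    | top => simp
    | coe f => simp [cls, Germ.coe_lt]

theorem cls_surjective {A : Type*} : Function.Surjective (cls (A := A)) := fun u =>
  Quotient.inductionOn' u fun x => ⟨x, rfl⟩

theorem tp_itv_cls (k : ℕ) (e : WithBot (ℕ → A)) (f : WithTop (ℕ → A)) :
    ∀ᶠ s in (hyperfilter ℕ : Filter ℕ),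
      tp k (itv (e.map (· s)) (f.map (· s))) = tp k (itv (e.map cls) (f.map cls)) := by
  induction k generalizing e f with
  | zero => exact Eventually.of_forall fun _ => rfl
  | succ k ih =>
    obtain ⟨t, ht⟩ := exists_eventually_eq fun s =>
      tp (k + 1) (itv (e.map fun x : ℕ → A => x s) (f.map fun x : ℕ → A => x s))
    suffices h : t = tp (k + 1) (itv (e.map cls) (f.map cls)) by rwa [← h]
    ext p
    constructor
    · intro hp
      have h₁ : ∀ᶠ s in (hyperfilter ℕ : Filter ℕ), ∃ x : A,
          x ∈ itv (e.map fun x : ℕ → A => x s) (f.map fun x : ℕ → A => x s) ∧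
          p = (tp k (itv (e.map fun x : ℕ → A => x s) x),
            tp k (itv x (f.map fun x : ℕ → A => x s))) := by
        filter_upwards [ht] with s hs
        rw [← hs] at hp
        obtain ⟨x, hx, hp⟩ := mem_tp.1 hp
        rw [itv_inter_Iio hx.2, itv_inter_Ioi hx.1] at hp
        exact ⟨x, hx, hp⟩
      obtain ⟨x, hx⟩ := h₁.choice
      have hx' : cls x ∈ itv (e.map cls) (f.map cls) :=
        mem_itv_cls.2 (hx.mono fun s hs => hs.1)
      obtain ⟨s, hs, h₁, h₂⟩ := (hx.and ((ih e x).and (ih x f))).exists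
      rw [mem_tp]
      refine ⟨cls x, hx', ?_⟩
      rw [itv_inter_Iio hx'.2, itv_inter_Ioi hx'.1, hs.2]
      simp only [WithBot.map_coe, WithTop.map_coe] at h₁ h₂
      rw [h₁, h₂]
    · intro hp
      obtain ⟨u, hu, hp⟩ := mem_tp.1 hp
      obtain ⟨x, rfl⟩ := cls_surjective u
      rw [itv_inter_Iio hu.2, itv_inter_Ioi hu.1] at hp
      obtain ⟨s, hs, hs', h₁, h₂⟩ :=
        ((mem_itv_cls.1 hu).and (ht.and ((ih e x).and (ih x f)))).exists
      rw [← hs', mem_tp]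
      refine ⟨x s, hs, ?_⟩
      simp only [WithBot.map_coe, WithTop.map_coe] at h₁ h₂
      rw [itv_inter_Iio hs.2, itv_inter_Ioi hs.1, hp, h₁, h₂]

theorem typ_cls {ι : Type*} [Finite ι] (k : ℕ) (a : ι → ℕ → A) :
    ∀ᶠ s in (hyperfilter ℕ : Filter ℕ), typ k (fun i => a i s) = typ k (fun i => cls (a i)) := by
  have : Finite (WithBot ι) := inferInstanceAs (Finite (Option ι))
  have : Finite (WithTop ι) := inferInstanceAs (Finite (Option ι))
  simp only [typ_eq_iff, eventually_and, eventually_all]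
  refine ⟨fun i j => ?_, fun e f => ?_⟩
  · by_cases h : cls (a i) < cls (a j)
    · filter_upwards [Germ.coe_lt.1 h] with s hs
      exact iff_of_true hs h
    · filter_upwards [Ultrafilter.eventually_not.2 fun h' => h (Germ.coe_lt.2 h')] with s hs
      exact iff_of_false hs h
  · have := tp_itv_cls k (e.map a) (f.map a)
    simp only [WithBot.map_map, WithTop.map_map] at this
    exact this

theorem typ_const {ι : Type*} [Finite ι] (k : ℕ) (a : ι → A) :
    typ k a = typ k (fun i => cls fun _ => a i) := by
  obtain ⟨_, h⟩ := (typ_cls k fun i _ => a i).exists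
  exact h

theorem tp_Upow (k : ℕ) : tp k (Set.univ : Set (Upow A)) = tp k (Set.univ : Set A) :=
  (typ_univ (typ_const k (Empty.elim : Empty → A))).symm

theorem sat_Upow : Sat (Upow A) := by
  intro c
  choose r hr using cls_surjective (A := A)
  choose L hL using fun n => exists_eventually_eq fun k => sty n (c k)
  choose κ hκ using fun n => (hL n).exists
  have hB : ∀ n, ∀ᶠ s in (hyperfilter ℕ : Filter ℕ),
      sty n (fun i => r (c (κ n) i) s) = L n := by
    intro n
    filter_upwards [typ_cls n fun i : Fin n => r (c (κ n) i)] with s hs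
    refine hs.trans (Eq.trans ?_ (hκ n))
    simp only [hr, sty]
  classical
  let m : ℕ → ℕ := fun s =>
    Nat.findGreatest (fun n => sty n (fun i => r (c (κ n) i) s) = L n) s
  let b : ℕ → Upow A := fun i => cls fun s => r (c (κ (m s)) i) s
  have hb : ∀ n, sty n b = L n := by
    intro n
    obtain ⟨s, hs, hns, hs'⟩ := ((hB n).and
      ((eventually_ge n).and
      (typ_cls n fun (i : Fin n) s => r (c (κ (m s)) i) s))).exists
    have h₁ : n ≤ m s := Nat.le_findGreatest hns hs
    have h₂ : sty (m s) (fun i => r (c (κ (m s)) i) s) = L (m s) :=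
      Nat.findGreatest_spec (P := fun n => sty n (fun i => r (c (κ n) i) s) = L n) hns hs
    obtain ⟨k, hk, hk'⟩ := ((hL n).and (hL (m s))).exists
    rw [← hk'] at h₂
    rw [← hk]
    exact hs'.symm.trans (sty_mono h₁ h₂)
  refine ⟨b, fun n => ?_, fun i v hv => ?_⟩
  · rw [hb n]; exact hL n
  · change cls _ = _
    simp only [hv]
    exact hr v

end Ultrapower

namespace EF

/-- The type of the reversed order. -/
def rev : ∀ {k}, EF k → EF k
  | 0, _ => ()
  | k + 1, S => ((fun p : EF k × EF k => (rev p.2, rev p.1)) '' S : Set (EF k × EF k))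

theorem rev_rev : ∀ {k} (S : EF k), rev (rev S) = S
  | 0, _ => rfl
  | k + 1, S => by
    have ih : ∀ T : EF k, rev (rev T) = T := fun T => rev_rev T
    ext p
    constructor
    · rintro ⟨_, ⟨q, hq, rfl⟩, rfl⟩
      simp only [ih]
      exact hq
    · intro hp
      exact ⟨(rev p.2, rev p.1), ⟨p, hp, rfl⟩, by simp only [ih]⟩

end EF

section Dual

variable {α : Type*} [LinearOrder α]

open OrderDual

theorem tp_dual : ∀ (k : ℕ) (s : Set α), tp k (ofDual ⁻¹' s) = (tp k s).rev
  | 0, _ => rfl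
  | k + 1, s => by
    ext p
    constructor
    · rintro ⟨x, hx, rfl⟩
      refine ⟨_, ⟨ofDual x, hx, rfl⟩, ?_⟩
      simp only [← tp_dual k]
      rfl
    · rintro ⟨_, ⟨x, hx, rfl⟩, rfl⟩
      refine ⟨toDual x, hx, ?_⟩
      simp only [← tp_dual k]
      rfl

theorem tp_Ioo_toDual (k : ℕ) (x y : α) :
    tp k (Ioo (toDual x) (toDual y)) = (tp k (Ioo y x)).rev := by
  rw [← tp_dual]
  congr 1
  ext z
  exact and_comm

end Dual

section Fine

variable {α β : Type*} [LinearOrder α] [LinearOrder β]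

theorem Th_eq_iff {s : Set α} {t : Set β} : Th s = Th t ↔ ∀ k, tp k s = tp k t := funext_iff

theorem Th_union {s t : Set α} (h : ∀ x ∈ s, ∀ y ∈ t, x < y) : Th (s ∪ t) = Th s + Th t :=
  funext fun k => tp_union k h

theorem Th_split {s : Set α} {x : α} (hx : x ∈ s) :
    Th s = Th (s ∩ Iio x) + (pt + Th (s ∩ Ioi x)) :=
  funext fun k => tp_split k hx

/-- A set is fine if its bounded intervals have only finitely many theories. -/
def Fine (D : Set α) : Prop := (image2 (fun x y => Th (Ioo x y)) D D).Finite

theorem Fine.mono {D E : Set α} (h : Fine E) (hDE : D ⊆ E) : Fine D :=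
  Set.Finite.subset h (image2_subset hDE hDE)

theorem Fine.dual {D : Set α} (h : Fine D) : Fine (OrderDual.ofDual ⁻¹' D) := by
  refine (Set.Finite.image (fun T : ∀ k, EF k => fun k => (T k).rev) h).subset ?_
  rintro _ ⟨x, hx, y, hy, rfl⟩
  refine ⟨_, ⟨OrderDual.ofDual y, hy, OrderDual.ofDual x, hx, rfl⟩, ?_⟩
  funext k
  exact (tp_Ioo_toDual k (OrderDual.ofDual x) (OrderDual.ofDual y)).symm

theorem Fine.finite_upper {D : Set α} (h : Fine D) (hD : D.OrdConnected) :
    ((fun x => Th (D ∩ Ioi x)) '' D).Finite := by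
  by_contra hinf
  obtain ⟨F, hF⟩ := h.exists_finset
  obtain ⟨O, hO, hOc⟩ := Set.Infinite.exists_subset_card_eq hinf (F.card + 2)
  have hO' : ∀ t : O, ∃ x ∈ D, Th (D ∩ Ioi x) = t := fun t => hO t.2
  choose x hxD hx using hO'
  have hne : Nonempty O := by
    rw [Finset.nonempty_coe_sort, ← Finset.card_pos, hOc]; omega
  obtain ⟨m, hm⟩ := Finite.exists_max x
  classical
  obtain ⟨s, -, t, -, hst, he⟩ := Finset.exists_ne_map_eq_of_card_lt_of_maps_to
    (s := (Finset.univ : Finset O)) (t := Finset.insertNone F)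
    (f := fun t => if x t < x m then some (Th (Ioo (x t) (x m))) else none)
    (by rw [Finset.card_univ, Fintype.card_coe, hOc, Finset.card_insertNone]; omega) (by
      intro t _
      dsimp only
      split_ifs
      · exact Finset.some_mem_insertNone.2 ((hF _).2 ⟨_, hxD t, _, hxD m, rfl⟩)
      · exact Finset.none_mem_insertNone)
  have key : ∀ t, x t < x m →
      (t : ∀ k, EF k) = Th (Ioo (x t) (x m)) + (pt + Th (D ∩ Ioi (x m))) := by
    intro t ht
    have h₁ : D ∩ Ioi (x t) ∩ Iio (x m) = Ioo (x t) (x m) := by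
      ext y
      exact ⟨fun hy => ⟨hy.1.2, hy.2⟩, fun hy =>
        ⟨⟨hD.out (hxD t) (hxD m) ⟨hy.1.le, hy.2.le⟩, hy.1⟩, hy.2⟩⟩
    have h₂ : D ∩ Ioi (x t) ∩ Ioi (x m) = D ∩ Ioi (x m) := by
      ext y
      exact ⟨fun hy => ⟨hy.1.1, hy.2⟩, fun hy => ⟨⟨hy.1, ht.trans hy.2⟩, hy.2⟩⟩
    rw [← hx t, Th_split (show x m ∈ D ∩ Ioi (x t) from ⟨hxD m, ht⟩), h₁, h₂]
  apply hst
  split_ifs at he with h₁ h₂ h₂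
  · exact Subtype.ext (by rw [key s h₁, key t h₂, Option.some.inj he])
  · have : x s = x t :=
      (le_antisymm (hm s) (not_lt.1 h₁)).trans (le_antisymm (hm t) (not_lt.1 h₂)).symm
    exact Subtype.ext (by rw [← hx s, ← hx t, this])

theorem Fine.finite_lower {D : Set α} (h : Fine D) (hD : D.OrdConnected) :
    ((fun x => Th (D ∩ Iio x)) '' D).Finite := by
  refine (Set.Finite.image (fun T : ∀ k, EF k => fun k => (T k).rev)
    (h.dual.finite_upper hD.dual)).subset ?_
  rintro _ ⟨x, hx, rfl⟩
  refine ⟨_, ⟨OrderDual.toDual x, hx, rfl⟩, ?_⟩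
  funext k
  change (tp k (OrderDual.ofDual ⁻¹' (D ∩ Iio x))).rev = tp k (D ∩ Iio x)
  rw [tp_dual, EF.rev_rev]

theorem Fine.union {D E : Set α} (hD : Fine D) (hE : Fine E) (cD : D.OrdConnected)
    (cE : E.OrdConnected) (hDE : ∀ x ∈ D, ∀ y ∈ E, x < y) (cU : (D ∪ E).OrdConnected) :
    Fine (D ∪ E) := by
  refine ((Set.Finite.union hD hE).union ((((hD.finite_upper cD).image2 (· + ·) (hE.finite_lower cE))).union
    (finite_singleton (Th (∅ : Set α))))).subset ?_
  rintro _ ⟨x, hx | hx, y, hy | hy, rfl⟩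
  · exact Or.inl (Or.inl ⟨x, hx, y, hy, rfl⟩)
  · refine Or.inr (Or.inl ⟨_, ⟨x, hx, rfl⟩, _, ⟨y, hy, rfl⟩, ?_⟩)
    dsimp only
    rw [← Th_union fun a ha b hb => hDE a ha.1 b hb.1]
    congr 1
    ext z
    constructor
    · rintro (hz | hz)
      · exact ⟨hz.2, hDE _ hz.1 _ hy⟩
      · exact ⟨hDE _ hx _ hz.1, hz.2⟩
    · intro hz
      rcases cU.out (Or.inl hx) (Or.inr hy) ⟨hz.1.le, hz.2.le⟩ with h | h
      · exact Or.inl ⟨h, hz.1⟩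
      · exact Or.inr ⟨h, hz.2⟩
  · refine Or.inr (Or.inr ?_)
    rw [mem_singleton_iff]
    dsimp only
    rw [Ioo_eq_empty (hDE y hy x hx).not_gt]
  · exact Or.inl (Or.inr ⟨x, hx, y, hy, rfl⟩)

theorem exists_separating {F : Set (∀ k, EF k)} (hF : F.Finite) :
    ∃ K, ∀ {s t : Set α}, Th s ∈ F → Th t ∈ F → tp K s = tp K t → Th s = Th t := by
  have : Finite F := hF
  have h : ∀ p : F × F, ∃ k, (p.1 : ∀ k, EF k) ≠ p.2 → (p.1 : ∀ k, EF k) k ≠ p.2.1 k := by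
    intro p
    by_cases hp : (p.1 : ∀ k, EF k) = p.2
    · exact ⟨0, fun h => absurd hp h⟩
    · obtain ⟨k, hk⟩ := Function.ne_iff.1 hp
      exact ⟨k, fun _ => hk⟩
  choose κ hκ using h
  obtain ⟨K, hK⟩ := (Set.finite_range κ).bddAbove
  refine ⟨K, fun {s t} hs ht hst => ?_⟩
  by_contra hne
  exact hκ (⟨_, hs⟩, ⟨_, ht⟩) hne (tp_eq_of_le (hK ⟨_, rfl⟩) hst)

theorem Fine.exists_separating {D : Set α} (h : Fine D) : ∃ K, ∀ x ∈ D, ∀ y ∈ D, ∀ x' ∈ D,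
    ∀ y' ∈ D, tp K (Ioo x y) = tp K (Ioo x' y') → Th (Ioo x y) = Th (Ioo x' y') := by
  obtain ⟨K, hK⟩ := LinOrdTheory.exists_separating (α := α) h
  exact ⟨K, fun x hx y hy x' hx' y' hy' => hK ⟨x, hx, y, hy, rfl⟩ ⟨x', hx', y', hy', rfl⟩⟩

theorem Ioo_inter_Iio_eq {x y z : α} (h : z ∈ Ioo x y) : Ioo x y ∩ Iio z = Ioo x z := by
  ext w; exact ⟨fun hw => ⟨hw.1.1, hw.2⟩, fun hw => ⟨⟨hw.1, hw.2.trans h.2⟩, hw.2⟩⟩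

theorem Ioo_inter_Ioi_eq {x y z : α} (h : z ∈ Ioo x y) : Ioo x y ∩ Ioi z = Ioo z y := by
  ext w; exact ⟨fun hw => ⟨hw.2, hw.1.2⟩, fun hw => ⟨⟨h.1.trans hw.1, hw.2⟩, hw.1⟩⟩

theorem fine_of_det {D : Set α} (hD : D.OrdConnected) (K : ℕ)
    (h : ∀ x ∈ D, ∀ y ∈ D, ∀ x' ∈ D, ∀ y' ∈ D, tp K (Ioo x y) = tp K (Ioo x' y') →
      tp (K + 1) (Ioo x y) = tp (K + 1) (Ioo x' y')) : Fine D := by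
  have key : ∀ m, ∀ x ∈ D, ∀ y ∈ D, ∀ x' ∈ D, ∀ y' ∈ D, tp K (Ioo x y) = tp K (Ioo x' y') →
      tp m (Ioo x y) = tp m (Ioo x' y') := by
    intro m
    induction m with
    | zero => intros; rfl
    | succ m ih =>
      have aux : ∀ x ∈ D, ∀ y ∈ D, ∀ x' ∈ D, ∀ y' ∈ D, tp K (Ioo x y) = tp K (Ioo x' y') →
          ∀ z ∈ Ioo x y, ∃ w ∈ Ioo x' y', tp m (Ioo x' y' ∩ Iio w) = tp m (Ioo x y ∩ Iio z) ∧
            tp m (Ioo x' y' ∩ Ioi w) = tp m (Ioo x y ∩ Ioi z) := by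
        intro x hx y hy x' hx' y' hy' he z hz
        obtain ⟨w, hw, h₁, h₂⟩ := (tp_succ_eq_iff.1 (h x hx y hy x' hx' y' hy' he)).1 z hz
        rw [Ioo_inter_Iio_eq hz, Ioo_inter_Iio_eq hw] at h₁
        rw [Ioo_inter_Ioi_eq hz, Ioo_inter_Ioi_eq hw] at h₂
        have hzD := hD.out hx hy ⟨hz.1.le, hz.2.le⟩
        have hwD := hD.out hx' hy' ⟨hw.1.le, hw.2.le⟩
        refine ⟨w, hw, ?_, ?_⟩
        · rw [Ioo_inter_Iio_eq hz, Ioo_inter_Iio_eq hw]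
          exact ih _ hx' _ hwD _ hx _ hzD h₁
        · rw [Ioo_inter_Ioi_eq hz, Ioo_inter_Ioi_eq hw]
          exact ih _ hwD _ hy' _ hzD _ hy h₂
      intro x hx y hy x' hx' y' hy' he
      exact tp_succ_eq_iff.2 ⟨aux x hx y hy x' hx' y' hy' he, aux x' hx' y' hy' x hx y hy he.symm⟩
  classical
  let φ : EF K → ∀ k, EF k := fun t =>
    if h : ∃ x ∈ D, ∃ y ∈ D, tp K (Ioo x y) = t then Th (Ioo h.choose h.choose_spec.2.choose)
    else Th (∅ : Set α)
  refine (Set.finite_range φ).subset ?_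
  rintro _ ⟨x, hx, y, hy, rfl⟩
  have hex : ∃ x' ∈ D, ∃ y' ∈ D, tp K (Ioo x' y') = tp K (Ioo x y) := ⟨x, hx, y, hy, rfl⟩
  refine ⟨tp K (Ioo x y), ?_⟩
  simp only [φ, dif_pos hex]
  exact Th_eq_iff.2 fun k => key k _ hex.choose_spec.1 _ hex.choose_spec.2.choose_spec.1 _ hx _ hy
    hex.choose_spec.2.choose_spec.2

theorem Fine.finite_itv (h : Fine (Set.univ : Set α)) :
    (range fun p : WithBot α × WithTop α => Th (itv p.1 p.2)).Finite := by
  refine (((Set.Finite.union h (h.finite_upper ordConnected_univ)).union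
    (h.finite_lower ordConnected_univ)).union (finite_singleton (Th (Set.univ : Set α)))).subset ?_
  rintro _ ⟨⟨e, f⟩, rfl⟩
  induction e using WithBot.recBotCoe with
  | bot =>
    induction f using WithTop.recTopCoe with
    | top => exact Or.inr (by simp [itv_bot_top])
    | coe j => exact Or.inl (Or.inr ⟨j, mem_univ _, by simp [itv_bot_coe]⟩)
  | coe i =>
    induction f using WithTop.recTopCoe with
    | top => exact Or.inl (Or.inl (Or.inr ⟨i, mem_univ _, by simp [itv_coe_top]⟩))
    | coe j =>
      exact Or.inl (Or.inl (Or.inl ⟨i, mem_univ _, j, mem_univ _, by simp [itv_coe_coe]⟩))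

theorem exists_itv_tp_eq (h : ∀ k, tp k (Set.univ : Set α) = tp k (Set.univ : Set β)) (m : ℕ)
    (e : WithBot α) (f : WithTop α) :
    ∃ e' f', tp m (itv e f) = tp m (itv (e' : WithBot β) (f' : WithTop β)) := by
  have h' : ∀ k, tp k (itv (⊥ : WithBot α) ⊤) = tp k (itv (⊥ : WithBot β) ⊤) := by
    simpa only [itv_bot_top] using h
  induction e using WithBot.recBotCoe with
  | bot =>
    induction f using WithTop.recTopCoe with
    | top => exact ⟨⊥, ⊤, h' m⟩
    | coe y =>
      obtain ⟨y', -, h₁, -⟩ := tp_itv_succ_ext (h' (m + 1)) (x := y) (by simp [itv_bot_top])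
      exact ⟨⊥, y', h₁.symm⟩
  | coe x =>
    obtain ⟨x', -, -, h₂⟩ := tp_itv_succ_ext (h' (m + 2)) (x := x) (by simp [itv_bot_top])
    induction f using WithTop.recTopCoe with
    | top => exact ⟨x', ⊤, tp_eq_of_le (by omega) h₂.symm⟩
    | coe y =>
      by_cases hxy : x < y
      · obtain ⟨y', -, h₃, -⟩ := tp_itv_succ_ext h₂.symm (x := y) (by simpa [itv_coe_top])
        exact ⟨x', y', h₃.symm⟩
      · exact ⟨x', x', by rw [tp_itv_empty (not_lt.1 hxy), tp_itv_empty le_rfl]⟩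

end Fine

section BackAndForth

variable {A B : Type*} [LinearOrder A] [LinearOrder B]

theorem orderIso_of_backAndForth [Countable A] [Countable B] (G : Finset (A × B) → Prop)
    (h₀ : G ∅) (hG : ∀ s, G s → ∀ p ∈ s, ∀ q ∈ s, p.1 < q.1 ↔ p.2 < q.2)
    (hl : ∀ s, G s → ∀ a, ∃ b, ∃ t, G t ∧ s ⊆ t ∧ (a, b) ∈ t)
    (hr : ∀ s, G s → ∀ b, ∃ a, ∃ t, G t ∧ s ⊆ t ∧ (a, b) ∈ t) : Nonempty (A ≃o B) := by
  cases nonempty_encodable A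
  cases nonempty_encodable B
  let D : A ⊕ B → Order.Cofinal {s : Finset (A × B) // G s} := Sum.elim
    (fun a => ⟨{s | ∃ b, (a, b) ∈ s.1}, fun s => by
      obtain ⟨b, t, ht, hst, hb⟩ := hl s.1 s.2 a
      exact ⟨⟨t, ht⟩, ⟨b, hb⟩, hst⟩⟩)
    (fun b => ⟨{s | ∃ a, (a, b) ∈ s.1}, fun s => by
      obtain ⟨b, t, ht, hst, hb⟩ := hr s.1 s.2 b
      exact ⟨⟨t, ht⟩, ⟨b, hb⟩, hst⟩⟩)
  let I := Order.idealOfCofinals (⟨∅, h₀⟩ : {s : Finset (A × B) // G s}) D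
  have hF : ∀ a, ∃ b, ∃ s ∈ I, (a, b) ∈ s.1 := fun a => by
    obtain ⟨s, ⟨b, hb⟩, hs⟩ := Order.cofinal_meets_idealOfCofinals _ D (Sum.inl a)
    exact ⟨b, s, hs, hb⟩
  have hF' : ∀ b, ∃ a, ∃ s ∈ I, (a, b) ∈ s.1 := fun b => by
    obtain ⟨s, ⟨a, hb⟩, hs⟩ := Order.cofinal_meets_idealOfCofinals _ D (Sum.inr b)
    exact ⟨a, s, hs, hb⟩
  choose f s hs hf using hF
  choose g t ht hg using hF'
  have hcmp : ∀ a b, cmp a (g b) = cmp (f a) b := by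
    intro a b
    obtain ⟨m, -, h₁, h₂⟩ := I.directed _ (hs a) _ (ht b)
    have e₁ := hG m.1 m.2 _ (h₁ (hf a)) _ (h₂ (hg b))
    have e₂ := hG m.1 m.2 _ (h₂ (hg b)) _ (h₁ (hf a))
    dsimp only at e₁ e₂
    simp only [cmp, cmpUsing, e₁, e₂]
  exact ⟨OrderIso.ofCmpEqCmp f g hcmp⟩

/-- A point of a fine order can be matched in an equivalent order. -/
theorem typ_ext_full {ι : Type*} [Finite ι] {a : ι → A} {b : ι → B} {K : ℕ}
    (hK : ∀ (e : WithBot A) (f : WithTop A) (e' : WithBot B) (f' : WithTop B),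
      tp K (itv e f) = tp K (itv e' f') → Th (itv e f) = Th (itv e' f'))
    (h : ∀ k, typ k a = typ k b) (x : A) :
    ∃ y, ∀ k, typ k (fun o : Option ι => o.elim x a) = typ k (fun o : Option ι => o.elim y b) := by
  by_cases hx : ∃ i, a i = x
  · obtain ⟨i, rfl⟩ := hx
    refine ⟨b i, fun k => ?_⟩
    convert typ_comp (h k) (fun o : Option ι => o.elim i id) using 2 <;>
    · ext o; cases o <;> rfl
  · obtain ⟨e, he, he'⟩ := exists_nearest_below a x
    obtain ⟨f, hf, hf'⟩ := exists_nearest_above a x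
    obtain ⟨y, hy, h₁, h₂⟩ := tp_itv_succ_ext (typ_tp (h (K + 1)) e f) ⟨he, hf⟩
    refine ⟨y, fun k => typ_extend (h k) ⟨he, hf⟩ hy (fun i => ?_)
      (congrFun (hK _ _ _ _ h₁.symm) k).symm (congrFun (hK _ _ _ _ h₂.symm) k).symm⟩
    rcases lt_or_gt_of_ne fun hi => hx ⟨i, hi⟩ with hi | hi
    · exact Or.inl (he' i hi)
    · exact Or.inr (hf' i hi)

theorem Fine.orderIso [Countable A] [Countable B] (hA : Fine (Set.univ : Set A))
    (h : ∀ k, tp k (Set.univ : Set A) = tp k (Set.univ : Set B)) : Nonempty (A ≃o B) := by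
  obtain ⟨K, hK⟩ := LinOrdTheory.exists_separating (α := A) hA.finite_itv
  have hAB : ∀ (e : WithBot A) (f : WithTop A) (e' : WithBot B) (f' : WithTop B),
      tp K (itv e f) = tp K (itv e' f') → Th (itv e f) = Th (itv e' f') := by
    intro e f e' f' he
    refine Th_eq_iff.2 fun m => ?_
    obtain ⟨e₁, f₁, h₁⟩ := exists_itv_tp_eq (fun k => (h k).symm) (max m K) e' f'
    have h₂ := hK (s := itv e f) (t := itv e₁ f₁) ⟨(e, f), rfl⟩ ⟨(e₁, f₁), rfl⟩
      (he.trans (tp_eq_of_le (le_max_right _ _) h₁))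
    exact (congrFun h₂ m).trans (tp_eq_of_le (le_max_left _ _) h₁).symm
  have hBA : ∀ (e : WithBot B) (f : WithTop B) (e' : WithBot A) (f' : WithTop A),
      tp K (itv e f) = tp K (itv e' f') → Th (itv e f) = Th (itv e' f') :=
    fun e f e' f' he => (hAB e' f' e f he.symm).symm
  classical
  have hins : ∀ (s : Finset (A × B)) (p : A × B), (∀ k, typ k (fun o : Option s =>
      o.elim p.1 fun q => q.1.1) = typ k (fun o : Option s => o.elim p.2 fun q => q.1.2)) →
      ∀ k, typ k (fun q : (insert p s : Finset (A × B)) => q.1.1) =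
        typ k (fun q : (insert p s : Finset (A × B)) => q.1.2) := by
    intro s p hp k
    have := typ_comp (hp k) (fun q : (insert p s : Finset (A × B)) =>
      if hq : q.1 ∈ s then some ⟨q.1, hq⟩ else none)
    convert this using 2 <;>
    · ext q
      by_cases hq : q.1 ∈ s
      · simp [hq]
      · have hqp := (Finset.mem_insert.1 q.2).resolve_right hq
        rw [Function.comp_apply, dif_neg hq, hqp]
        rfl
  refine orderIso_of_backAndForth
    (fun s => ∀ k, typ k (fun p : s => p.1.1) = typ k (fun p : s => p.1.2)) ?_ ?_ ?_ ?_
  · refine fun k => typ_iff.2 ⟨?_, h k, ?_, ?_, ?_⟩ <;> exact fun i => absurd i.2 (Finset.notMem_empty _)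
  · exact fun s hs p hp q hq => typ_lt (hs 0) (i := ⟨p, hp⟩) (j := ⟨q, hq⟩)
  · intro s hs a
    obtain ⟨b, hb⟩ := typ_ext_full hAB hs a
    exact ⟨b, insert (a, b) s, hins s (a, b) hb, Finset.subset_insert _ _,
      Finset.mem_insert_self _ _⟩
  · intro s hs b
    obtain ⟨a, hb⟩ := typ_ext_full hBA (fun k => (hs k).symm) b
    exact ⟨a, insert (a, b) s, hins s (a, b) fun k => (hb k).symm, Finset.subset_insert _ _,
      Finset.mem_insert_self _ _⟩

end BackAndForth

section

variable {V : Type*} [LinearOrder V]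

/-- The interval between `x` and `z` looks, up to rank `k`, like the sum of the part of the order
above `x` and the part of the order below `z`. -/
def Gen (k : ℕ) (x z : V) : Prop := x < z ∧ tp k (Ioo x z) = tp k (Ioi x) + tp k (Iio z)

theorem Gen.mono_left {k : ℕ} {x' x z : V} (h : Gen k x z) (hx : x' ≤ x) : Gen k x' z := by
  rcases hx.eq_or_lt with rfl | hx
  · exact h
  · exact ⟨hx.trans h.1, by rw [tp_Ioo_eq k hx h.1, h.2, tp_Ioi_eq k hx]; simp only [add_assoc]⟩

theorem Gen.mono_right {k : ℕ} {x z z' : V} (h : Gen k x z) (hz : z ≤ z') : Gen k x z' := by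
  rcases hz.eq_or_lt with rfl | hz
  · exact h
  · exact ⟨h.1.trans hz, by rw [tp_Ioo_eq k h.1 hz, h.2, tp_Iio_eq k hz]; simp only [add_assoc]⟩

theorem Gen.mono {k : ℕ} {x' x z z' : V} (h : Gen k x z) (hx : x' ≤ x) (hz : z ≤ z') :
    Gen k x' z' :=
  (h.mono_left hx).mono_right hz

/-- The theory of the order is absorbed by the final segments and by the initial segments. -/
structure SelfAdditive (V : Type*) [LinearOrder V] : Prop where
  nontrivial : Nontrivial V
  upper : ∀ (k : ℕ) (x : V), tp k (Ioi x) + tp k (Set.univ : Set V) = tp k (Ioi x)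
  lower : ∀ (k : ℕ) (x : V), tp k (Set.univ : Set V) + tp k (Iio x) = tp k (Iio x)

/-- Every one-point type is realized cofinally. -/
def CofinalTypes (V : Type*) [LinearOrder V] : Prop :=
  ∀ (k : ℕ) (x y : V), ∃ z, y ≤ z ∧ tp k (Iio z) = tp k (Iio x) ∧ tp k (Ioi z) = tp k (Ioi x)

/-- Every one-point type is realized coinitially. -/
def CoinitialTypes (V : Type*) [LinearOrder V] : Prop :=
  ∀ (k : ℕ) (x y : V), ∃ z, z ≤ y ∧ tp k (Iio z) = tp k (Iio x) ∧ tp k (Ioi z) = tp k (Ioi x)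

theorem nonempty_iff_of_tp_one {α β : Type*} [LinearOrder α] [LinearOrder β] {s : Set α}
    {t : Set β} (h : tp 1 s = tp 1 t) : s.Nonempty ↔ t.Nonempty :=
  ⟨fun ⟨x, hx⟩ => let ⟨y, hy, _⟩ := (tp_succ_eq_iff.1 h).1 x hx; ⟨y, hy⟩,
    fun ⟨x, hx⟩ => let ⟨y, hy, _⟩ := (tp_succ_eq_iff.1 h).2 x hx; ⟨y, hy⟩⟩

theorem CoinitialTypes.noMaxOrder [Nontrivial V] (h : CoinitialTypes V) : NoMaxOrder V where
  exists_gt m := by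
    by_contra hm
    obtain ⟨y, hy⟩ := exists_ne m
    obtain ⟨z, hz, -, hz'⟩ := h 1 m y
    have hyz : ¬ (Ioi z).Nonempty := fun h' => hm ((nonempty_iff_of_tp_one hz').1 h')
    have hmy : m ≤ y := (not_lt.1 fun h' => hyz ⟨m, h'⟩).trans hz
    exact hm ⟨y, lt_of_le_of_ne hmy hy.symm⟩

theorem CofinalTypes.noMinOrder [Nontrivial V] (h : CofinalTypes V) : NoMinOrder V where
  exists_lt m := by
    by_contra hm
    obtain ⟨y, hy⟩ := exists_ne m
    obtain ⟨z, hz, hz', -⟩ := h 1 m y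
    have hyz : ¬ (Iio z).Nonempty := fun h' => hm ((nonempty_iff_of_tp_one hz').1 h')
    have hmy : y ≤ m := hz.trans (not_lt.1 fun h' => hyz ⟨m, h'⟩)
    exact hm ⟨y, lt_of_le_of_ne hmy hy⟩

/-- Everything above `x` is mirrored, up to rank `k`, by points far below `z`. -/
def MirrorUp (k : ℕ) (x z : V) : Prop := ∃ w₀, x < w₀ ∧ Gen k w₀ z ∧ ∀ w, x < w →
  ∃ u, x < u ∧ u ≤ w₀ ∧ tp k (Ioo x u) = tp k (Ioo x w) ∧ tp k (Ioi u) = tp k (Ioi w)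

/-- Everything below `z` is mirrored, up to rank `k`, by points far above `x`. -/
def MirrorDown (k : ℕ) (x z : V) : Prop := ∃ w₀, w₀ < z ∧ Gen k x w₀ ∧ ∀ w, w < z →
  ∃ u, u < z ∧ w₀ ≤ u ∧ tp k (Ioo u z) = tp k (Ioo w z) ∧ tp k (Iio u) = tp k (Iio w)

theorem MirrorUp.mono {k : ℕ} {x' x z z' : V} (h : MirrorUp k x z) (hx : x' ≤ x) (hz : z ≤ z') :
    MirrorUp k x' z' := by
  obtain ⟨w₀, h₁, h₂, h₃⟩ := h
  refine ⟨w₀, hx.trans_lt h₁, h₂.mono_right hz, fun w hw => ?_⟩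
  rcases le_or_gt w w₀ with hw₀ | hw₀
  · exact ⟨w, hw, hw₀, rfl, rfl⟩
  · obtain ⟨u, hu, hu', e₁, e₂⟩ := h₃ w (h₁.trans hw₀)
    refine ⟨u, hx.trans_lt hu, hu', ?_, e₂⟩
    rcases hx.eq_or_lt with rfl | hx
    · exact e₁
    · rw [tp_Ioo_eq k hx hu, tp_Ioo_eq k hx (h₁.trans hw₀), e₁]

theorem MirrorDown.mono {k : ℕ} {x' x z z' : V} (h : MirrorDown k x z) (hx : x' ≤ x)
    (hz : z ≤ z') : MirrorDown k x' z' := by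
  obtain ⟨w₀, h₁, h₂, h₃⟩ := h
  refine ⟨w₀, h₁.trans_le hz, h₂.mono_left hx, fun w hw => ?_⟩
  rcases le_or_gt w₀ w with hw₀ | hw₀
  · exact ⟨w, hw, hw₀, rfl, rfl⟩
  · obtain ⟨u, hu, hu', e₁, e₂⟩ := h₃ w (hw₀.trans h₁)
    refine ⟨u, hu.trans_le hz, hu', ?_, e₂⟩
    rcases hz.eq_or_lt with rfl | hz
    · exact e₁
    · rw [tp_Ioo_eq k hu hz, tp_Ioo_eq k (hw₀.trans h₁) hz, e₁]

theorem exists_mirrorUp [NoMaxOrder V] {k : ℕ} (h : ∀ x : V, ∃ z, Gen k x z) (x : V) :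
    ∃ z, MirrorUp k x z := by
  have hc : ∀ p : EF k × EF k, ∃ w, x < w ∧
      ((∃ u, x < u ∧ (tp k (Ioo x u), tp k (Ioi u)) = p) →
        (tp k (Ioo x w), tp k (Ioi w)) = p) := by
    intro p
    by_cases hp : ∃ u, x < u ∧ (tp k (Ioo x u), tp k (Ioi u)) = p
    · obtain ⟨u, hu, hu'⟩ := hp
      exact ⟨u, hu, fun _ => hu'⟩
    · obtain ⟨u, hu⟩ := exists_gt x
      exact ⟨u, hu, fun h => absurd h hp⟩
  choose w hw hw' using hc
  have : Nonempty (EF k × EF k) := ⟨0⟩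
  obtain ⟨m, hm⟩ := Finite.exists_max w
  obtain ⟨z, hz⟩ := h (w m)
  refine ⟨z, w m, hw m, hz, fun u hu => ?_⟩
  have := hw' _ ⟨u, hu, rfl⟩
  exact ⟨_, hw _, hm _, congrArg Prod.fst this, congrArg Prod.snd this⟩

theorem exists_mirrorDown [NoMinOrder V] {k : ℕ} (h : ∀ z : V, ∃ x, Gen k x z) (z : V) :
    ∃ x, MirrorDown k x z := by
  have hc : ∀ p : EF k × EF k, ∃ w, w < z ∧
      ((∃ u, u < z ∧ (tp k (Ioo u z), tp k (Iio u)) = p) →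
        (tp k (Ioo w z), tp k (Iio w)) = p) := by
    intro p
    by_cases hp : ∃ u, u < z ∧ (tp k (Ioo u z), tp k (Iio u)) = p
    · obtain ⟨u, hu, hu'⟩ := hp
      exact ⟨u, hu, fun _ => hu'⟩
    · obtain ⟨u, hu⟩ := exists_lt z
      exact ⟨u, hu, fun h => absurd h hp⟩
  choose w hw hw' using hc
  have : Nonempty (EF k × EF k) := ⟨0⟩
  obtain ⟨m, hm⟩ := Finite.exists_min w
  obtain ⟨x, hx⟩ := h (w m)
  refine ⟨x, w m, hw m, hx, fun u hu => ?_⟩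
  have := hw' _ ⟨u, hu, rfl⟩
  exact ⟨_, hw _, hm _, congrArg Prod.fst this, congrArg Prod.snd this⟩

theorem Gen.succ {k : ℕ} {x w z : V} (hxw : Gen k x w) (hwz : Gen k w z) (hu : MirrorUp k x z)
    (hd : MirrorDown k x z) : Gen (k + 1) x z := by
  refine ⟨hxw.1.trans hwz.1, ?_⟩
  ext p
  rw [EF.mem_add, trunc_tp, trunc_tp]
  have e₁ : ∀ u ∈ Ioi x, Ioi x ∩ Iio u = Ioo x u ∧ Ioi x ∩ Ioi u = Ioi u :=
    fun u hu => ⟨rfl, inter_eq_right.2 (Ioi_subset_Ioi (le_of_lt hu))⟩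
  have e₂ : ∀ u ∈ Iio z, Iio z ∩ Iio u = Iio u ∧ Iio z ∩ Ioi u = Ioo u z :=
    fun u hu => ⟨inter_eq_right.2 (Iio_subset_Iio (le_of_lt hu)), by rw [inter_comm]; rfl⟩
  constructor
  · rintro ⟨u, hu, rfl⟩
    rw [Ioo_inter_Iio_eq hu, Ioo_inter_Ioi_eq hu]
    rcases le_total u w with h | h
    · refine Or.inl ⟨_, mk_mem_tp (show u ∈ Ioi x from hu.1), ?_⟩
      rw [(e₁ u hu.1).1, (e₁ u hu.1).2, (hwz.mono_left h).2]
    · refine Or.inr ⟨_, mk_mem_tp (show u ∈ Iio z from hu.2), ?_⟩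
      rw [(e₂ u hu.2).1, (e₂ u hu.2).2, (hxw.mono_right h).2]
  · rintro (⟨_, ⟨u, hu', rfl⟩, rfl⟩ | ⟨_, ⟨u, hu', rfl⟩, rfl⟩)
    · obtain ⟨w₀, -, h₂, h₃⟩ := hu
      obtain ⟨v, hv, hv', h₄, h₅⟩ := h₃ u hu'
      have hvz := h₂.mono_left hv'
      refine ⟨v, ⟨hv, hvz.1⟩, ?_⟩
      rw [Ioo_inter_Iio_eq ⟨hv, hvz.1⟩, Ioo_inter_Ioi_eq ⟨hv, hvz.1⟩, hvz.2, h₄, h₅,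
        (e₁ u hu').1, (e₁ u hu').2]
    · obtain ⟨w₀, -, h₂, h₃⟩ := hd
      obtain ⟨v, hv, hv', h₄, h₅⟩ := h₃ u hu'
      have hvz := h₂.mono_right hv'
      refine ⟨v, ⟨hvz.1, hv⟩, ?_⟩
      rw [Ioo_inter_Iio_eq ⟨hvz.1, hv⟩, Ioo_inter_Ioi_eq ⟨hvz.1, hv⟩, hvz.2, h₄, h₅,
        (e₂ u hu').1, (e₂ u hu').2]

theorem Gen.transfer_left {k : ℕ} {x x' z : V} (h : Gen k x z)
    (h₁ : tp (k + 1) (Iio x) = tp (k + 1) (Iio x')) (h₂ : tp (k + 1) (Ioi x) = tp (k + 1) (Ioi x')) :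
    ∃ z', Gen k x' z' ∧ tp k (Iio z') = tp k (Iio z) ∧ tp k (Ioi z') = tp k (Ioi z) := by
  rw [← itv_coe_top, ← itv_coe_top] at h₂
  obtain ⟨z', hz', e₁, e₂⟩ := tp_itv_succ_ext h₂ (x := z) (by simpa [itv_coe_top] using h.1)
  have h₃ := tp_eq_of_le k.le_succ h₂
  simp only [itv_coe_top, itv_coe_coe, mem_Ioi] at hz' e₁ e₂ h₃
  have e₃ : tp k (Iio z') = tp k (Iio z) := by
    rw [tp_Iio_eq k hz', tp_Iio_eq k h.1, e₁, tp_eq_of_le k.le_succ h₁]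
  exact ⟨z', ⟨hz', by rw [e₁, h.2, h₃, e₃]⟩, e₃, e₂⟩

theorem Gen.transfer_right {k : ℕ} {x z z' : V} (h : Gen k x z)
    (h₁ : tp (k + 1) (Iio z) = tp (k + 1) (Iio z')) (h₂ : tp (k + 1) (Ioi z) = tp (k + 1) (Ioi z')) :
    ∃ x', Gen k x' z' ∧ tp k (Iio x') = tp k (Iio x) ∧ tp k (Ioi x') = tp k (Ioi x) := by
  rw [← itv_bot_coe, ← itv_bot_coe] at h₁
  obtain ⟨x', hx', e₁, e₂⟩ := tp_itv_succ_ext h₁ (x := x) (by simpa [itv_bot_coe] using h.1)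
  have h₃ := tp_eq_of_le k.le_succ h₁
  simp only [itv_bot_coe, itv_coe_coe, mem_Iio] at hx' e₁ e₂ h₃
  have e₃ : tp k (Ioi x') = tp k (Ioi x) := by
    rw [tp_Ioi_eq k hx', tp_Ioi_eq k h.1, e₂, tp_eq_of_le k.le_succ h₂]
  exact ⟨x', ⟨hx', by rw [e₂, h.2, h₃, e₃]⟩, e₁, e₃⟩

theorem exists_gen [Nontrivial V] (hup : CofinalTypes V) (hdn : CoinitialTypes V) (k : ℕ) :
    (∀ x : V, ∃ z, Gen k x z) ∧ ∀ z : V, ∃ x, Gen k x z := by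
  have := hdn.noMaxOrder
  have := hup.noMinOrder
  induction k with
  | zero =>
    exact ⟨fun x => (exists_gt x).imp fun z hz => ⟨hz, rfl⟩,
      fun x => (exists_lt x).imp fun z hz => ⟨hz, rfl⟩⟩
  | succ k ih =>
    have key : ∀ x₀ z₀ : V, ∃ x z : V, Gen (k + 1) x z ∧
        tp (k + 2) (Iio x) = tp (k + 2) (Iio x₀) ∧ tp (k + 2) (Ioi x) = tp (k + 2) (Ioi x₀) ∧
        tp (k + 2) (Iio z) = tp (k + 2) (Iio z₀) ∧ tp (k + 2) (Ioi z) = tp (k + 2) (Ioi z₀) := by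
      intro x₀ z₀
      obtain ⟨w, hw⟩ := ih.1 x₀
      obtain ⟨z₁, hz₁⟩ := exists_mirrorUp ih.1 x₀
      obtain ⟨z₂, hz₂⟩ := ih.1 w
      obtain ⟨z, hz, e₁, e₂⟩ := hup (k + 2) z₀ (max z₁ z₂)
      obtain ⟨x₂, hx₂⟩ := exists_mirrorDown ih.2 z
      obtain ⟨x, hx, e₃, e₄⟩ := hdn (k + 2) x₀ (min x₀ x₂)
      have hx₀ := hx.trans (min_le_left _ _)
      exact ⟨x, z, Gen.succ (hw.mono_left hx₀) (hz₂.mono_right ((le_max_right _ _).trans hz))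
        (hz₁.mono hx₀ ((le_max_left _ _).trans hz)) (hx₂.mono (hx.trans (min_le_right _ _)) le_rfl),
        e₃, e₄, e₁, e₂⟩
    refine ⟨fun x₀ => ?_, fun z₀ => ?_⟩
    · obtain ⟨x, z, h, e₁, e₂, -, -⟩ := key x₀ x₀
      obtain ⟨z', h', -⟩ := h.transfer_left e₁ e₂
      exact ⟨z', h'⟩
    · obtain ⟨x, z, h, -, -, e₁, e₂⟩ := key z₀ z₀
      obtain ⟨z', h', -⟩ := h.transfer_right e₁ e₂
      exact ⟨z', h'⟩

theorem selfAdditive_of_cofinalTypes [Nontrivial V] (hup : CofinalTypes V)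
    (hdn : CoinitialTypes V) : SelfAdditive V where
  nontrivial := ‹_›
  upper k x := by
    obtain ⟨z, hz⟩ := (exists_gen hup hdn k).1 x
    rw [tp_univ_eq k z, ← add_assoc, ← hz.2, ← tp_Ioi_eq k hz.1]
  lower k z := by
    obtain ⟨x, hz⟩ := (exists_gen hup hdn k).2 z
    rw [tp_univ_eq k x, add_assoc, add_assoc, ← hz.2, ← tp_Iio_eq k hz.1]

theorem SelfAdditive.of_Th_eq {W : Type*} [LinearOrder W] (hV : SelfAdditive V)
    (h : ∀ k, tp k (Set.univ : Set V) = tp k (Set.univ : Set W)) : SelfAdditive W := by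
  have key : ∀ k (x : W), ∃ y : V, tp k (Iio y) = tp k (Iio x) ∧ tp k (Ioi y) = tp k (Ioi x) := by
    intro k x
    obtain ⟨y, -, h₁, h₂⟩ := (tp_succ_eq_iff.1 (h (k + 1))).2 x (mem_univ x)
    rw [univ_inter, univ_inter] at h₁ h₂
    exact ⟨y, h₁, h₂⟩
  refine ⟨?_, fun k x => ?_, fun k x => ?_⟩
  · obtain ⟨a, b, hab⟩ := @exists_pair_lt V hV.nontrivial _
    obtain ⟨y, -, h₁, -⟩ := (tp_succ_eq_iff.1 (h 2)).1 b (mem_univ b)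
    rw [univ_inter, univ_inter] at h₁
    obtain ⟨x, hx⟩ := (nonempty_iff_of_tp_one h₁).2 ⟨a, hab⟩
    exact ⟨x, y, ne_of_lt hx⟩
  · obtain ⟨y, -, h₂⟩ := key k x
    rw [← h₂, ← h k, hV.upper]
  · obtain ⟨y, h₁, -⟩ := key k x
    rw [← h₁, ← h k, hV.lower]

end

section

variable {α β : Type*} [LinearOrder α] [LinearOrder β]

/-- The rank `k` type of a point. -/
def pty (k : ℕ) (x : α) : EF k × EF k := (tp k (Iio x), tp k (Ioi x))

theorem pty_eq_iff {k : ℕ} {x : α} {y : β} :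
    pty k x = pty k y ↔ tp k (Iio x) = tp k (Iio y) ∧ tp k (Ioi x) = tp k (Ioi y) := Prod.ext_iff

theorem pty_of_typ {ι : Type*} {k : ℕ} {a : ι → α} {b : ι → β} (h : typ k a = typ k b) (i : ι) :
    pty k (a i) = pty k (b i) := pty_eq_iff.2 ⟨typ_Iio h i, typ_Ioi h i⟩

theorem pty_mono {k m : ℕ} (hkm : k ≤ m) {x : α} {y : β} (h : pty m x = pty m y) :
    pty k x = pty k y :=
  pty_eq_iff.2 ⟨tp_eq_of_le hkm (pty_eq_iff.1 h).1, tp_eq_of_le hkm (pty_eq_iff.1 h).2⟩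

theorem tp_univ_of_pty {k : ℕ} {x : α} {y : β} (h : pty k x = pty k y) :
    tp k (Set.univ : Set α) = tp k (Set.univ : Set β) := by
  rw [tp_univ_eq k x, tp_univ_eq k y, (pty_eq_iff.1 h).1, (pty_eq_iff.1 h).2]

theorem typ_unit_iff {k : ℕ} {x : α} {y : β} :
    typ k (fun _ : Unit => x) = typ k (fun _ : Unit => y) ↔ pty k x = pty k y :=
  ⟨fun h => pty_of_typ h (), fun h => typ_iff.2 ⟨by simp, tp_univ_of_pty h,
    fun _ => (pty_eq_iff.1 h).1, fun _ => (pty_eq_iff.1 h).2, by simp⟩⟩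

/-- The rank `k` types of points occurring from `x` on. -/
def upTypes (k : ℕ) (x : α) : Set (EF k × EF k) := pty k '' Ici x

/-- The rank `k` types of points occurring up to `x`. -/
def downTypes (k : ℕ) (x : α) : Set (EF k × EF k) := pty k '' Iic x

theorem upTypes_subset {k : ℕ} {x : α} {y : β} (h : pty (k + 1) x = pty (k + 1) y) :
    upTypes k x ⊆ upTypes k y := by
  rintro _ ⟨z, hz, rfl⟩
  obtain ⟨h₁, h₂⟩ := pty_eq_iff.1 h
  rcases (mem_Ici.1 hz).eq_or_lt with rfl | hz
  · exact ⟨y, le_rfl, (pty_mono k.le_succ h).symm⟩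
  · rw [← itv_coe_top, ← itv_coe_top] at h₂
    obtain ⟨w, hw, e₁, e₂⟩ := tp_itv_succ_ext h₂ (x := z) (by simpa [itv_coe_top] using hz)
    simp only [itv_coe_top, itv_coe_coe, mem_Ioi] at hw e₁ e₂
    refine ⟨w, le_of_lt hw, pty_eq_iff.2 ⟨?_, e₂⟩⟩
    rw [tp_Iio_eq k hw, tp_Iio_eq k hz, e₁, tp_eq_of_le k.le_succ h₁]

theorem upTypes_eq {k : ℕ} {x : α} {y : β} (h : pty (k + 1) x = pty (k + 1) y) :
    upTypes k x = upTypes k y := (upTypes_subset h).antisymm (upTypes_subset h.symm)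

theorem downTypes_subset {k : ℕ} {x : α} {y : β} (h : pty (k + 1) x = pty (k + 1) y) :
    downTypes k x ⊆ downTypes k y := by
  rintro _ ⟨z, hz, rfl⟩
  obtain ⟨h₁, h₂⟩ := pty_eq_iff.1 h
  rcases (mem_Iic.1 hz).eq_or_lt with rfl | hz
  · exact ⟨y, le_rfl, (pty_mono k.le_succ h).symm⟩
  · rw [← itv_bot_coe, ← itv_bot_coe] at h₁
    obtain ⟨w, hw, e₁, e₂⟩ := tp_itv_succ_ext h₁ (x := z) (by simpa [itv_bot_coe] using hz)
    simp only [itv_bot_coe, itv_coe_coe, mem_Iio] at hw e₁ e₂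
    refine ⟨w, le_of_lt hw, pty_eq_iff.2 ⟨e₁, ?_⟩⟩
    rw [tp_Ioi_eq k hw, tp_Ioi_eq k hz, e₂, tp_eq_of_le k.le_succ h₂]

theorem downTypes_eq {k : ℕ} {x : α} {y : β} (h : pty (k + 1) x = pty (k + 1) y) :
    downTypes k x = downTypes k y := (downTypes_subset h).antisymm (downTypes_subset h.symm)

theorem upTypes_antitone (k : ℕ) : Antitone (upTypes k : α → _) :=
  fun _ _ h => image_mono (Ici_subset_Ici.2 h)

theorem downTypes_monotone (k : ℕ) : Monotone (downTypes k : α → _) :=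
  fun _ _ h => image_mono (Iic_subset_Iic.2 h)

theorem trunc_pty (k : ℕ) : Prod.map EF.trunc EF.trunc ∘ pty (k + 1) = (pty k : α → _) := by
  funext x
  simp [pty, trunc_tp]

theorem upTypes_trunc (k : ℕ) (x : α) :
    upTypes k x = Prod.map EF.trunc EF.trunc '' upTypes (k + 1) x := by
  rw [upTypes, upTypes, ← image_comp, trunc_pty]

theorem downTypes_trunc (k : ℕ) (x : α) :
    downTypes k x = Prod.map EF.trunc EF.trunc '' downTypes (k + 1) x := by
  rw [downTypes, downTypes, ← image_comp, trunc_pty]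

/-- The points which see the same rank `k` types of points above and below as `b`. -/
def level (k : ℕ) (b : β) : Set α := {x | upTypes k x = upTypes k b ∧ downTypes k x = downTypes k b}

/-- The points which see the same types of points above and below as `b`. -/
def core (b : β) : Set α := {x | ∀ k, x ∈ level k b}

theorem level_eq {γ : Type*} [LinearOrder γ] {k : ℕ} {x : α} {y : β}
    (h : pty (k + 1) x = pty (k + 1) y) : (level k x : Set γ) = level k y := by
  rw [level, level, upTypes_eq h, downTypes_eq h]

theorem mem_level_congr {γ : Type*} [LinearOrder γ] {k : ℕ} {x : α} {y : β} {b : γ}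
    (h : pty (k + 1) x = pty (k + 1) y) : x ∈ level k b ↔ y ∈ level k b := by
  simp only [level, mem_ofPred_eq, upTypes_eq h, downTypes_eq h]

theorem mem_core_congr {γ : Type*} [LinearOrder γ] {x : α} {y : β} {b : γ}
    (h : ∀ k, pty k x = pty k y) : x ∈ core b ↔ y ∈ core b :=
  forall_congr' fun k => mem_level_congr (h (k + 1))

theorem ordConnected_level (k : ℕ) (b : β) : (level k b : Set α).OrdConnected := by
  refine ⟨fun x hx z hz y hy => ⟨?_, ?_⟩⟩
  · exact ((upTypes_antitone k hy.1).trans_eq hx.1).antisymm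
      (hz.1.symm.le.trans (upTypes_antitone k hy.2))
  · exact ((downTypes_monotone k hy.2).trans_eq hz.2).antisymm
      (hx.2.symm.le.trans (downTypes_monotone k hy.1))

theorem ordConnected_core (b : β) : (core b : Set α).OrdConnected :=
  ⟨fun _ hx _ hz _ hy k => (ordConnected_level k b).out (hx k) (hz k) hy⟩

theorem level_antitone (b : β) : Antitone fun k => (level k b : Set α) := by
  refine antitone_nat_of_succ_le fun k x hx => ⟨?_, ?_⟩
  · rw [upTypes_trunc, hx.1, ← upTypes_trunc]
  · rw [downTypes_trunc, hx.2, ← downTypes_trunc]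

theorem mem_level_self (k : ℕ) (x : α) : x ∈ level k x := ⟨rfl, rfl⟩

theorem mem_core_self (x : α) : x ∈ core x := fun k => mem_level_self k x

theorem fine_of_rank (ρ : α → ℕ) (hρ : Monotone ρ) {B : ℕ} (hB : ∀ x, ρ x < B)
    (h : ∀ r, Fine {x | ρ x = r}) : Fine (Set.univ : Set α) := by
  have conn : ∀ R, {x | ρ x < R}.OrdConnected := fun R =>
    ⟨fun x _ z hz y hy => (hρ hy.2).trans_lt hz⟩
  have key : ∀ R, Fine {x | ρ x < R} := by
    intro R
    induction R with
    | zero => exact (h 0).mono fun x hx => absurd hx (Nat.not_lt_zero _)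
    | succ R ih =>
      have e : {x | ρ x < R + 1} = {x | ρ x < R} ∪ {x | ρ x = R} := by
        ext x
        simp only [mem_ofPred_eq, mem_union]
        omega
      rw [e]
      refine ih.union (h R) (conn R) ⟨fun x hx z hz y hy => ?_⟩ (fun x hx y hy => ?_) (e ▸ conn _)
      · exact le_antisymm ((hρ hy.2).trans_eq hz) (hx.symm.le.trans (hρ hy.1))
      · refine lt_of_not_ge fun hyx => ?_
        have h₁ := hρ hyx
        simp only [mem_ofPred_eq] at hx hy
        omega
  exact (key B).mono fun x _ => hB x

theorem exists_not_fine_level (h : ¬ Fine (Set.univ : Set α)) (k : ℕ) :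
    ∃ x : α, ¬ Fine (level k x : Set α) := by
  by_contra! hf
  have hC : ∀ s : Set (EF k × EF k), s.ncard ≤ Nat.card (EF k × EF k) := fun s => by
    rw [← ncard_univ]
    exact ncard_le_ncard (subset_univ s) (toFinite _)
  set C := Nat.card (EF k × EF k)
  have hu : ∀ {x y : α}, x ≤ y → (upTypes k y).ncard ≤ (upTypes k x).ncard := fun hxy =>
    ncard_le_ncard (upTypes_antitone k hxy) (toFinite _)
  have hd : ∀ {x y : α}, x ≤ y → (downTypes k x).ncard ≤ (downTypes k y).ncard := fun hxy =>
    ncard_le_ncard (downTypes_monotone k hxy) (toFinite _)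
  refine h (fine_of_rank (fun x => (downTypes k x).ncard + (C - (upTypes k x).ncard))
    (fun x y hxy => ?_) (B := 2 * C + 1) (fun x => ?_) fun r => ?_)
  · have := hu hxy
    have := hd hxy
    simp only
    omega
  · have := hC (upTypes k x)
    have := hC (downTypes k x)
    omega
  · by_cases hr : ∃ x : α, (downTypes k x).ncard + (C - (upTypes k x).ncard) = r
    · obtain ⟨x, rfl⟩ := hr
      refine (hf x).mono fun y hy => ?_
      have h₁ := hC (upTypes k x)
      have h₂ := hC (upTypes k y)
      simp only [mem_ofPred_eq] at hy
      rcases le_total x y with hxy | hxy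
      · have h₃ := hu hxy
        have h₄ := hd hxy
        exact ⟨eq_of_subset_of_ncard_le (upTypes_antitone k hxy) (by omega) (toFinite _),
          (eq_of_subset_of_ncard_le (downTypes_monotone k hxy) (by omega) (toFinite _)).symm⟩
      · have h₃ := hu hxy
        have h₄ := hd hxy
        exact ⟨(eq_of_subset_of_ncard_le (upTypes_antitone k hxy) (by omega) (toFinite _)).symm,
          eq_of_subset_of_ncard_le (downTypes_monotone k hxy) (by omega) (toFinite _)⟩
    · exact (hf (Classical.choice (not_isEmpty_iff.1 fun _ => h (by
        rw [Fine]; simp [Set.univ_eq_empty_iff.2 ‹_›])))).mono fun y hy => absurd ⟨y, hy⟩ hr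

theorem Sat.exists_core_not_fine (hS : Sat α) (h : ¬ Fine (Set.univ : Set α)) :
    ∃ b : α, ¬ Fine (core b : Set α) := by
  choose y hy using exists_not_fine_level h
  obtain ⟨b, hb, -⟩ := hS.finite fun k (_ : Unit) => y k
  have hlev : ∀ n, ¬ Fine (level n (b ()) : Set α) := by
    intro n hn
    obtain ⟨k, hk, hnk⟩ := ((hb (n + 1)).and (eventually_ge n)).exists
    rw [← level_eq (pty_of_typ hk ())] at hn
    exact hy k (hn.mono (level_antitone _ hnk))
  refine ⟨b (), fun hf => ?_⟩
  obtain ⟨K, hK⟩ := hf.exists_separating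
  have : ∀ n, ∃ q : Fin 4 → α, (∀ i, q i ∈ (level n (b ()) : Set α)) ∧
      tp K (Ioo (q 0) (q 1)) = tp K (Ioo (q 2) (q 3)) ∧
      tp (K + 1) (Ioo (q 0) (q 1)) ≠ tp (K + 1) (Ioo (q 2) (q 3)) := by
    intro n
    by_contra! hq
    refine hlev n (fine_of_det (ordConnected_level _ _) K fun x hx y hy x' hx' y' hy' he => ?_)
    exact hq ![x, y, x', y'] (by simp [Fin.forall_fin_succ, *]) he
  choose q hq₁ hq₂ hq₃ using this
  obtain ⟨c, hc, -⟩ := hS.finite q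
  have hcN : ∀ i, c i ∈ (core (b ()) : Set α) := by
    intro i n
    obtain ⟨k, hk, hnk⟩ := ((hc (n + 1)).and (eventually_ge n)).exists
    exact (mem_level_congr (pty_of_typ hk i)).1 (level_antitone _ hnk (hq₁ k i))
  obtain ⟨k, hk⟩ := (hc (K + 1)).exists
  have h₁ := typ_mono K.le_succ hk
  refine hq₃ k ?_
  rw [typ_Ioo hk, typ_Ioo hk]
  refine Th_eq_iff.1 (hK _ (hcN 0) _ (hcN 1) _ (hcN 2) _ (hcN 3) ?_) _
  rw [← typ_Ioo h₁, ← typ_Ioo h₁, hq₂]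

theorem Sat.tp_inter_itv (hS : Sat α) {N : Set α}
    (hN : ∀ {x y : α}, (∀ k, pty k x = pty k y) → x ∈ N → y ∈ N) (k : ℕ) :
    ∀ {ι : Type} [Finite ι] {a a' : ι → α}, (∀ k, typ k a = typ k a') →
      ∀ (e : WithBot ι) (f : WithTop ι),
      tp k (N ∩ itv (e.map a) (f.map a)) = tp k (N ∩ itv (e.map a') (f.map a')) := by
  induction k with
  | zero => intros; exact Subsingleton.elim _ _
  | succ k ih =>
    have key : ∀ {ι : Type} [Finite ι] {a a' : ι → α}, (∀ k, typ k a = typ k a') →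
      ∀ (e : WithBot ι) (f : WithTop ι), ∀ x ∈ N ∩ itv (e.map a) (f.map a),
      ∃ y ∈ N ∩ itv (e.map a') (f.map a'),
        tp k (N ∩ itv (e.map a') (f.map a') ∩ Iio y) = tp k (N ∩ itv (e.map a) (f.map a) ∩ Iio x) ∧
        tp k (N ∩ itv (e.map a') (f.map a') ∩ Ioi y) =
          tp k (N ∩ itv (e.map a) (f.map a) ∩ Ioi x) := by
      intro ι _ a a' h e f x hx
      obtain ⟨y, hy⟩ := hS.ext h x
      have hyi : y ∈ itv (e.map a') (f.map a') := by
        constructor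
        · induction e using WithBot.recBotCoe with
          | bot => simp
          | coe e =>
            have := hx.2.1
            rw [WithBot.map_coe, WithBot.coe_lt_coe] at this ⊢
            exact (typ_lt (hy 0) (i := some e) (j := none)).1 this
        · induction f using WithTop.recTopCoe with
          | top => simp
          | coe e =>
            have := hx.2.2
            rw [WithTop.map_coe, WithTop.coe_lt_coe] at this ⊢
            exact (typ_lt (hy 0) (i := none) (j := some e)).1 this
      refine ⟨y, ⟨hN (fun k => pty_of_typ (hy k) none) hx.1, hyi⟩, ?_, ?_⟩
      · rw [inter_assoc, inter_assoc, itv_inter_Iio hx.2.2, itv_inter_Iio hyi.2]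
        have := ih hy (e.map some) ((none : Option ι) : WithTop (Option ι))
        rw [WithBot.map_map, WithBot.map_map] at this
        exact this.symm
      · rw [inter_assoc, inter_assoc, itv_inter_Ioi hx.2.1, itv_inter_Ioi hyi.1]
        have := ih hy ((none : Option ι) : WithBot (Option ι)) (f.map some)
        rw [WithTop.map_map, WithTop.map_map] at this
        exact this.symm
    intro ι _ a a' h e f
    exact tp_succ_eq_iff.2 ⟨key h e f, key (fun k => (h k).symm) e f⟩

theorem tp_subtype_Iio (k : ℕ) {N : Set α} (x : N) : tp k (Iio x) = tp k (N ∩ Iio (x : α)) := by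
  rw [← tp_coe]
  congr 1
  ext y
  exact ⟨fun ⟨z, hz, hzy⟩ => hzy ▸ ⟨z.2, hz⟩, fun hy => ⟨⟨y, hy.1⟩, hy.2, rfl⟩⟩

theorem tp_subtype_Ioi (k : ℕ) {N : Set α} (x : N) : tp k (Ioi x) = tp k (N ∩ Ioi (x : α)) := by
  rw [← tp_coe]
  congr 1
  ext y
  exact ⟨fun ⟨z, hz, hzy⟩ => hzy ▸ ⟨z.2, hz⟩, fun hy => ⟨⟨y, hy.1⟩, hy.2, rfl⟩⟩

theorem Sat.pty_core (hS : Sat α) {b : α} {x y : (core b : Set α)}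
    (h : ∀ k, pty k (x : α) = pty k (y : α)) (k : ℕ) : pty k x = pty k y := by
  have key := hS.tp_inter_itv (N := core b) (fun h => (mem_core_congr h).1) k
    fun k => typ_unit_iff.2 (h k)
  refine pty_eq_iff.2 ⟨?_, ?_⟩
  · have := key ⊥ (() : Unit)
    simp only [WithBot.map_bot, WithTop.map_coe, itv_bot_coe] at this
    rw [tp_subtype_Iio, tp_subtype_Iio, this]
  · have := key (() : Unit) ⊤
    simp only [WithTop.map_top, WithBot.map_coe, itv_coe_top] at this
    rw [tp_subtype_Ioi, tp_subtype_Ioi, this]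

theorem Sat.cofinalTypes_core (hS : Sat α) (b : α) : CofinalTypes (core b : Set α) := by
  intro k x y
  have : ∀ k, pty k x.1 ∈ upTypes k y.1 := fun k => by
    rw [(y.2 k).1, ← (x.2 k).1]
    exact mem_image_of_mem _ le_rfl
  choose z hz hz' using this
  obtain ⟨c, hc, hc'⟩ := hS.finite fun k => ![z k, y.1]
  have hc₁ : c 1 = y.1 := hc' 1 _ fun _ => rfl
  have hcx : ∀ k, pty k (c 0) = pty k x.1 := by
    intro n
    obtain ⟨k, hk, hnk⟩ := ((hc n).and (eventually_ge n)).exists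
    rw [← pty_of_typ hk 0]
    exact pty_mono hnk (hz' k)
  obtain ⟨n, hn⟩ := (hc 0).exists
  have hle : y.1 ≤ c 0 := by
    rw [← hc₁]
    exact (typ_le hn (i := 1) (j := 0)).1 (hz n)
  have := hS.pty_core (x := ⟨c 0, (mem_core_congr hcx).2 x.2⟩) (y := x) hcx k
  exact ⟨_, hle, pty_eq_iff.1 this⟩

theorem Sat.coinitialTypes_core (hS : Sat α) (b : α) : CoinitialTypes (core b : Set α) := by
  intro k x y
  have : ∀ k, pty k x.1 ∈ downTypes k y.1 := fun k => by
    rw [(y.2 k).2, ← (x.2 k).2]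
    exact mem_image_of_mem _ le_rfl
  choose z hz hz' using this
  obtain ⟨c, hc, hc'⟩ := hS.finite fun k => ![z k, y.1]
  have hc₁ : c 1 = y.1 := hc' 1 _ fun _ => rfl
  have hcx : ∀ k, pty k (c 0) = pty k x.1 := by
    intro n
    obtain ⟨k, hk, hnk⟩ := ((hc n).and (eventually_ge n)).exists
    rw [← pty_of_typ hk 0]
    exact pty_mono hnk (hz' k)
  obtain ⟨n, hn⟩ := (hc 0).exists
  have hle : c 0 ≤ y.1 := by
    rw [← hc₁]
    exact (typ_le hn (i := 0) (j := 1)).1 (hz n)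
  have := hS.pty_core (x := ⟨c 0, (mem_core_congr hcx).2 x.2⟩) (y := x) hcx k
  exact ⟨_, hle, pty_eq_iff.1 this⟩

theorem tp_subtype_Ioo (k : ℕ) {N : Set α} (hN : N.OrdConnected) (x y : N) :
    tp k (Ioo x y) = tp k (Ioo (x : α) y) := by
  rw [← tp_coe]
  congr 1
  ext z
  simp only [mem_image, mem_Ioo, Subtype.exists, exists_and_right, exists_eq_right]
  exact ⟨fun ⟨_, h⟩ => h, fun h => ⟨hN.out x.2 y.2 ⟨h.1.le, h.2.le⟩, h⟩⟩

theorem fine_subtype_univ {N : Set α} (hN : N.OrdConnected) :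
    Fine (Set.univ : Set N) ↔ Fine N := by
  rw [Fine, Fine]
  refine iff_of_eq (congrArg _ ?_)
  ext T
  constructor
  · rintro ⟨x, -, y, -, rfl⟩
    exact ⟨x, x.2, y, y.2, funext fun k => (tp_subtype_Ioo k hN x y).symm⟩
  · rintro ⟨x, hx, y, hy, rfl⟩
    exact ⟨⟨x, hx⟩, mem_univ _, ⟨y, hy⟩, mem_univ _, funext fun k => tp_subtype_Ioo k hN _ _⟩

theorem fine_of_subsingleton [Subsingleton α] (D : Set α) : Fine D := by
  refine (finite_singleton (Th (∅ : Set α))).subset ?_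
  rintro _ ⟨x, -, y, -, rfl⟩
  rw [Subsingleton.elim x y]
  simp

theorem Sat.exists_selfAdditive_core (hS : Sat α) (h : ¬ Fine (Set.univ : Set α)) :
    ∃ b : α, SelfAdditive (core b : Set α) ∧ ¬ Fine (Set.univ : Set (core b : Set α)) := by
  obtain ⟨b, hb⟩ := hS.exists_core_not_fine h
  rw [← fine_subtype_univ (ordConnected_core b)] at hb
  have : Nontrivial (core b : Set α) := by
    by_contra hn
    rw [not_nontrivial_iff_subsingleton] at hn
    exact hb (fine_of_subsingleton _)
  exact ⟨b, selfAdditive_of_cofinalTypes (hS.cofinalTypes_core b) (hS.coinitialTypes_core b), hb⟩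

end

section

variable {V : Type*} [LinearOrder V]

/-- The interval between `x` and `z` has the theory of the sum of the part of the order
above `x` and the part of the order below `z`. -/
def Far (x z : V) : Prop := ∀ k, Gen k x z

theorem Far.lt {x z : V} (h : Far x z) : x < z := (h 0).1

theorem Far.mono {x' x z z' : V} (h : Far x z) (hx : x' ≤ x) (hz : z ≤ z') : Far x' z' :=
  fun k => (h k).mono hx hz

theorem gen_of_typ {W ι : Type*} [LinearOrder W] {k : ℕ} {a : ι → V} {b : ι → W}
    (h : typ k a = typ k b) {i j : ι} (hg : Gen k (a i) (a j)) : Gen k (b i) (b j) :=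
  ⟨(typ_lt h).1 hg.1, by rw [← typ_Ioo h, ← typ_Ioi h, ← typ_Iio h, hg.2]⟩

theorem far_of_typ {W ι : Type*} [LinearOrder W] {a : ι → V} {b : ι → W}
    (h : ∀ k, typ k a = typ k b) {i j : ι} (hg : Far (a i) (a j)) : Far (b i) (b j) :=
  fun k => gen_of_typ (h k) (hg k)

theorem tp_succ_add_mem {k : ℕ} {S T : EF (k + 1)} {x : V} {s : Set V}
    (h : tp (k + 1) s = S + (tp (k + 1) (Set.univ : Set V) + T)) :
    ∃ w ∈ s, tp k (s ∩ Iio w) = S.trunc + tp k (Iio x) ∧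
      tp k (s ∩ Ioi w) = tp k (Ioi x) + T.trunc := by
  have hp : (S.trunc + tp k (Iio x), tp k (Ioi x) + T.trunc) ∈ tp (k + 1) s := by
    rw [h, EF.mem_add]
    refine Or.inr ⟨(tp k (Iio x), tp k (Ioi x) + T.trunc), ?_, rfl⟩
    rw [EF.mem_add]
    exact Or.inl ⟨(tp k (Iio x), tp k (Ioi x)), ⟨x, mem_univ x, by simp⟩, rfl⟩
  obtain ⟨w, hw, e⟩ := mem_tp.1 hp
  exact ⟨w, hw, (congrArg Prod.fst e).symm, (congrArg Prod.snd e).symm⟩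

theorem SelfAdditive.pty_eq_of_gen (hV : SelfAdditive V) {k : ℕ} {x w p : V} (hxw : x < w)
    (h₁ : tp k (Ioo x w) = tp k (Ioi x) + tp k (Iio p))
    (h₂ : tp k (Ioi w) = tp k (Ioi p)) : pty k w = pty k p := by
  refine pty_eq_iff.2 ⟨?_, h₂⟩
  refine Eq.trans ?_ (hV.lower k p)
  rw [tp_Iio_eq k hxw, h₁, tp_univ_eq k x]
  simp only [add_assoc]

theorem SelfAdditive.exists_above (hV : SelfAdditive V) (k : ℕ) (x p : V) :
    ∃ w, x < w ∧ tp k (Ioo x w) = tp k (Ioi x) + tp k (Iio p) ∧ pty k w = pty k p := by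
  have h : tp (k + 1) (Ioi x) = tp (k + 1) (Ioi x) + (tp (k + 1) (Set.univ : Set V) + 0) := by
    rw [add_zero, hV.upper]
  obtain ⟨w, hw, e₁, e₂⟩ := tp_succ_add_mem (x := p) h
  rw [← tp_empty (α := V), trunc_tp, tp_empty, add_zero,
    inter_eq_right.2 (Ioi_subset_Ioi (le_of_lt hw))] at e₂
  rw [trunc_tp, Ioi_inter_Iio] at e₁
  exact ⟨w, hw, e₁, hV.pty_eq_of_gen hw e₁ e₂⟩

theorem SelfAdditive.exists_below (hV : SelfAdditive V) (k : ℕ) (z p : V) :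
    ∃ w, w < z ∧ tp k (Ioo w z) = tp k (Ioi p) + tp k (Iio z) ∧ pty k w = pty k p := by
  have h : tp (k + 1) (Iio z) = 0 + (tp (k + 1) (Set.univ : Set V) + tp (k + 1) (Iio z)) := by
    rw [zero_add, hV.lower]
  obtain ⟨w, hw, e₁, e₂⟩ := tp_succ_add_mem (x := p) h
  rw [← tp_empty (α := V), trunc_tp, tp_empty, zero_add,
    inter_eq_right.2 (Iio_subset_Iio (le_of_lt hw))] at e₁
  rw [trunc_tp, Iio_inter_Ioi] at e₂
  refine ⟨w, hw, e₂, pty_eq_iff.2 ⟨e₁, ?_⟩⟩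
  refine Eq.trans ?_ (hV.upper k p)
  rw [tp_Ioi_eq k hw, e₂, tp_univ_eq k z]
  simp only [add_assoc]

theorem SelfAdditive.exists_between (hV : SelfAdditive V) {k : ℕ} {x y : V} (h : Gen (k + 1) x y)
    (p : V) : ∃ w ∈ Ioo x y, tp k (Ioo x w) = tp k (Ioi x) + tp k (Iio p) ∧
      pty k w = pty k p := by
  have e := h.2
  rw [← hV.lower] at e
  obtain ⟨w, hw, e₁, e₂⟩ := tp_succ_add_mem (x := p) e
  rw [trunc_tp, Ioo_inter_Iio_eq hw] at e₁
  rw [trunc_tp, Ioo_inter_Ioi_eq hw] at e₂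
  refine ⟨w, hw, e₁, hV.pty_eq_of_gen hw.1 e₁ ?_⟩
  refine Eq.trans ?_ (hV.upper k p)
  rw [tp_Ioi_eq k hw.2, e₂, tp_univ_eq k y]
  simp only [add_assoc]

theorem tp_add_of_le {k m : ℕ} (h : k ≤ m) {s t u : Set V} (e : tp m s = tp m t + tp m u) :
    tp k s = tp k t + tp k u := by
  induction h with
  | refl => exact e
  | step _ ih =>
    refine ih ?_
    rw [← trunc_tp, e, EF.trunc_add, trunc_tp, trunc_tp]

theorem finite_image_of_det {X Y Z : Type*} [Finite Y] {S : Set X} {g : X → Z} (f : X → Y)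
    (h : ∀ a ∈ S, ∀ b ∈ S, f a = f b → g a = g b) : (g '' S).Finite := by
  rcases isEmpty_or_nonempty X with hX | hX
  · rw [eq_empty_of_isEmpty S, image_empty]
    exact finite_empty
  refine ((toFinite (f '' S)).image (g ∘ Function.invFunOn f S)).subset ?_
  rintro _ ⟨a, ha, rfl⟩
  have hex : ∃ b ∈ S, f b = f a := ⟨a, ha, rfl⟩
  exact ⟨f a, ⟨a, ha, rfl⟩, h _ (Function.invFunOn_mem hex) _ ha (Function.invFunOn_eq hex)⟩

/-- Equality of the complete types of two pairs. -/
def PairEquiv {W : Type*} [LinearOrder W] (x y : V) (x' y' : W) : Prop :=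
  ∀ k, typ k ![x, y] = typ k ![x', y']

theorem PairEquiv.symm {W : Type*} [LinearOrder W] {x y : V} {x' y' : W}
    (h : PairEquiv x y x' y') : PairEquiv x' y' x y := fun k => (h k).symm

theorem PairEquiv.trans {W X : Type*} [LinearOrder W] [LinearOrder X] {x y : V} {x' y' : W}
    {x'' y'' : X} (h : PairEquiv x y x' y') (h' : PairEquiv x' y' x'' y'') :
    PairEquiv x y x'' y'' := fun k => (h k).trans (h' k)

theorem pty_fst {W : Type*} [LinearOrder W] {x y : V} {x' y' : W} {k : ℕ}
    (h : typ k ![x, y] = typ k ![x', y']) : pty k x = pty k x' := pty_of_typ h 0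

theorem pty_snd {W : Type*} [LinearOrder W] {x y : V} {x' y' : W} {k : ℕ}
    (h : typ k ![x, y] = typ k ![x', y']) : pty k y = pty k y' := pty_of_typ h 1

theorem typ_diag {W : Type*} [LinearOrder W] {x : V} {x' : W} {k : ℕ}
    (h : pty k x = pty k x') : typ k ![x, x] = typ k ![x', x'] := by
  have := typ_comp (typ_unit_iff.2 h) (fun _ : Fin 2 => ())
  convert this using 2 <;> ext i <;> fin_cases i <;> rfl

/-- The pair is approximated by pairs of another complete type. -/
def NonisolatedPair (x y : V) : Prop :=
  ∀ k, ∃ x₁ y₁ : V, typ k ![x₁, y₁] = typ k ![x, y] ∧ ¬ PairEquiv x₁ y₁ x y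

/-- Pairs of points which are far apart and have the type of `x` are approximated by pairs
of points of the type of `x` which are not far apart. -/
def NonisolatedFar (x : V) : Prop :=
  ∀ k, ∃ x₁ x₂ : V, x₁ < x₂ ∧ (∀ m, pty m x₁ = pty m x) ∧ (∀ m, pty m x₂ = pty m x) ∧
    tp k (Ioo x₁ x₂) = tp k (Ioi x) + tp k (Iio x) ∧ ¬ Far x₁ x₂

theorem SelfAdditive.exists_nonisolated (hV : SelfAdditive V) (hS : Sat V)
    (hF : ¬ Fine (Set.univ : Set V)) : ∃ x y : V, x ≤ y ∧ ¬ Far x y ∧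
      (NonisolatedPair x y ∨ x = y ∧ NonisolatedFar x) := by
  by_contra! hcon
  have not_far_self : ∀ x : V, ¬ Far x x := fun x h => lt_irrefl x h.lt
  have h₁ : ∀ x y : V, x ≤ y → ¬ Far x y → ∃ k, ∀ x₁ y₁ : V,
      typ k ![x₁, y₁] = typ k ![x, y] → PairEquiv x₁ y₁ x y := by
    intro x y hxy hf
    simpa [NonisolatedPair] using (hcon x y hxy hf).1
  have h₂ : ∀ x : V, ∃ k, ∀ x₁ x₂ : V, x₁ < x₂ → (∀ m, pty m x₁ = pty m x) →
      (∀ m, pty m x₂ = pty m x) → tp k (Ioo x₁ x₂) = tp k (Ioi x) + tp k (Iio x) →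
      Far x₁ x₂ := by
    intro x
    simpa [NonisolatedFar] using (hcon x x le_rfl (not_far_self x)).2 rfl
  have h₃ : ∀ x : V, ∃ k, ∀ x₁ : V, pty k x₁ = pty k x → ∀ m, pty m x₁ = pty m x := by
    intro x
    obtain ⟨k, hk⟩ := h₁ x x le_rfl (not_far_self x)
    exact ⟨k, fun x₁ h m => pty_fst (hk x₁ x₁ (typ_diag h) m)⟩
  obtain ⟨K, hK⟩ : ∃ K, ∀ x y x' y' : V, x ≤ y → ¬ Far x y →
      typ K ![x, y] = typ K ![x', y'] → PairEquiv x y x' y' := by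
    by_contra! hno
    choose x y x' y' hxy hf he hne using hno
    obtain ⟨b, hb, -⟩ := hS.finite fun k => ![x k, y k]
    have hb' : b = ![b 0, b 1] := by ext i; fin_cases i <;> rfl
    rw [hb'] at hb
    set p := b 0
    set q := b 1
    have hpq : p ≤ q := by
      obtain ⟨k, hk⟩ := (hb 0).exists
      exact (typ_le hk (i := 0) (j := 1)).1 (hxy k)
    by_cases hfar : Far p q
    · obtain ⟨k₁, hk₁⟩ := h₂ p
      obtain ⟨k₂, hk₂⟩ := h₃ p
      set k := max k₁ k₂
      obtain ⟨n, hn⟩ := (hb (k + 1)).exists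
      have hn' := typ_mono k.le_succ hn
      have hg : Gen (k + 1) (x n) (y n) := gen_of_typ (i := 0) (j := 1) hn.symm (hfar _)
      obtain ⟨w, hw, e₁, e₂⟩ := hV.exists_between hg p
      refine hf n ((hk₁ (x n) w hw.1 (hk₂ _ ?_) (hk₂ _ ?_) ?_).mono le_rfl hw.2.le)
      · exact pty_mono (le_max_right _ _) (pty_fst hn')
      · exact pty_mono (le_max_right _ _) e₂
      · rw [(pty_eq_iff.1 (pty_fst hn')).2] at e₁
        exact tp_add_of_le (le_max_left k₁ k₂) e₁
    · obtain ⟨k, hk⟩ := h₁ p q hpq hfar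
      obtain ⟨n, hn, hkn⟩ := ((hb k).and (eventually_ge k)).exists
      exact hne n ((hk _ _ hn).trans (hk _ _ ((typ_mono hkn (he n)).symm.trans hn)).symm)
  have hnear : ((fun p : V × V => Th (Ioo p.1 p.2)) '' {p | p.1 ≤ p.2 ∧ ¬ Far p.1 p.2}).Finite :=
    finite_image_of_det (fun p : V × V => typ K ![p.1, p.2]) fun a ha b _ hab =>
      Th_eq_iff.2 fun k => typ_Ioo (hK _ _ _ _ ha.1 ha.2 hab k) 0 1
  have hpt : ∀ {x y : V}, pty K x = pty K y → ∀ m, pty m x = pty m y := fun h m =>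
    pty_fst (hK _ _ _ _ le_rfl (not_far_self _) (typ_diag h) m)
  have hup : ((fun x : V => Th (Ioi x)) '' Set.univ).Finite :=
    finite_image_of_det (pty K) fun a _ b _ hab => Th_eq_iff.2 fun k => (pty_eq_iff.1 (hpt hab k)).2
  have hdn : ((fun x : V => Th (Iio x)) '' Set.univ).Finite :=
    finite_image_of_det (pty K) fun a _ b _ hab => Th_eq_iff.2 fun k => (pty_eq_iff.1 (hpt hab k)).1
  refine hF (((hnear.union (hup.image2 (· + ·) hdn)).union
    (finite_singleton (Th (∅ : Set V)))).subset ?_)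
  rintro _ ⟨x, -, y, -, rfl⟩
  rcases le_total y x with h | h
  · refine Or.inr ?_
    simp only [Ioo_eq_empty h.not_gt, mem_singleton_iff]
  · by_cases hf : Far x y
    · exact Or.inl (Or.inr ⟨_, ⟨x, mem_univ x, rfl⟩, _, ⟨y, mem_univ y, rfl⟩,
        funext fun k => (hf k).2.symm⟩)
    · exact Or.inl (Or.inl ⟨(x, y), ⟨h, hf⟩, rfl⟩)

end

section

variable {α β V : Type*} [LinearOrder α] [LinearOrder β] [LinearOrder V]

theorem typ_ext_fin {K : ℕ} : ∀ (n : ℕ) {κ : Type} [Finite κ] {c : κ → α} {c' : κ → β},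
    typ (K + n) c = typ (K + n) c' → ∀ a : Fin n → α, ∃ a' : Fin n → β,
      typ K (Sum.elim c a) = typ K (Sum.elim c' a')
  | 0, κ, _, c, c', h, a => by
    refine ⟨Fin.elim0, ?_⟩
    have h' : typ K c = typ K c' := h
    convert typ_comp h' (fun i : κ ⊕ Fin 0 => i.elim id Fin.elim0) using 2 <;>
    · ext i
      rcases i with i | i
      · rfl
      · exact i.elim0
  | n + 1, κ, _, c, c', h, a => by
    obtain ⟨y, hy⟩ := typ_ext (k := K + n) h (a 0)
    obtain ⟨a', ha'⟩ := typ_ext_fin n hy (Fin.tail a)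
    refine ⟨Fin.cons y a', ?_⟩
    convert typ_comp ha' (fun i : κ ⊕ Fin (n + 1) => i.elim (fun j => Sum.inl (some j))
      (Fin.cons (Sum.inl none) Sum.inr : Fin (n + 1) → Option κ ⊕ Fin n)) using 2 <;>
    · ext i
      rcases i with i | i
      · rfl
      · refine Fin.cases ?_ (fun j => ?_) i <;> rfl

/-- A set containing witnesses for all intervals with end points in it. -/
def TarskiVaught (W : Set V) : Prop :=
  ∀ (e : WithBot W) (f : WithTop W) (k : ℕ), ∀ x ∈ itv (e.map Subtype.val) (f.map Subtype.val),
    ∃ y : W, (y : V) ∈ itv (e.map Subtype.val) (f.map Subtype.val) ∧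
      tp k (itv (e.map Subtype.val) (y : V)) = tp k (itv (e.map Subtype.val) x) ∧
      tp k (itv (y : V) (f.map Subtype.val)) = tp k (itv x (f.map Subtype.val))

theorem mem_itv_val {W : Set V} {e : WithBot W} {f : WithTop W} {y : W} :
    (y : V) ∈ itv (e.map Subtype.val) (f.map Subtype.val) ↔ y ∈ itv e f := by
  rw [mem_itv, mem_itv]
  refine and_congr ?_ ?_
  · induction e using WithBot.recBotCoe with
    | bot => simp
    | coe e => simp
  · induction f using WithTop.recTopCoe with
    | top => simp
    | coe f => simp

theorem TarskiVaught.tp_itv {W : Set V} (hW : TarskiVaught W) (k : ℕ) (e : WithBot W)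
    (f : WithTop W) : tp k (itv e f) = tp k (itv (e.map Subtype.val) (f.map Subtype.val)) := by
  induction k generalizing e f with
  | zero => exact Subsingleton.elim _ _
  | succ k ih =>
    refine tp_succ_eq_iff.2 ⟨fun x hx => ⟨x, mem_itv_val.2 hx, ?_⟩, fun x hx => ?_⟩
    · have hx' := mem_itv_val.2 hx
      rw [itv_inter_Iio hx.2, itv_inter_Iio hx'.2, itv_inter_Ioi hx.1, itv_inter_Ioi hx'.1, ih, ih]
      exact ⟨rfl, rfl⟩
    · obtain ⟨y, hy, h₁, h₂⟩ := hW e f k x hx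
      have hy' := mem_itv_val.1 hy
      refine ⟨y, hy', ?_⟩
      rw [itv_inter_Iio hx.2, itv_inter_Iio hy'.2, itv_inter_Ioi hx.1, itv_inter_Ioi hy'.1, ih, ih]
      exact ⟨h₁, h₂⟩

theorem TarskiVaught.typ {ι : Type*} {W : Set V} (hW : TarskiVaught W) (k : ℕ) (a : ι → W) :
    typ k a = LinOrdTheory.typ k fun i => (a i : V) := by
  refine typ_eq_iff.2 ⟨fun i j => Iff.rfl, fun e f => ?_⟩
  rw [hW.tp_itv, WithBot.map_map, WithTop.map_map]
  rfl

theorem TarskiVaught.tp_univ {W : Set V} (hW : TarskiVaught W) (k : ℕ) :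
    tp k (Set.univ : Set W) = tp k (Set.univ : Set V) :=
  typ_univ (hW.typ k (Empty.elim : Empty → W))

theorem TarskiVaught.pty {W : Set V} (hW : TarskiVaught W) (k : ℕ) (x : W) :
    pty k x = LinOrdTheory.pty k (x : V) :=
  pty_of_typ (hW.typ k fun _ : Unit => x) ()

theorem tarskiVaught_range {b : ℕ → V}
    (hb : ∀ n x, ∃ j, typ n (fun o : Option (Fin n) => o.elim x fun i => b i) =
      typ n (fun o : Option (Fin n) => o.elim (b j) fun i => b i)) : TarskiVaught (range b) := by
  intro e f k x hx
  choose r hr using fun w : range b => w.2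
  obtain ⟨n, hkn, he, hf⟩ : ∃ n, k ≤ n ∧ (∀ i : range b, e = i → r i < n) ∧
      ∀ i : range b, f = i → r i < n := by
    obtain ⟨n₁, h₁⟩ : ∃ n, ∀ i : range b, e = i → r i < n := by
      induction e using WithBot.recBotCoe with
      | bot => exact ⟨0, by simp⟩
      | coe e => exact ⟨r e + 1, fun i hi => by rw [WithBot.coe_inj.1 hi]; omega⟩
    obtain ⟨n₂, h₂⟩ : ∃ n, ∀ i : range b, f = i → r i < n := by
      induction f using WithTop.recTopCoe with
      | top => exact ⟨0, by simp⟩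
      | coe e => exact ⟨r e + 1, fun i hi => by rw [WithTop.coe_inj.1 hi]; omega⟩
    exact ⟨k + n₁ + n₂, by omega, fun i hi => by have := h₁ i hi; omega,
      fun i hi => by have := h₂ i hi; omega⟩
  obtain ⟨e', he'⟩ : ∃ e' : WithBot (Fin n), e'.map (fun i : Fin n => b i) = e.map Subtype.val := by
    induction e using WithBot.recBotCoe with
    | bot => exact ⟨⊥, rfl⟩
    | coe e => exact ⟨((⟨r e, he e rfl⟩ : Fin n) : WithBot (Fin n)), by simp [hr]⟩
  obtain ⟨f', hf'⟩ : ∃ f' : WithTop (Fin n), f'.map (fun i : Fin n => b i) = f.map Subtype.val := by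
    induction f using WithTop.recTopCoe with
    | top => exact ⟨⊤, rfl⟩
    | coe f => exact ⟨((⟨r f, hf f rfl⟩ : Fin n) : WithTop (Fin n)), by simp [hr]⟩
  rw [← he', ← hf'] at hx ⊢
  obtain ⟨j, hj⟩ := hb n x
  refine ⟨⟨b j, j, rfl⟩, ⟨?_, ?_⟩, ?_, ?_⟩
  · have := hx.1
    induction e' using WithBot.recBotCoe with
    | bot => simp
    | coe i =>
      rw [WithBot.map_coe, WithBot.coe_lt_coe] at this ⊢
      exact (typ_lt hj (i := some i) (j := none)).1 this
  · have := hx.2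
    induction f' using WithTop.recTopCoe with
    | top => simp
    | coe i =>
      rw [WithTop.map_coe, WithTop.coe_lt_coe] at this ⊢
      exact (typ_lt hj (i := none) (j := some i)).1 this
  · have := typ_tp (typ_mono hkn hj) (e'.map some) ((none : Option (Fin n)) : WithTop _)
    rw [WithBot.map_map, WithBot.map_map] at this
    exact this.symm
  · have := typ_tp (typ_mono hkn hj) ((none : Option (Fin n)) : WithBot _) (f'.map some)
    rw [WithTop.map_map, WithTop.map_map] at this
    exact this.symm

theorem exists_countable_tarskiVaught (V : Type*) [LinearOrder V] :
    ∃ W : Set V, W.Countable ∧ TarskiVaught W := by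
  classical
  rcases isEmpty_or_nonempty V with hV | ⟨⟨v₀⟩⟩
  · exact ⟨∅, countable_empty, fun e f k x => isEmptyElim x⟩
  have key : ∀ (e : WithBot V) (f : WithTop V) (q : Σ k, EF k × EF k), ∃ y,
      (∃ x ∈ itv e f, q.2 = (tp q.1 (itv e x), tp q.1 (itv x f))) →
        y ∈ itv e f ∧ q.2 = (tp q.1 (itv e y), tp q.1 (itv y f)) := by
    intro e f q
    by_cases h : ∃ x ∈ itv e f, q.2 = (tp q.1 (itv e x), tp q.1 (itv x f))
    · exact h.imp fun x hx _ => hx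
    · exact ⟨v₀, fun h' => absurd h' h⟩
  choose w hw using key
  let step : Set V → Set V := fun S => S ∪
    range fun p : WithBot S × WithTop S × (Σ k, EF k × EF k) =>
      w (p.1.map Subtype.val) (p.2.1.map Subtype.val) p.2.2
  let S : ℕ → Set V := fun n => step^[n] ∅
  have hS : ∀ n, S (n + 1) = step (S n) := fun n => Function.iterate_succ_apply' _ _ _
  have hmono : Monotone S := monotone_nat_of_le_succ fun n => by
    rw [hS]; exact subset_union_left
  have hc : ∀ n, (S n).Countable := by
    intro n
    induction n with
    | zero => exact countable_empty
    | succ n ih =>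
      rw [hS]
      have : Countable (S n) := ih
      have : Countable (WithBot (S n)) := inferInstanceAs (Countable (Option (S n)))
      have : Countable (WithTop (S n)) := inferInstanceAs (Countable (Option (S n)))
      exact ih.union (countable_range _)
  refine ⟨⋃ n, S n, countable_iUnion hc, fun e f k x hx => ?_⟩
  choose r hr using fun v : ↥(⋃ n, S n) => mem_iUnion.1 v.2
  obtain ⟨n₁, h₁⟩ : ∃ n, ∀ m ≥ n, ∃ e' : WithBot (S m),
      e'.map Subtype.val = e.map Subtype.val := by
    induction e using WithBot.recBotCoe with
    | bot => exact ⟨0, fun m _ => ⟨⊥, rfl⟩⟩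
    | coe e => exact ⟨r e, fun m hm => ⟨((⟨e, hmono hm (hr e)⟩ : S m) : WithBot (S m)), rfl⟩⟩
  obtain ⟨n₂, h₂⟩ : ∃ n, ∀ m ≥ n, ∃ f' : WithTop (S m),
      f'.map Subtype.val = f.map Subtype.val := by
    induction f using WithTop.recTopCoe with
    | top => exact ⟨0, fun m _ => ⟨⊤, rfl⟩⟩
    | coe e => exact ⟨r e, fun m hm => ⟨((⟨e, hmono hm (hr e)⟩ : S m) : WithTop (S m)), rfl⟩⟩
  obtain ⟨e', he'⟩ := h₁ (max n₁ n₂) (le_max_left _ _)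
  obtain ⟨f', hf'⟩ := h₂ (max n₁ n₂) (le_max_right _ _)
  set q : Σ k, EF k × EF k :=
    ⟨k, tp k (itv (e.map Subtype.val) x), tp k (itv x (f.map Subtype.val))⟩ with hq
  obtain ⟨hy, hy'⟩ := hw (e.map Subtype.val) (f.map Subtype.val) q ⟨x, hx, rfl⟩
  refine ⟨⟨w (e.map Subtype.val) (f.map Subtype.val) q, mem_iUnion.2 ⟨max n₁ n₂ + 1, ?_⟩⟩, hy,
    (congrArg Prod.fst hy').symm, (congrArg Prod.snd hy').symm⟩
  rw [hS, ← he', ← hf']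
  exact Or.inr ⟨(e', f', q), rfl⟩

end

section

variable {V : Type*} [LinearOrder V]

/-- A finite approximation to a sequence starting with the two given points: a sequence, which
matters only up to the type of an initial part of it. -/
structure Approx (x₀ y₀ : V) where
  /-- the sequence -/
  seq : ℕ → V
  /-- the rank up to which the sequence matters -/
  rank : ℕ
  seq_zero : seq 0 = x₀
  seq_one : seq 1 = y₀

instance (x₀ y₀ : V) : Preorder (Approx x₀ y₀) where
  le a b := a.rank ≤ b.rank ∧ sty a.rank a.seq = sty a.rank b.seq
  le_refl a := ⟨le_rfl, rfl⟩
  le_trans _ _ _ h h' := ⟨h.1.trans h'.1, h.2.trans (sty_mono h.1 h'.2)⟩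

theorem typ_four {n : ℕ} {a b : ℕ → V} (h : sty n a = sty n b) {i j : ℕ} (hn : 1 < n) (hi : i < n)
    (hj : j < n) : typ n (Sum.elim ![a 0, a 1] ![a i, a j]) =
      typ n (Sum.elim ![b 0, b 1] ![b i, b j]) := by
  have := typ_comp h (Sum.elim ![(⟨0, by omega⟩ : Fin n), ⟨1, hn⟩] ![⟨i, hi⟩, ⟨j, hj⟩])
  convert this using 2 <;>
  · ext s
    rcases s with s | s <;> fin_cases s <;> rfl

/-- The approximations which force that no point with the given type over the first `n` terms
exists, or else contain such a point. -/
def witnessing (x₀ y₀ : V) (n : ℕ)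
    (p : (Option (Fin n) → Option (Fin n) → Prop) ×
      (WithBot (Option (Fin n)) → WithTop (Option (Fin n)) → EF n)) : Order.Cofinal (Approx x₀ y₀) where
  carrier := {a | n + 1 ≤ a.rank ∧
    ∀ x, typ n (fun o : Option (Fin n) => o.elim x fun i => a.seq i) = p →
      ∃ j < a.rank, typ n (fun o : Option (Fin n) => o.elim (a.seq j) fun i => a.seq i) = p}
  isCofinal a := by
    classical
    set k := max a.rank (n + 2)
    by_cases h : ∃ x, typ n (fun o : Option (Fin n) => o.elim x fun i => a.seq i) = p
    · obtain ⟨x, hx⟩ := h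
      have hup : ∀ i < k, Function.update a.seq k x i = a.seq i := fun i hi =>
        Function.update_of_ne hi.ne _ _
      have hup' : (fun i : Fin n => Function.update a.seq k x i) = fun i : Fin n => a.seq i := by
        ext i; exact hup i (by omega)
      refine ⟨⟨Function.update a.seq k x, k + 1, ?_, ?_⟩, ⟨by simp only; omega, fun _ _ => ⟨k, ?_⟩⟩,
        ?_, ?_⟩
      · rw [hup 0 (by omega), a.seq_zero]
      · rw [hup 1 (by omega), a.seq_one]
      · simp only [hup']
        exact ⟨by omega, by simpa using hx⟩
      · simp only; omega
      · refine congrArg (typ _) ?_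
        ext i
        exact (hup i (by omega)).symm
    · push Not at h
      exact ⟨⟨a.seq, k, a.seq_zero, a.seq_one⟩, ⟨by simp only; omega, fun x hx => absurd hx (h x)⟩,
        le_max_left _ _, rfl⟩

/-- The approximations which force that the pair of terms with indices `i` and `j` does not have
the property `Ψ`. -/
def omitting (x₀ y₀ : V) (Ψ : V → V → Prop)
    (h : ∀ (M : ℕ) (x' y' : V), ∃ (x'' y'' : V) (K : ℕ),
      typ M (Sum.elim ![x₀, y₀] ![x', y']) = typ M (Sum.elim ![x₀, y₀] ![x'', y'']) ∧
      ∀ x y : V, typ K (Sum.elim ![x₀, y₀] ![x'', y'']) = typ K (Sum.elim ![x₀, y₀] ![x, y]) →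
        ¬ Ψ x y) (i j : ℕ) : Order.Cofinal (Approx x₀ y₀) where
  carrier := {a | ∀ b : Approx x₀ y₀, sty a.rank a.seq = sty a.rank b.seq → ¬ Ψ (b.seq i) (b.seq j)}
  isCofinal a := by
    classical
    obtain ⟨k, hk, hi, hj, hk₁⟩ : ∃ k, a.rank ≤ k ∧ i < k ∧ j < k ∧ 1 < k :=
      ⟨a.rank + i + j + 2, by omega, by omega, by omega, by omega⟩
    obtain ⟨x'', y'', K, h₁, h₂⟩ := h (k + k) (a.seq i) (a.seq j)
    obtain ⟨a', ha'⟩ := typ_ext_fin k h₁ fun i => a.seq i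
    let s : ℕ → V := fun n => if hn : n < k then a' ⟨n, hn⟩ else x₀
    have hs : ∀ n (hn : n < k), s n = a' ⟨n, hn⟩ := fun n hn => dif_pos hn
    have hs₀ : s 0 = x₀ := (hs 0 (by omega)).trans <|
      (typ_eq ha' (i := Sum.inr ⟨0, by omega⟩) (j := Sum.inl (Sum.inl 0))).1 a.seq_zero
    have hs₁ : s 1 = y₀ := (hs 1 (by omega)).trans <|
      (typ_eq ha' (i := Sum.inr ⟨1, by omega⟩) (j := Sum.inl (Sum.inl 1))).1 a.seq_one
    have hsi : s i = x'' := (hs i hi).trans <|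
      (typ_eq ha' (i := Sum.inr ⟨i, hi⟩) (j := Sum.inl (Sum.inr 0))).1 rfl
    have hsj : s j = y'' := (hs j hj).trans <|
      (typ_eq ha' (i := Sum.inr ⟨j, hj⟩) (j := Sum.inl (Sum.inr 1))).1 rfl
    have hsa : sty k a.seq = sty k s := by
      refine (typ_comp ha' Sum.inr).trans (congrArg (typ _) ?_)
      ext n
      exact (hs n n.2).symm
    refine ⟨⟨s, max k K, hs₀, hs₁⟩, fun b hb => ?_, hk.trans (le_max_left _ _), sty_mono hk hsa⟩
    refine h₂ _ _ ?_
    have := typ_four hb (hk₁.trans_le (le_max_left _ _)) (hi.trans_le (le_max_left _ _))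
      (hj.trans_le (le_max_left _ _))
    simp only at this
    rw [hs₀, hs₁, hsi, hsj, b.seq_zero, b.seq_one] at this
    exact typ_mono (le_max_right _ _) this

theorem Sat.exists_omitting (hS : Sat V) (x₀ y₀ : V) (Ψ : Bool → V → V → Prop)
    (h : ∀ (s : Bool) (M : ℕ) (x' y' : V), ∃ (x'' y'' : V) (K : ℕ),
      typ M (Sum.elim ![x₀, y₀] ![x', y']) = typ M (Sum.elim ![x₀, y₀] ![x'', y'']) ∧
      ∀ x y : V, typ K (Sum.elim ![x₀, y₀] ![x'', y'']) = typ K (Sum.elim ![x₀, y₀] ![x, y]) →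
        ¬ Ψ s x y) :
    ∃ W : Set V, W.Countable ∧ x₀ ∈ W ∧ y₀ ∈ W ∧ TarskiVaught W ∧
      ∀ s, ∀ x ∈ W, ∀ y ∈ W, ¬ Ψ s x y := by
  let ι := (Bool × ℕ × ℕ) ⊕ Σ n : ℕ, (Option (Fin n) → Option (Fin n) → Prop) ×
      (WithBot (Option (Fin n)) → WithTop (Option (Fin n)) → EF n)
  let _ : Encodable ι := Encodable.ofCountable ι
  let D : ι → Order.Cofinal (Approx x₀ y₀) := Sum.elim
    (fun q => omitting x₀ y₀ (Ψ q.1) (h q.1) q.2.1 q.2.2) fun q => witnessing x₀ y₀ q.1 q.2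
  let p₀ : Approx x₀ y₀ := ⟨fun n => if n = 0 then x₀ else y₀, 0, if_pos rfl, if_neg one_ne_zero⟩
  let s := Order.sequenceOfCofinals p₀ D
  have hs : Monotone s := Order.sequenceOfCofinals.monotone p₀ D
  have hD : ∀ i : ι, s (Encodable.encode i + 1) ∈ D i := Order.sequenceOfCofinals.encode_mem p₀ D
  obtain ⟨b, hb, hb'⟩ := hS fun k => (s k).seq
  have hb₀ : b 0 = x₀ := hb' 0 _ fun k => (s k).seq_zero
  have hb₁ : b 1 = y₀ := hb' 1 _ fun k => (s k).seq_one
  have hsb : ∀ n, sty (s n).rank (s n).seq = sty (s n).rank b := by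
    intro n
    obtain ⟨k, hk, hnk⟩ := ((hb (s n).rank).and (eventually_ge n)).exists
    exact (hs hnk).2.trans hk
  refine ⟨range b, countable_range b, ⟨0, hb₀⟩, ⟨1, hb₁⟩, tarskiVaught_range fun n x => ?_, ?_⟩
  · set p := typ n (fun o : Option (Fin n) => o.elim x fun i => b i) with hp
    obtain ⟨h₁, h₂⟩ := hD (Sum.inr ⟨n, p⟩)
    set a := s (Encodable.encode (Sum.inr ⟨n, p⟩ : ι) + 1)
    have hab : sty a.rank a.seq = sty a.rank b := hsb _
    replace h₁ : n + 1 ≤ a.rank := h₁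
    obtain ⟨y, hy⟩ := typ_ext (typ_mono h₁ (typ_comp hab.symm
      fun i : Fin n => (⟨i, by omega⟩ : Fin a.rank))) x
    obtain ⟨j, hj, hj'⟩ := h₂ y hy.symm
    refine ⟨j, hj'.symm.trans ?_⟩
    have := typ_comp hab fun o : Option (Fin n) =>
      o.elim (⟨j, hj⟩ : Fin a.rank) fun i => ⟨i, by omega⟩
    convert typ_mono (by omega : n ≤ a.rank) this using 2 <;>
    · ext o
      cases o <;> rfl
  · rintro t _ ⟨i, rfl⟩ _ ⟨j, rfl⟩
    exact hD (Sum.inl (t, i, j)) ⟨b, 0, hb₀, hb₁⟩ (hsb _)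

theorem gen_of_typ_four {k : ℕ} {x₀ y₀ x y x' y' : V}
    (h : typ k (Sum.elim ![x₀, y₀] ![x, y]) = typ k (Sum.elim ![x₀, y₀] ![x', y'])) :
    typ k ![x, y] = typ k ![x', y'] ∧ (Gen k y₀ x' → Gen k y₀ x) ∧ (Gen k y' x₀ → Gen k y x₀) :=
  ⟨typ_comp h Sum.inr, gen_of_typ (i := Sum.inl 1) (j := Sum.inr 0) h.symm,
    gen_of_typ (i := Sum.inr 1) (j := Sum.inl 0) h.symm⟩

theorem exists_isolating_of_not {x₀ y₀ x y : V} {s : Bool}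
    (h : ¬ (PairEquiv x y x₀ y₀ ∧ if s then Far y₀ x else Far y x₀)) :
    ∃ K, ∀ x' y' : V, typ K (Sum.elim ![x₀, y₀] ![x, y]) = typ K (Sum.elim ![x₀, y₀] ![x', y']) →
      ¬ (PairEquiv x' y' x₀ y₀ ∧ if s then Far y₀ x' else Far y' x₀) := by
  by_cases hp : PairEquiv x y x₀ y₀
  · cases s
    · have : ¬ Far y x₀ := fun hf => h ⟨hp, hf⟩
      rw [Far] at this
      push Not at this
      obtain ⟨K, hK⟩ := this
      exact ⟨K, fun x' y' e h' => hK ((gen_of_typ_four e).2.2 (h'.2 K))⟩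
    · have : ¬ Far y₀ x := fun hf => h ⟨hp, hf⟩
      rw [Far] at this
      push Not at this
      obtain ⟨K, hK⟩ := this
      exact ⟨K, fun x' y' e h' => hK ((gen_of_typ_four e).2.1 (h'.2 K))⟩
  · rw [PairEquiv] at hp
    push Not at hp
    obtain ⟨K, hK⟩ := hp
    exact ⟨K, fun x' y' e h' => hK ((gen_of_typ_four e).1.trans (h'.1 K))⟩

theorem typ_pair {W : Type*} [LinearOrder W] {k : ℕ} {x y : V} {x' y' : W}
    (hxy : x < y) (hxy' : x' < y') (hx : pty k x = pty k x') (hy : pty k y = pty k y')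
    (h : tp k (Ioo x y) = tp k (Ioo x' y')) : typ k ![x, y] = typ k ![x', y'] := by
  refine typ_iff.2 ⟨?_, tp_univ_of_pty hx, ?_, ?_, ?_⟩
  · simp [Fin.forall_fin_two, hxy, hxy', hxy.not_gt, hxy'.not_gt]
  · simp [Fin.forall_fin_two, (pty_eq_iff.1 hx).1, (pty_eq_iff.1 hy).1]
  · simp [Fin.forall_fin_two, (pty_eq_iff.1 hx).2, (pty_eq_iff.1 hy).2]
  · simp [Fin.forall_fin_two, hxy.not_gt, h]

theorem typ_glue_pairs {k : ℕ} {x₀ y₀ x y x' y' : V} (h₀ : x₀ ≤ y₀) (hxy : x ≤ y)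
    (h : typ k ![x, y] = typ k ![x', y']) (hlt : y₀ < x) (hlt' : y₀ < x')
    (e : tp k (Ioo y₀ x) = tp k (Ioo y₀ x')) :
    typ k (Sum.elim ![x₀, y₀] ![x, y]) = typ k (Sum.elim ![x₀, y₀] ![x', y']) :=
  typ_glue rfl h (c := 1) (d := 0) (by simp [Fin.forall_fin_two, h₀])
    (by simp [Fin.forall_fin_two, hxy]) hlt hlt' e

theorem typ_glue_pairs' {k : ℕ} {x₀ y₀ x y x' y' : V} (h₀ : x₀ ≤ y₀) (hxy : x ≤ y)
    (h : typ k ![x, y] = typ k ![x', y']) (hlt : y < x₀) (hlt' : y' < x₀)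
    (e : tp k (Ioo y x₀) = tp k (Ioo y' x₀)) :
    typ k (Sum.elim ![x₀, y₀] ![x, y]) = typ k (Sum.elim ![x₀, y₀] ![x', y']) := by
  have := typ_glue h (rfl : typ k ![x₀, y₀] = _) (c := 1) (d := 0)
    (by simp [Fin.forall_fin_two, hxy]) (by simp [Fin.forall_fin_two, h₀]) hlt hlt' e
  have := typ_comp this Sum.swap
  convert this using 2 <;>
  · ext i; rcases i with i | i <;> rfl

theorem PairEquiv.le {W : Type*} [LinearOrder W] {x y : V} {x' y' : W}
    (h : PairEquiv x y x' y') : x ≤ y ↔ x' ≤ y' := typ_le (h 0) (i := 0) (j := 1)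

theorem typ_ext_snd {W : Type*} [LinearOrder W] {k : ℕ} {x y : V} {x' : W}
    (h : pty (k + 1) x = pty (k + 1) x') : ∃ y', typ k ![x, y] = typ k ![x', y'] := by
  obtain ⟨y', hy'⟩ := typ_ext (typ_unit_iff.2 h) y
  refine ⟨y', ?_⟩
  convert typ_comp hy' ![some (), none] using 2 <;>
  · ext i; fin_cases i <;> rfl

theorem typ_ext_fst {W : Type*} [LinearOrder W] {k : ℕ} {x y : V} {y' : W}
    (h : pty (k + 1) y = pty (k + 1) y') : ∃ x', typ k ![x, y] = typ k ![x', y'] := by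
  obtain ⟨y', hy'⟩ := typ_ext (typ_unit_iff.2 h) x
  refine ⟨y', ?_⟩
  convert typ_comp hy' ![none, some ()] using 2 <;>
  · ext i; fin_cases i <;> rfl

theorem Sat.ext_snd {W : Type*} [LinearOrder W] (hW : Sat W) {x y : V} {x' : W}
    (h : ∀ k, pty k x = pty k x') : ∃ y', PairEquiv x y x' y' := by
  obtain ⟨y', hy'⟩ := hW.ext (fun k => typ_unit_iff.2 (h k)) y
  refine ⟨y', fun k => ?_⟩
  convert typ_comp (hy' k) ![some (), none] using 2 <;>
  · ext i; fin_cases i <;> rfl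

theorem Sat.ext_fst {W : Type*} [LinearOrder W] (hW : Sat W) {x y : V} {y' : W}
    (h : ∀ k, pty k y = pty k y') : ∃ x', PairEquiv x y x' y' := by
  obtain ⟨y', hy'⟩ := hW.ext (fun k => typ_unit_iff.2 (h k)) x
  refine ⟨y', fun k => ?_⟩
  convert typ_comp (hy' k) ![none, some ()] using 2 <;>
  · ext i; fin_cases i <;> rfl

theorem NonisolatedPair.exists_approx {x₀ y₀ x' y' : V} (h : NonisolatedPair x₀ y₀)
    (hV : SelfAdditive V) (h₀ : x₀ ≤ y₀) (s : Bool)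
    (hx : PairEquiv x' y' x₀ y₀ ∧ if s then Far y₀ x' else Far y' x₀) (M : ℕ) :
    ∃ x'' y'' : V, typ M (Sum.elim ![x₀, y₀] ![x', y']) = typ M (Sum.elim ![x₀, y₀] ![x'', y'']) ∧
      ¬ PairEquiv x'' y'' x₀ y₀ := by
  obtain ⟨x₁, y₁, h₁, hne⟩ := h M
  rw [PairEquiv] at hne
  push Not at hne
  obtain ⟨m, hm⟩ := hne
  have hle := hx.1.le.2 h₀
  cases s
  · obtain ⟨w, hw, e₁, e₂⟩ := hV.exists_below (max M m + 1) x₀ y₁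
    obtain ⟨v, hv⟩ := typ_ext_fst (x := x₁) e₂.symm
    have hv' := typ_mono (le_max_left M m) hv
    have hp := ((hx.1 M).trans h₁.symm).trans hv'
    refine ⟨v, w, typ_glue_pairs' h₀ hle hp hx.2.lt hw ?_, fun h' => ?_⟩
    · rw [(hx.2 M).2, tp_add_of_le ((le_max_left M m).trans (Nat.le_succ _)) e₁,
        (pty_eq_iff.1 (pty_snd ((hx.1 M).trans h₁.symm))).2]
    · exact hm ((typ_mono (le_max_right M m) hv).trans (h' m))
  · obtain ⟨w, hw, e₁, e₂⟩ := hV.exists_above (max M m + 1) y₀ x₁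
    obtain ⟨v, hv⟩ := typ_ext_snd (y := y₁) e₂.symm
    have hv' := typ_mono (le_max_left M m) hv
    have hp := ((hx.1 M).trans h₁.symm).trans hv'
    refine ⟨w, v, typ_glue_pairs h₀ hle hp hx.2.lt hw ?_, fun h' => ?_⟩
    · rw [(hx.2 M).2, tp_add_of_le ((le_max_left M m).trans (Nat.le_succ _)) e₁,
        (pty_eq_iff.1 (pty_fst ((hx.1 M).trans h₁.symm))).1]
    · exact hm ((typ_mono (le_max_right M m) hv).trans (h' m))

theorem NonisolatedFar.exists_approx {x₀ x' y' : V} (h : NonisolatedFar x₀) (hS : Sat V)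
    (s : Bool) (hx : PairEquiv x' y' x₀ x₀ ∧ if s then Far x₀ x' else Far y' x₀) (M : ℕ) :
    ∃ z : V, typ M (Sum.elim ![x₀, x₀] ![x', y']) = typ M (Sum.elim ![x₀, x₀] ![z, z]) ∧
      ¬ if s then Far x₀ z else Far z x₀ := by
  obtain ⟨x₁, x₂, hlt, h₁, h₂, h₃, hf⟩ := h M
  obtain rfl : x' = y' := (typ_eq (hx.1 0) (i := 0) (j := 1)).2 rfl
  have hp : pty M x' = pty M x₀ := pty_fst (hx.1 M)
  cases s
  · obtain ⟨z, hz⟩ := hS.ext_fst (x := x₁) h₂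
    have hzx : pty M z = pty M x₀ := (pty_fst (hz M)).symm.trans (h₁ M)
    refine ⟨z, typ_glue_pairs' le_rfl le_rfl (typ_diag (hp.trans hzx.symm)) hx.2.lt
      ((typ_lt (hz 0) (i := 0) (j := 1)).1 hlt) ?_, fun h' => hf ?_⟩
    · rw [(hx.2 M).2, (pty_eq_iff.1 hp).2]
      exact h₃.symm.trans (typ_Ioo (hz M) 0 1)
    · exact far_of_typ (fun k => (hz k).symm) (i := 0) (j := 1) h'
  · obtain ⟨z, hz⟩ := hS.ext_snd (y := x₂) h₁
    have hzx : pty M z = pty M x₀ := (pty_snd (hz M)).symm.trans (h₂ M)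
    refine ⟨z, typ_glue_pairs le_rfl le_rfl (typ_diag (hp.trans hzx.symm)) hx.2.lt
      ((typ_lt (hz 0) (i := 0) (j := 1)).1 hlt) ?_, fun h' => hf ?_⟩
    · rw [(hx.2 M).2, (pty_eq_iff.1 hp).1]
      exact h₃.symm.trans (typ_Ioo (hz M) 0 1)
    · exact far_of_typ (fun k => (hz k).symm) (i := 0) (j := 1) h'

/-- A pair of points none of whose conjugates lies far from it. -/
structure Anchored (x₀ y₀ : V) : Prop where
  le : x₀ ≤ y₀
  not_far : ¬ Far x₀ y₀
  not_far_above : ∀ x y : V, PairEquiv x y x₀ y₀ → ¬ Far y₀ x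
  not_far_below : ∀ x y : V, PairEquiv x y x₀ y₀ → ¬ Far y x₀

theorem SelfAdditive.exists_anchored_of_sat (hV : SelfAdditive V) (hS : Sat V)
    (hF : ¬ Fine (Set.univ : Set V)) : ∃ W : Set V, W.Countable ∧ TarskiVaught W ∧
      ∃ x₀ y₀ : W, Anchored x₀ y₀ := by
  obtain ⟨x₀, y₀, hle, hnf, hn⟩ := hV.exists_nonisolated hS hF
  obtain ⟨W, hW, hx₀, hy₀, hTV, hom⟩ := hS.exists_omitting x₀ y₀
    (fun s x y => PairEquiv x y x₀ y₀ ∧ if s then Far y₀ x else Far y x₀) fun s M x' y' => by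
      by_cases hΨ : PairEquiv x' y' x₀ y₀ ∧ if s then Far y₀ x' else Far y' x₀
      · suffices ∃ x'' y'' : V, typ M (Sum.elim ![x₀, y₀] ![x', y']) =
            typ M (Sum.elim ![x₀, y₀] ![x'', y'']) ∧
            ¬ (PairEquiv x'' y'' x₀ y₀ ∧ if s then Far y₀ x'' else Far y'' x₀) by
          obtain ⟨x'', y'', h₁, h₂⟩ := this
          obtain ⟨K, hK⟩ := exists_isolating_of_not h₂
          exact ⟨x'', y'', K, h₁, hK⟩
        rcases hn with hn | ⟨rfl, hn⟩
        · obtain ⟨x'', y'', h₁, h₂⟩ := hn.exists_approx hV hle s hΨ M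
          exact ⟨x'', y'', h₁, fun h => h₂ h.1⟩
        · obtain ⟨z, h₁, h₂⟩ := hn.exists_approx hS s hΨ M
          exact ⟨z, z, h₁, fun h => h₂ h.2⟩
      · obtain ⟨K, hK⟩ := exists_isolating_of_not hΨ
        exact ⟨x', y', K, rfl, hK⟩
  have hpair : ∀ x y : W, PairEquiv x y (x : V) (y : V) := fun x y k => by
    refine (hTV.typ k ![x, y]).trans (congrArg _ ?_)
    ext i; fin_cases i <;> rfl
  have hfar : ∀ {x y : W}, Far x y → Far (x : V) (y : V) := fun {x y} h =>
    far_of_typ (hpair x y) (i := 0) (j := 1) h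
  refine ⟨W, hW, hTV, ⟨x₀, hx₀⟩, ⟨y₀, hy₀⟩, hle, fun h => hnf (hfar h), fun x y h h' => ?_,
    fun x y h h' => ?_⟩
  · exact hom true x x.2 y y.2 ⟨((hpair x y).symm.trans h).trans (hpair _ _), hfar h'⟩
  · exact hom false x x.2 y y.2 ⟨((hpair x y).symm.trans h).trans (hpair _ _), hfar h'⟩

theorem fine_of_fine_Upow (h : Fine (Set.univ : Set (Upow V))) : Fine (Set.univ : Set V) := by
  refine Set.Finite.subset h ?_
  rintro _ ⟨x, -, y, -, rfl⟩
  exact ⟨cls fun _ => x, mem_univ _, cls fun _ => y, mem_univ _,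
    funext fun k => (typ_Ioo (typ_const k ![x, y]) 0 1).symm⟩

end

theorem SelfAdditive.exists_anchored {N : Type} [LinearOrder N] (hN : SelfAdditive N)
    (hF : ¬ Fine (Set.univ : Set N)) : ∃ (W : Type) (_ : LinearOrder W), Countable W ∧
      (∀ k, tp k (Set.univ : Set W) = tp k (Set.univ : Set N)) ∧ SelfAdditive W ∧
      ∃ x₀ y₀ : W, Anchored x₀ y₀ := by
  have hU : SelfAdditive (Upow N) := hN.of_Th_eq fun k => (tp_Upow k).symm
  obtain ⟨W, hW, hTV, h⟩ := hU.exists_anchored_of_sat sat_Upow (mt fine_of_fine_Upow hF)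
  exact ⟨W, inferInstance, hW, fun k => (hTV.tp_univ k).trans (tp_Upow k),
    hU.of_Th_eq fun k => (hTV.tp_univ k).symm, h⟩

section

variable {I J W : Type*} [LinearOrder I] [LinearOrder J] [LinearOrder W]

theorem strictMono_copy (i : I) : StrictMono (fun w : W => (toLex (i, w) : I ×ₗ W)) :=
  fun _ _ h => Prod.Lex.toLex_lt_toLex.2 (Or.inr ⟨rfl, h⟩)

/-- The points of the lexicographic product with first coordinate in `X`. -/
def slab (W : Type*) (X : Set I) : Set (I ×ₗ W) := {p | (ofLex p).1 ∈ X}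

theorem slab_inter_Iio {X : Set I} {i : I} (hi : i ∈ X) (w : W) :
    slab W X ∩ Iio (toLex (i, w)) =
      slab W (X ∩ Iio i) ∪ (fun w : W => (toLex (i, w) : I ×ₗ W)) '' Iio w := by
  ext p
  obtain ⟨⟨j, v⟩, rfl⟩ := toLex.surjective p
  simp only [slab, mem_inter_iff, mem_union, mem_image, mem_Iio, mem_ofPred_eq, ofLex_toLex,
    Prod.Lex.toLex_lt_toLex, EmbeddingLike.apply_eq_iff_eq, Prod.mk.injEq]
  grind

theorem slab_inter_Ioi {X : Set I} {i : I} (hi : i ∈ X) (w : W) :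
    slab W X ∩ Ioi (toLex (i, w)) =
      (fun w : W => (toLex (i, w) : I ×ₗ W)) '' Ioi w ∪ slab W (X ∩ Ioi i) := by
  ext p
  obtain ⟨⟨j, v⟩, rfl⟩ := toLex.surjective p
  simp only [slab, mem_inter_iff, mem_union, mem_image, mem_Ioi, mem_ofPred_eq, ofLex_toLex,
    Prod.Lex.toLex_lt_toLex, EmbeddingLike.apply_eq_iff_eq, Prod.mk.injEq]
  grind

theorem Ioo_copy (i : I) (x y : W) : Ioo (toLex (i, x) : I ×ₗ W) (toLex (i, y)) =
    (fun w : W => (toLex (i, w) : I ×ₗ W)) '' Ioo x y := by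
  ext p
  obtain ⟨⟨j, v⟩, rfl⟩ := toLex.surjective p
  simp only [mem_image, mem_Ioo,
    Prod.Lex.toLex_lt_toLex, EmbeddingLike.apply_eq_iff_eq, Prod.mk.injEq]
  grind

theorem SelfAdditive.upper_slab (hW : SelfAdditive W) {k : ℕ} {X : Set I} (x : W)
    (h : X.Nonempty → tp k (slab W X) = tp k (Set.univ : Set W)) :
    tp k (Ioi x) + tp k (slab W X) = tp k (Ioi x) := by
  rcases X.eq_empty_or_nonempty with rfl | hX
  · rw [show slab W (∅ : Set I) = ∅ from rfl, tp_empty, add_zero]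
  · rw [h hX, hW.upper]

theorem SelfAdditive.lower_slab (hW : SelfAdditive W) {k : ℕ} {X : Set I} (x : W)
    (h : X.Nonempty → tp k (slab W X) = tp k (Set.univ : Set W)) :
    tp k (slab W X) + tp k (Iio x) = tp k (Iio x) := by
  rcases X.eq_empty_or_nonempty with rfl | hX
  · rw [show slab W (∅ : Set I) = ∅ from rfl, tp_empty, zero_add]
  · rw [h hX, hW.lower]

theorem SelfAdditive.tp_slab_Iio (hW : SelfAdditive W) {k : ℕ} {X : Set I} {i : I} (hi : i ∈ X)
    (w : W) (h : (X ∩ Iio i).Nonempty → tp k (slab W (X ∩ Iio i)) = tp k (Set.univ : Set W)) :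
    tp k (slab W X ∩ Iio (toLex (i, w))) = tp k (Iio w) := by
  rw [slab_inter_Iio hi, tp_union, tp_image k ((strictMono_copy i).strictMonoOn _),
    hW.lower_slab w h]
  rintro p hp _ ⟨v, -, rfl⟩
  exact Prod.Lex.lt_iff.2 (Or.inl hp.2)

theorem SelfAdditive.tp_slab_Ioi (hW : SelfAdditive W) {k : ℕ} {X : Set I} {i : I} (hi : i ∈ X)
    (w : W) (h : (X ∩ Ioi i).Nonempty → tp k (slab W (X ∩ Ioi i)) = tp k (Set.univ : Set W)) :
    tp k (slab W X ∩ Ioi (toLex (i, w))) = tp k (Ioi w) := by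
  rw [slab_inter_Ioi hi, tp_union, tp_image k ((strictMono_copy i).strictMonoOn _),
    hW.upper_slab w h]
  rintro _ ⟨v, -, rfl⟩ p hp
  exact Prod.Lex.lt_iff.2 (Or.inl hp.2)

theorem SelfAdditive.tp_slab (hW : SelfAdditive W) (k : ℕ) {X : Set I} (hX : X.Nonempty) :
    tp k (slab W X) = tp k (Set.univ : Set W) := by
  induction k generalizing X with
  | zero => rfl
  | succ k ih =>
    refine tp_succ_eq_iff.2 ⟨fun p hp => ?_, fun w _ => ?_⟩
    · obtain ⟨⟨i, w⟩, rfl⟩ := toLex.surjective p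
      have hp : i ∈ X := hp
      exact ⟨w, mem_univ w, by rw [univ_inter, hW.tp_slab_Iio hp w ih],
        by rw [univ_inter, hW.tp_slab_Ioi hp w ih]⟩
    · obtain ⟨i, hi⟩ := hX
      exact ⟨toLex (i, w), hi, by rw [univ_inter, hW.tp_slab_Iio hi w ih],
        by rw [univ_inter, hW.tp_slab_Ioi hi w ih]⟩

theorem SelfAdditive.tp_lex (hW : SelfAdditive W) [Nonempty I] (k : ℕ) :
    tp k (Set.univ : Set (I ×ₗ W)) = tp k (Set.univ : Set W) :=
  hW.tp_slab k Set.univ_nonempty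

theorem SelfAdditive.tp_lex_Iio (hW : SelfAdditive W) (k : ℕ) (i : I) (w : W) :
    tp k (Iio (toLex (i, w) : I ×ₗ W)) = tp k (Iio w) := by
  rw [← hW.tp_slab_Iio (mem_univ i) w (hW.tp_slab k),
    show slab W (Set.univ : Set I) = Set.univ from rfl, univ_inter]

theorem SelfAdditive.tp_lex_Ioi (hW : SelfAdditive W) (k : ℕ) (i : I) (w : W) :
    tp k (Ioi (toLex (i, w) : I ×ₗ W)) = tp k (Ioi w) := by
  rw [← hW.tp_slab_Ioi (mem_univ i) w (hW.tp_slab k),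
    show slab W (Set.univ : Set I) = Set.univ from rfl, univ_inter]

theorem tp_copy_Ioo (k : ℕ) (i : I) (x y : W) :
    tp k (Ioo (toLex (i, x) : I ×ₗ W) (toLex (i, y))) = tp k (Ioo x y) := by
  rw [Ioo_copy, tp_image k ((strictMono_copy i).strictMonoOn _)]

theorem SelfAdditive.far_copy_iff (hW : SelfAdditive W) {i : I} {x y : W} :
    Far (toLex (i, x) : I ×ₗ W) (toLex (i, y)) ↔ Far x y := by
  simp only [Far, Gen, tp_copy_Ioo, hW.tp_lex_Iio, hW.tp_lex_Ioi, (strictMono_copy i).lt_iff_lt]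

theorem SelfAdditive.far_of_lt (hW : SelfAdditive W) {p q : I ×ₗ W}
    (h : (ofLex p).1 < (ofLex q).1) : Far p q := by
  obtain ⟨⟨i, x⟩, rfl⟩ := toLex.surjective p
  obtain ⟨⟨j, y⟩, rfl⟩ := toLex.surjective q
  have hij : i < j := h
  refine fun k => ⟨Prod.Lex.toLex_lt_toLex.2 (Or.inl h), ?_⟩
  have e : Ioo (toLex (i, x) : I ×ₗ W) (toLex (j, y)) =
      slab W (Ici i ∩ Iio j) ∩ Ioi (toLex (i, x)) ∪
        (fun w : W => (toLex (j, w) : I ×ₗ W)) '' Iio y := by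
    ext p
    obtain ⟨⟨l, v⟩, rfl⟩ := toLex.surjective p
    simp only [slab, mem_inter_iff, mem_union, mem_image, mem_Ioi, mem_Ioo, mem_Ici, mem_Iio,
      mem_ofPred_eq, ofLex_toLex, Prod.Lex.toLex_lt_toLex, EmbeddingLike.apply_eq_iff_eq,
      Prod.mk.injEq]
    grind
  rw [e, tp_union, tp_image k ((strictMono_copy j).strictMonoOn _),
    hW.tp_slab_Ioi (show i ∈ Ici i ∩ Iio j from ⟨le_rfl, hij⟩) x (hW.tp_slab k), hW.tp_lex_Iio,
    hW.tp_lex_Ioi]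
  rintro p ⟨hp, -⟩ _ ⟨v, -, rfl⟩
  exact Prod.Lex.lt_iff.2 (Or.inl hp.2)

theorem pairEquiv_of_pty {V V' : Type*} [LinearOrder V] [LinearOrder V'] {f : V → V'}
    (hf : StrictMono f) (h₁ : ∀ k x, pty k (f x) = pty k x)
    (h₂ : ∀ k x y, tp k (Ioo (f x) (f y)) = tp k (Ioo x y)) {x y : V} (h : x ≤ y) :
    PairEquiv (f x) (f y) x y := by
  rcases h.eq_or_lt with rfl | h
  · exact fun k => typ_diag (h₁ k x)
  · exact fun k => typ_pair (hf h) h (h₁ k x) (h₁ k y) (h₂ k x y)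

theorem SelfAdditive.pairEquiv_copy (hW : SelfAdditive W) (i : I) {x y : W} (h : x ≤ y) :
    PairEquiv (toLex (i, x) : I ×ₗ W) (toLex (i, y)) x y :=
  pairEquiv_of_pty (strictMono_copy i)
    (fun k x => pty_eq_iff.2 ⟨hW.tp_lex_Iio k i x, hW.tp_lex_Ioi k i x⟩)
    (fun k => tp_copy_Ioo k i) h

theorem PairEquiv.far_iff {V V' : Type*} [LinearOrder V] [LinearOrder V'] {x y : V} {x' y' : V'}
    (h : PairEquiv x y x' y') : Far x y ↔ Far x' y' :=
  ⟨far_of_typ h (i := 0) (j := 1), far_of_typ (fun k => (h k).symm) (i := 0) (j := 1)⟩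

theorem pty_orderIso {V V' : Type*} [LinearOrder V] [LinearOrder V'] (f : V ≃o V') (k : ℕ)
    (x : V) : pty k (f x) = pty k x :=
  pty_eq_iff.2 ⟨by rw [← f.image_Iio, tp_orderIso], by rw [← f.image_Ioi, tp_orderIso]⟩

theorem pairEquiv_orderIso {V V' : Type*} [LinearOrder V] [LinearOrder V'] (f : V ≃o V') {x y : V}
    (h : x ≤ y) : PairEquiv (f x) (f y) x y :=
  pairEquiv_of_pty f.strictMono (pty_orderIso f) (fun k x y => by rw [← f.image_Ioo, tp_orderIso]) h

theorem far_orderIso {V V' : Type*} [LinearOrder V] [LinearOrder V'] (f : V ≃o V') {x y : V} :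
    Far (f x) (f y) ↔ Far x y := by
  by_cases h : x ≤ y
  · exact (pairEquiv_orderIso f h).far_iff
  · exact ⟨fun h' => absurd (f.lt_iff_lt.1 h'.lt).le h, fun h' => absurd h'.lt.le h⟩

/-- A pair equivalent to an anchored pair lies in one copy, near the anchored pair there. -/
theorem Anchored.near (hW : SelfAdditive W) {x₀ y₀ : W} (h : Anchored x₀ y₀) {p q : I ×ₗ W}
    (hpq : PairEquiv p q x₀ y₀) : (ofLex p).1 = (ofLex q).1 ∧
      ¬ Far (toLex ((ofLex p).1, y₀) : I ×ₗ W) p ∧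
      ¬ Far q (toLex ((ofLex p).1, x₀) : I ×ₗ W) := by
  obtain ⟨⟨i, x⟩, rfl⟩ := toLex.surjective p
  obtain ⟨⟨j, y⟩, rfl⟩ := toLex.surjective q
  have hle : (toLex (i, x) : I ×ₗ W) ≤ toLex (j, y) := hpq.le.2 h.le
  have hij : i = j := by
    rcases Prod.Lex.toLex_le_toLex.1 hle with h' | h'
    · exact absurd (hpq.far_iff.1 (hW.far_of_lt h')) h.not_far
    · exact h'.1
  subst hij
  have hxy : x ≤ y := (strictMono_copy i).le_iff_le.1 hle
  have hq : PairEquiv x y x₀ y₀ := (hW.pairEquiv_copy i hxy).symm.trans hpq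
  exact ⟨rfl, fun h' => h.not_far_above x y hq (hW.far_copy_iff.1 h'),
    fun h' => h.not_far_below x y hq (hW.far_copy_iff.1 h')⟩

theorem Anchored.near_orderIso (hW : SelfAdditive W) {x₀ y₀ : W} (h : Anchored x₀ y₀)
    (f : I ×ₗ W ≃o J ×ₗ W) (i : I) :
    (ofLex (f (toLex (i, x₀)))).1 = (ofLex (f (toLex (i, y₀)))).1 ∧
      ¬ Far (toLex ((ofLex (f (toLex (i, x₀)))).1, y₀) : J ×ₗ W) (f (toLex (i, x₀))) ∧
      ¬ Far (f (toLex (i, y₀))) (toLex ((ofLex (f (toLex (i, x₀)))).1, x₀) : J ×ₗ W) :=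
  h.near hW ((pairEquiv_orderIso f ((strictMono_copy i).monotone h.le)).trans
    (hW.pairEquiv_copy i h.le))

theorem monotone_copy_orderIso (f : I ×ₗ W ≃o J ×ₗ W) (x : W) :
    Monotone fun i : I => (ofLex (f (toLex (i, x)))).1 := by
  intro k l hkl
  have : f (toLex (k, x)) ≤ f (toLex (l, x)) :=
    f.monotone (Prod.Lex.toLex_le_toLex.2 (hkl.lt_or_eq.imp_right fun h => ⟨h, le_rfl⟩))
  exact (Prod.Lex.le_iff.1 this).elim le_of_lt fun h => h.1.le

theorem Anchored.copy_symm (hW : SelfAdditive W) {x₀ y₀ : W} (h : Anchored x₀ y₀)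
    (f : I ×ₗ W ≃o J ×ₗ W) (i : I) :
    (ofLex (f.symm (toLex ((ofLex (f (toLex (i, x₀)))).1, x₀)))).1 = i := by
  set a := (ofLex (f (toLex (i, x₀)))).1 with ha
  obtain ⟨-, n₁, n₂⟩ := h.near_orderIso hW f i
  have hc := (h.near_orderIso hW f.symm a).1
  rw [← ha, ← far_orderIso f.symm, f.symm_apply_apply] at n₁ n₂
  refine le_antisymm (not_lt.1 fun hlt => n₂ (hW.far_of_lt hlt)) (not_lt.1 fun hlt => n₁ ?_)
  exact hW.far_of_lt (hc ▸ hlt)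

/-- The index set can be recovered from a lexicographic product of copies of an anchored
order. -/
theorem Anchored.orderIso (hW : SelfAdditive W) {x₀ y₀ : W} (h : Anchored x₀ y₀)
    (f : I ×ₗ W ≃o J ×ₗ W) : Nonempty (I ≃o J) :=
  ⟨Equiv.toOrderIso
    ⟨fun i => (ofLex (f (toLex (i, x₀)))).1, fun j => (ofLex (f.symm (toLex (j, x₀)))).1,
      h.copy_symm hW f, h.copy_symm hW f.symm⟩ (monotone_copy_orderIso f x₀)
    (monotone_copy_orderIso f.symm x₀)⟩

end

section

variable {α β : Type*} [LinearOrder α] [LinearOrder β]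

theorem strictMono_inl : StrictMono (fun a : α => (toLex (Sum.inl a) : α ⊕ₗ β)) :=
  Sum.Lex.inl_strictMono

theorem strictMono_inr : StrictMono (fun b : β => (toLex (Sum.inr b) : α ⊕ₗ β)) :=
  Sum.Lex.inr_strictMono

theorem tp_sum_univ (k : ℕ) : tp k (Set.univ : Set (α ⊕ₗ β)) =
    tp k (Set.univ : Set α) + tp k (Set.univ : Set β) := by
  rw [← tp_image k (strictMono_inl.strictMonoOn (Set.univ : Set α)) (β := α ⊕ₗ β),
    ← tp_image k (strictMono_inr.strictMonoOn (Set.univ : Set β)) (β := α ⊕ₗ β), ← tp_union]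
  · congr 1
    ext p
    obtain ⟨p | p, rfl⟩ := toLex.surjective p <;> simp
  · rintro _ ⟨a, -, rfl⟩ _ ⟨b, -, rfl⟩
    exact Sum.Lex.inl_lt_inr a b

theorem tp_sum_Iio_inl (k : ℕ) (a : α) :
    tp k (Iio (toLex (Sum.inl a) : α ⊕ₗ β)) = tp k (Iio a) := by
  rw [← tp_image k (strictMono_inl.strictMonoOn (Iio a)) (β := α ⊕ₗ β)]
  congr 1
  ext p
  obtain ⟨p | p, rfl⟩ := toLex.surjective p <;> simp

theorem tp_sum_Ioi_inr (k : ℕ) (b : β) :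
    tp k (Ioi (toLex (Sum.inr b) : α ⊕ₗ β)) = tp k (Ioi b) := by
  rw [← tp_image k (strictMono_inr.strictMonoOn (Ioi b)) (β := α ⊕ₗ β)]
  congr 1
  ext p
  obtain ⟨p | p, rfl⟩ := toLex.surjective p <;> simp

theorem tp_sum_Ioi_inl (k : ℕ) (a : α) : tp k (Ioi (toLex (Sum.inl a) : α ⊕ₗ β)) =
    tp k (Ioi a) + tp k (Set.univ : Set β) := by
  rw [← tp_image k (strictMono_inl.strictMonoOn (Ioi a)) (β := α ⊕ₗ β),
    ← tp_image k (strictMono_inr.strictMonoOn (Set.univ : Set β)) (β := α ⊕ₗ β), ← tp_union]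
  · congr 1
    ext p
    obtain ⟨p | p, rfl⟩ := toLex.surjective p <;> simp
  · rintro _ ⟨a, -, rfl⟩ _ ⟨b, -, rfl⟩
    exact Sum.Lex.inl_lt_inr a b

theorem tp_sum_Iio_inr (k : ℕ) (b : β) : tp k (Iio (toLex (Sum.inr b) : α ⊕ₗ β)) =
    tp k (Set.univ : Set α) + tp k (Iio b) := by
  rw [← tp_image k (strictMono_inr.strictMonoOn (Iio b)) (β := α ⊕ₗ β),
    ← tp_image k (strictMono_inl.strictMonoOn (Set.univ : Set α)) (β := α ⊕ₗ β), ← tp_union]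
  · congr 1
    ext p
    obtain ⟨p | p, rfl⟩ := toLex.surjective p <;> simp
  · rintro _ ⟨a, -, rfl⟩ _ ⟨b, -, rfl⟩
    exact Sum.Lex.inl_lt_inr a b

theorem core_sum {A N C U : Type*} [LinearOrder A] [LinearOrder N] [LinearOrder C] [LinearOrder U]
    {b : U}
    (hA : ∀ a : A, ∃ u : U, u ∉ core b ∧ ∀ k, tp k (Iio a) = tp k (Iio u) ∧
      tp k (Ioi a) + (tp k (Set.univ : Set N) + tp k (Set.univ : Set C)) = tp k (Ioi u))
    (hC : ∀ c : C, ∃ u : U, u ∉ core b ∧ ∀ k,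
      tp k (Set.univ : Set A) + (tp k (Set.univ : Set N) + tp k (Iio c)) = tp k (Iio u) ∧
      tp k (Ioi c) = tp k (Ioi u))
    (hN : ∀ (k : ℕ) (x : N), ∃ u : U, u ∈ core b ∧
      tp k (Set.univ : Set A) + tp k (Iio x) = tp k (Iio u) ∧
      tp k (Ioi x) + tp k (Set.univ : Set C) = tp k (Ioi u)) :
    (core b : Set (A ⊕ₗ N ⊕ₗ C)) = range fun x : N => toLex (Sum.inr (toLex (Sum.inl x))) := by
  ext p
  obtain ⟨a | p, rfl⟩ := toLex.surjective p
  · obtain ⟨u, hu, h⟩ := hA a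
    rw [mem_core_congr (y := u)]
    · simpa using hu
    · intro k
      rw [pty_eq_iff, tp_sum_Iio_inl, tp_sum_Ioi_inl, tp_sum_univ]
      exact h k
  obtain ⟨x | c, rfl⟩ := toLex.surjective p
  · refine ⟨fun _ => ⟨x, rfl⟩, fun _ k => ?_⟩
    obtain ⟨u, hu, h⟩ := hN (k + 1) x
    rw [mem_level_congr (y := u)]
    · exact hu k
    · rw [pty_eq_iff, tp_sum_Iio_inr, tp_sum_Ioi_inr, tp_sum_Iio_inl, tp_sum_Ioi_inl]
      exact h
  · obtain ⟨u, hu, h⟩ := hC c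
    rw [mem_core_congr (y := u)]
    · simpa using hu
    · intro k
      rw [pty_eq_iff, tp_sum_Iio_inr, tp_sum_Ioi_inr, tp_sum_Iio_inr, tp_sum_Ioi_inr]
      exact h k

theorem orderIso_of_range_eq {N N' V V' U : Type*} [LinearOrder N] [LinearOrder N'] [LinearOrder V]
    [LinearOrder V'] [LinearOrder U] {b : U} {g : N → V} {g' : N' → V'} (hg : StrictMono g)
    (hg' : StrictMono g') (h : core b = range g) (h' : core b = range g') (f : V ≃o V') :
    Nonempty (N ≃o N') := by
  have hf : f '' range g = range g' := by
    rw [← h, ← h']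
    ext y
    rw [← f.apply_symm_apply y, f.injective.mem_set_image]
    exact (mem_core_congr fun k => pty_orderIso f k _).symm
  have e : range g ≃o range g' :=
    { toEquiv := (f.toEquiv.image (range g)).trans (Equiv.setCongr hf)
      map_rel_iff' := f.le_iff_le }
  exact ⟨(hg.orderIso g).trans (e.trans (hg'.orderIso g').symm)⟩

/-- A countable linear order with infinitely many theories of intervals has, for every nonempty
countable linear order `I`, an elementarily equivalent countable linear order encoding `I`. -/
theorem exists_encoding {M : Type} [LinearOrder M] (hM : ¬ Fine (Set.univ : Set M)) :
    ∃ (A W C : Type) (_ : LinearOrder A) (_ : LinearOrder W) (_ : LinearOrder C),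
      Countable A ∧ Countable W ∧ Countable C ∧
      (∀ (I : Type) [LinearOrder I] [Nonempty I] (k : ℕ),
        tp k (Set.univ : Set (A ⊕ₗ (I ×ₗ W) ⊕ₗ C)) = tp k (Set.univ : Set M)) ∧
      ∀ (I J : Type) [LinearOrder I] [LinearOrder J] [Nonempty I] [Nonempty J],
        (A ⊕ₗ (I ×ₗ W) ⊕ₗ C ≃o A ⊕ₗ (J ×ₗ W) ⊕ₗ C) → Nonempty (I ≃o J) := by
  obtain ⟨b, hN, hF⟩ := (sat_Upow (A := M)).exists_selfAdditive_core (mt fine_of_fine_Upow hM)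
  obtain ⟨W, _, hWc, hWN, hW, x₀, y₀, han⟩ := hN.exists_anchored hF
  set N : Set (Upow M) := core b with hNdef
  set A : Set (Upow M) := {u | ∀ n ∈ N, u < n} with hA
  set C : Set (Upow M) := {u | ∀ n ∈ N, n < u} with hC
  have hbN : b ∈ N := mem_core_self b
  have hunion : ∀ u, u ∈ A ∨ u ∈ N ∨ u ∈ C := by
    intro u
    by_contra! h
    obtain ⟨h₁, h₂, h₃⟩ := h
    simp only [hA, hC, mem_ofPred_eq] at h₁ h₃
    push Not at h₁ h₃
    obtain ⟨n₁, hn₁, h₁⟩ := h₁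
    obtain ⟨n₃, hn₃, h₃⟩ := h₃
    exact h₂ ((ordConnected_core b).out hn₁ hn₃ ⟨h₁, h₃⟩)
  have hAC : ∀ u ∈ A, ∀ v ∈ C, u < v := fun u hu v hv => (hu b hbN).trans (hv b hbN)
  obtain ⟨A₀, hA₀, hAt⟩ := exists_countable_tarskiVaught A
  obtain ⟨C₀, hC₀, hCt⟩ := exists_countable_tarskiVaught C
  have hAu : ∀ k, tp k (Set.univ : Set A₀) = tp k A := fun k =>
    (hAt.tp_univ k).trans (tp_subtype_univ k A)
  have hCu : ∀ k, tp k (Set.univ : Set C₀) = tp k C := fun k =>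
    (hCt.tp_univ k).trans (tp_subtype_univ k C)
  have hWu : ∀ (I : Type) [LinearOrder I] [Nonempty I] (k : ℕ),
      tp k (Set.univ : Set (I ×ₗ W)) = tp k N := fun I _ _ k =>
    ((hW.tp_lex k).trans (hWN k)).trans (tp_subtype_univ k N)
  have hcore : ∀ (I : Type) [LinearOrder I] [Nonempty I],
      (core b : Set (A₀ ⊕ₗ (I ×ₗ W) ⊕ₗ C₀)) =
        range fun x : I ×ₗ W => toLex (Sum.inr (toLex (Sum.inl x))) := by
    intro I _ _
    refine core_sum (fun a => ⟨a.1.1, fun h => (a.1.2 _ h).false, fun k => ?_⟩)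
      (fun c => ⟨c.1.1, fun h => (c.1.2 _ h).false, fun k => ?_⟩) fun k x => ?_
    · obtain ⟨h₁, h₂⟩ := pty_eq_iff.1 (hAt.pty k a)
      rw [h₁, h₂, tp_subtype_Iio, tp_subtype_Ioi, hWu, hCu, ← tp_union, ← tp_union]
      · constructor
        · congr 1
          ext u
          exact ⟨fun h => h.2, fun h => ⟨fun n hn => h.trans (a.1.2 n hn), h⟩⟩
        · congr 1
          ext u
          refine ⟨?_, fun h => ?_⟩
          · rintro (h | h | h)
            · exact h.2
            · exact a.1.2 u h
            · exact hAC _ a.1.2 u h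
          · exact (hunion u).imp_left fun h' => ⟨h', h⟩
      · rintro u hu v (hv | hv)
        · exact hu.1 v hv
        · exact hAC u hu.1 v hv
      · exact fun u hu v hv => hv u hu
    · obtain ⟨h₁, h₂⟩ := pty_eq_iff.1 (hCt.pty k c)
      rw [h₁, h₂, tp_subtype_Iio, tp_subtype_Ioi, hWu, hAu, ← tp_union, ← tp_union]
      · constructor
        · congr 1
          ext u
          refine ⟨?_, fun h => ?_⟩
          · rintro (h | h | h)
            · exact hAC u h _ c.1.2
            · exact c.1.2 u h
            · exact h.2
          · exact (hunion u).imp_right fun h' => h'.imp_right fun h' => ⟨h', h⟩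
        · congr 1
          ext u
          exact ⟨fun h => h.2, fun h => ⟨fun n hn => (c.1.2 n hn).trans h, h⟩⟩
      · rintro u hu v (hv | hv)
        · exact hu v hv
        · exact hAC u hu v hv.1
      · exact fun u hu v hv => hv.1 u hu
    · obtain ⟨y, -, h₁, h₂⟩ := (tp_succ_eq_iff.1
        (((hW.tp_lex (I := I) (k + 1)).trans (hWN (k + 1))))).1 x (mem_univ x)
      rw [univ_inter, univ_inter] at h₁ h₂
      refine ⟨y, y.2, ?_⟩
      rw [← h₁, ← h₂, tp_subtype_Iio, tp_subtype_Ioi, hAu, hCu, ← tp_union, ← tp_union]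
      · constructor
        · congr 1
          ext u
          refine ⟨?_, fun h => ?_⟩
          · rintro (h | h)
            · exact h y y.2
            · exact h.2
          · rcases hunion u with h' | h' | h'
            · exact Or.inl h'
            · exact Or.inr ⟨h', h⟩
            · exact absurd (h' y y.2) h.not_gt
        · congr 1
          ext u
          refine ⟨?_, fun h => ?_⟩
          · rintro (h | h)
            · exact h.2
            · exact h y y.2
          · rcases hunion u with h' | h' | h'
            · exact absurd (h' y y.2) h.not_gt
            · exact Or.inl ⟨h', h⟩
            · exact Or.inr h'
      · exact fun u hu v hv => hv u hu.1
      · exact fun u hu v hv => hu v hv.1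
  refine ⟨A₀, W, C₀, inferInstance, inferInstance, inferInstance, hA₀, hWc, hC₀, fun I _ _ k => ?_,
    fun I J _ _ _ _ f => ?_⟩
  · rw [tp_sum_univ, tp_sum_univ, hAu, hWu, hCu, ← tp_Upow k, ← tp_union, ← tp_union]
    · congr 1
      exact eq_univ_of_forall hunion
    · rintro u hu v (hv | hv)
      · exact hu v hv
      · exact hAC u hu v hv
    · exact fun u hu v hv => hv u hu
  · obtain ⟨e⟩ := orderIso_of_range_eq (strictMono_inr.comp strictMono_inl)
      (strictMono_inr.comp strictMono_inl) (hcore I) (hcore J) f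
    exact han.orderIso hW e

end

/-- The sum over `n ∈ X` of a copy of the negative rationals followed by `n + 1` points. -/
def blocks (X : Set ℕ) : Set (ℕ ×ₗ ℚ) :=
  {p | (ofLex p).1 ∈ X ∧ ((ofLex p).2 < 0 ∨ ∃ i : ℕ, i ≤ (ofLex p).1 ∧ (ofLex p).2 = i)}

/-- The point number `i` in the finite part of block number `n`. -/
def blockPt {X : Set ℕ} {n : ℕ} (hn : n ∈ X) {i : ℕ} (hi : i ≤ n) : blocks X :=
  ⟨toLex (n, (i : ℚ)), hn, Or.inr ⟨i, hi, rfl⟩⟩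

theorem blockPt_covBy {X : Set ℕ} {n : ℕ} (hn : n ∈ X) {i : ℕ} (hi : i + 1 ≤ n) :
    blockPt hn (i.le_succ.trans hi) ⋖ blockPt hn hi := by
  refine ⟨Prod.Lex.toLex_lt_toLex.2 (Or.inr ⟨rfl, by push_cast; linarith⟩), ?_⟩
  rintro ⟨p, -, hp⟩
  obtain ⟨⟨m, r⟩, rfl⟩ := toLex.surjective p
  intro h₁ h₂
  have h₁ : (toLex (n, (i : ℚ)) : ℕ ×ₗ ℚ) < toLex (m, r) := h₁
  have h₂ : (toLex (m, r) : ℕ ×ₗ ℚ) < toLex (n, ((i + 1 : ℕ) : ℚ)) := h₂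
  rw [Prod.Lex.toLex_lt_toLex] at h₁ h₂
  have hi : (0 : ℚ) ≤ i := Nat.cast_nonneg i
  simp only [ofLex_toLex] at hp h₁ h₂
  obtain ⟨rfl, h₁⟩ := h₁.resolve_left (by omega)
  have h₂ := (h₂.resolve_left (by omega)).2
  rcases hp with hp | ⟨j, -, rfl⟩
  · linarith
  · norm_cast at h₁ h₂
    omega

theorem exists_of_covBy {X : Set ℕ} {x y : blocks X} (h : x ⋖ y) :
    ∃ (n : ℕ) (hn : n ∈ X) (i : ℕ) (hi : i + 1 ≤ n),
      x = blockPt hn (i.le_succ.trans hi) ∧ y = blockPt hn hi := by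
  obtain ⟨p, hp, hp'⟩ := x
  obtain ⟨q, hq, hq'⟩ := y
  obtain ⟨⟨m, r⟩, rfl⟩ := toLex.surjective p
  obtain ⟨⟨n, s⟩, rfl⟩ := toLex.surjective q
  simp only [ofLex_toLex] at hp hp' hq hq'
  obtain ⟨h₁, h₂⟩ := h
  have key : ∀ t : ℚ, (t < 0 ∨ ∃ i : ℕ, i ≤ n ∧ t = i) →
      (toLex (m, r) : ℕ ×ₗ ℚ) < toLex (n, t) → ¬ t < s := fun t ht h₃ h₄ =>
    h₂ (c := ⟨toLex (n, t), hq, ht⟩) h₃ (Prod.Lex.toLex_lt_toLex.2 (Or.inr ⟨rfl, h₄⟩))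
  have h₁ : (toLex (m, r) : ℕ ×ₗ ℚ) < toLex (n, s) := h₁
  rcases Prod.Lex.toLex_lt_toLex.1 h₁ with h | ⟨h, h'⟩
  · refine absurd ?_ (key (min s 0 - 1) ?_ (Prod.Lex.toLex_lt_toLex.2 (Or.inl h)))
    · linarith [min_le_left s 0]
    · exact Or.inl (by linarith [min_le_right s 0])
  · obtain rfl : m = n := h
    have h' : r < s := h'
    rcases hp' with hr | ⟨i, hi, rfl⟩
    · obtain ⟨t, ht₁, ht₂⟩ := exists_between (lt_min h' hr)
      exact absurd (ht₂.trans_le (min_le_left _ _)) (key t (Or.inl (ht₂.trans_le (min_le_right _ _)))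
        (Prod.Lex.toLex_lt_toLex.2 (Or.inr ⟨rfl, ht₁⟩)))
    · rcases hq' with hs | ⟨j, hj, rfl⟩
      · linarith [(Nat.cast_nonneg i : (0 : ℚ) ≤ i)]
      · have hij : i < j := by exact_mod_cast h'
        obtain rfl : j = i + 1 := by
          by_contra hne
          refine key (i + 1 : ℕ) (Or.inr ⟨i + 1, by omega, rfl⟩)
            (Prod.Lex.toLex_lt_toLex.2 (Or.inr ⟨rfl, ?_⟩)) ?_
          · exact Nat.cast_lt.2 i.lt_succ_self
          · exact_mod_cast show i + 1 < j by omega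
        exact ⟨m, hp, i, hj, rfl, rfl⟩

theorem blockPt_inj {X : Set ℕ} {m n : ℕ} {hm : m ∈ X} {hn : n ∈ X} {i j : ℕ} {hi : i ≤ m}
    {hj : j ≤ n} (h : blockPt hm hi = blockPt hn hj) : m = n ∧ i = j := by
  have h : (toLex (m, (i : ℚ)) : ℕ ×ₗ ℚ) = toLex (n, (j : ℚ)) := congrArg Subtype.val h
  simpa using h

/-- A maximal finite chain of `n + 1` successive points. -/
def HasChain (n : ℕ) (α : Type*) [LinearOrder α] : Prop :=
  ∃ c : ℕ → α, (∀ x, ¬ x ⋖ c 0) ∧ (∀ i < n, c i ⋖ c (i + 1)) ∧ ∀ x, ¬ c n ⋖ x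

theorem HasChain.of_orderIso {n : ℕ} {α β : Type*} [LinearOrder α] [LinearOrder β] (f : α ≃o β)
    (h : HasChain n α) : HasChain n β := by
  obtain ⟨c, h₀, h₁, h₂⟩ := h
  refine ⟨f ∘ c, fun x hx => h₀ (f.symm x) ?_, fun i hi => (apply_covBy_apply_iff f).2 (h₁ i hi),
    fun x hx => h₂ (f.symm x) ?_⟩
  · rw [← apply_covBy_apply_iff f, f.apply_symm_apply]
    exact hx
  · rw [← apply_covBy_apply_iff f, f.apply_symm_apply]
    exact hx

theorem hasChain_blocks {X : Set ℕ} {n : ℕ} (hn : n ≠ 0) : HasChain n (blocks X) ↔ n ∈ X := by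
  constructor
  · rintro ⟨c, h₀, h₁, h₂⟩
    obtain ⟨m, hm, i, hi, e, -⟩ := exists_of_covBy (h₁ 0 (Nat.pos_of_ne_zero hn))
    have hi0 : i = 0 := by
      rcases i with - | i
      · rfl
      · rw [e] at h₀
        exact absurd (blockPt_covBy hm (i := i) (by omega)) (h₀ _)
    subst hi0
    have key : ∀ j ≤ n, ∃ hj : j ≤ m, c j = blockPt hm hj := by
      intro j
      induction j with
      | zero => exact fun _ => ⟨m.zero_le, e⟩
      | succ j ih =>
        intro hj
        obtain ⟨hjm, ej⟩ := ih (by omega)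
        obtain ⟨m', hm', i, hi, e₁, e₂⟩ := exists_of_covBy (h₁ j hj)
        obtain ⟨rfl, rfl⟩ := blockPt_inj (ej.symm.trans e₁)
        exact ⟨hi, e₂⟩
    obtain ⟨hnm, en⟩ := key n le_rfl
    rcases hnm.eq_or_lt with rfl | hlt
    · exact hm
    · rw [en] at h₂
      exact absurd (blockPt_covBy hm hlt) (h₂ _)
  · intro h
    refine ⟨fun i => blockPt h (min_le_right i n), fun x hx => ?_, fun i hi => ?_, fun x hx => ?_⟩
    · obtain ⟨m, hm, i, hi, -, e⟩ := exists_of_covBy hx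
      have := (blockPt_inj e).2
      omega
    · have e : ∀ j (hj : j ≤ n), blockPt h (min_le_right j n) = blockPt h hj := fun j hj => by
        simp only [blockPt, min_eq_left hj]
      simp only [e i hi.le, e (i + 1) hi]
      exact blockPt_covBy h hi
    · obtain ⟨m, hm, i, hi, e, -⟩ := exists_of_covBy hx
      have := blockPt_inj e
      omega

/-- There are continuum many pairwise nonisomorphic countable linear orders. -/
theorem exists_orders : ∃ (I : Set ℕ → Type) (_ : ∀ S, LinearOrder (I S)),
    (∀ S, Countable (I S)) ∧ (∀ S, Nonempty (I S)) ∧ ∀ S S', (I S ≃o I S') → S = S' := by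
  have hsub : ∀ S S' : Set ℕ, (blocks (insert 0 (Nat.succ '' S)) ≃o
      blocks (insert 0 (Nat.succ '' S'))) → S ⊆ S' := by
    intro S S' f n hn
    have := ((hasChain_blocks n.succ_ne_zero).2
      (Or.inr (mem_image_of_mem Nat.succ hn))).of_orderIso f
    simpa using (hasChain_blocks n.succ_ne_zero).1 this
  refine ⟨fun S => blocks (insert 0 (Nat.succ '' S)), fun S => inferInstance, fun S => ?_,
    fun S => ⟨blockPt (mem_insert 0 _) le_rfl⟩, fun S S' f =>
      (hsub S S' f).antisymm (hsub S' S f.symm)⟩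
  have : Countable (ℕ ×ₗ ℚ) := inferInstanceAs (Countable (ℕ × ℚ))
  infer_instance

theorem typ_ext_snoc {M N : Type*} [LinearOrder M] [LinearOrder N] {k n : ℕ} {a : Fin n → M} {b : Fin n → N} (h : typ (k + 1) a = typ (k + 1) b)
    (x : M) : ∃ y : N, typ k (Fin.snoc a x : Fin (n + 1) → M) =
      typ k (Fin.snoc b y : Fin (n + 1) → N) := by
  obtain ⟨y, hy⟩ := typ_ext h x
  refine ⟨y, ?_⟩
  convert typ_comp hy (Fin.lastCases none some : Fin (n + 1) → Option (Fin n)) using 2 <;>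
  · ext i
    induction i using Fin.lastCases <;> simp

open FirstOrder.Language

/-- The relation symbol of the language of orders. -/
def relSymb : Language.order.Relations 2 := orderRel.le

/-- The relation symbol is interpreted as the strict order. -/
class StrictlyOrdered (M : Type) [LinearOrder M] [Language.order.Structure M] : Prop where
  relMap_iff : ∀ a b : M, Structure.RelMap relSymb ![a, b] ↔ a < b

/-- The structure on a linear order in which the relation symbol is interpreted as the strict
order. -/
@[reducible]
def strictStructure (M : Type) [LinearOrder M] : Language.order.Structure M where
  funMap := fun f => f.elim
  RelMap := fun {_} r => match r with
    | .le => fun v => v 0 < v 1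

theorem strictlyOrdered_strictStructure (M : Type) [LinearOrder M] :
    letI := strictStructure M; StrictlyOrdered M :=
  letI := strictStructure M
  ⟨fun _ _ => Iff.rfl⟩

section

variable {M N : Type} [LinearOrder M] [LinearOrder N] [Language.order.Structure M]
  [Language.order.Structure N] [StrictlyOrdered M] [StrictlyOrdered N]

theorem relMap_relSymb (x : Fin 2 → M) : Structure.RelMap relSymb x ↔ x 0 < x 1 := by
  rw [← StrictlyOrdered.relMap_iff]
  congr! 1
  ext i
  fin_cases i <;> rfl

theorem relMap_congr : ∀ {l : ℕ} (R : Language.order.Relations l) {x : Fin l → M} {y : Fin l → N},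
    (∀ i j, x i < x j ↔ y i < y j) → (Structure.RelMap R x ↔ Structure.RelMap R y)
  | 2, .le, x, y, h => (relMap_relSymb x).trans ((h 0 1).trans (relMap_relSymb y).symm)

theorem exists_realize_term {n : ℕ} (t : Language.order.Term (Empty ⊕ Fin n)) :
    ∃ i, ∀ {M : Type} [Language.order.Structure M] (v : Empty → M) (a : Fin n → M),
      t.realize (Sum.elim v a) = a i := by
  rcases t with (i | i) | f
  · exact i.elim
  · exact ⟨i, fun _ _ => rfl⟩
  · exact Empty.elim f

theorem exists_rank {n : ℕ} (φ : Language.order.BoundedFormula Empty n) :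
    ∃ k, ∀ (v : Empty → M) (w : Empty → N) (a : Fin n → M) (b : Fin n → N), typ k a = typ k b →
      (φ.Realize v a ↔ φ.Realize w b) := by
  induction φ with
  | falsum => exact ⟨0, fun _ _ _ _ _ => Iff.rfl⟩
  | equal t₁ t₂ =>
    obtain ⟨i, hi⟩ := exists_realize_term t₁
    obtain ⟨j, hj⟩ := exists_realize_term t₂
    refine ⟨0, fun v w a b h => ?_⟩
    simp only [BoundedFormula.Realize, hi, hj]
    exact typ_eq h
  | rel R ts =>
    choose i hi using fun l => exists_realize_term (ts l)
    refine ⟨0, fun v w a b h => relMap_congr R fun l l' => ?_⟩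
    rw [hi, hi, hi, hi]
    exact typ_lt h
  | imp φ ψ ih₁ ih₂ =>
    obtain ⟨k, hk⟩ := ih₁
    obtain ⟨m, hm⟩ := ih₂
    refine ⟨max k m, fun v w a b h => ?_⟩
    exact imp_congr (hk v w a b (typ_mono (le_max_left k m) h))
      (hm v w a b (typ_mono (le_max_right k m) h))
  | all φ ih =>
    obtain ⟨k, hk⟩ := ih
    refine ⟨k + 1, fun v w a b h => ⟨fun h' y => ?_, fun h' x => ?_⟩⟩
    · obtain ⟨x, hx⟩ := typ_ext_snoc h.symm y
      exact (hk v w _ _ hx.symm).1 (h' x)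
    · obtain ⟨y, hy⟩ := typ_ext_snoc h x
      exact (hk v w _ _ hy).2 (h' y)

theorem realize_sentence_iff_of_tp (h : ∀ k, tp k (Set.univ : Set M) = tp k (Set.univ : Set N))
    (φ : Language.order.Sentence) : M ⊨ φ ↔ N ⊨ φ := by
  obtain ⟨k, hk⟩ := exists_rank (M := M) (N := N) φ
  exact hk _ _ _ _ (typ_iff.2 ⟨fun i => i.elim0, h k, fun i => i.elim0, fun i => i.elim0,
    fun i => i.elim0⟩)

theorem model_of_tp {T : Language.order.Theory} [M ⊨ T]
    (h : ∀ k, tp k (Set.univ : Set M) = tp k (Set.univ : Set N)) : N ⊨ T :=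
  ⟨fun φ hφ => (realize_sentence_iff_of_tp h φ).1 (Theory.realize_sentence_of_mem T hφ)⟩

end

theorem exists_lt_formula {n : ℕ} (i j : Fin n) : ∃ φ : Language.order.BoundedFormula Empty n,
    ∀ (M : Type) [LinearOrder M] [Language.order.Structure M] [StrictlyOrdered M]
      (v : Empty → M) (a : Fin n → M), φ.Realize v a ↔ a i < a j :=
  ⟨Relations.boundedFormula₂ relSymb (.var (.inr i)) (.var (.inr j)), by
    intro M _ _ _ v a
    rw [BoundedFormula.realize_rel₂]
    exact StrictlyOrdered.relMap_iff _ _⟩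

theorem exists_mem_itv_formula {n : ℕ} (e : WithBot (Fin n)) (f : WithTop (Fin n)) (j : Fin n) :
    ∃ φ : Language.order.BoundedFormula Empty n,
    ∀ (M : Type) [LinearOrder M] [Language.order.Structure M] [StrictlyOrdered M]
      (v : Empty → M) (a : Fin n → M), φ.Realize v a ↔ a j ∈ itv (e.map a) (f.map a) := by
  have h₁ : ∃ φ : Language.order.BoundedFormula Empty n,
      ∀ (M : Type) [LinearOrder M] [Language.order.Structure M] [StrictlyOrdered M]
        (v : Empty → M) (a : Fin n → M), φ.Realize v a ↔ e.map a < a j := by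
    induction e using WithBot.recBotCoe with
    | bot => exact ⟨⊤, by simp⟩
    | coe i => simpa using exists_lt_formula i j
  have h₂ : ∃ φ : Language.order.BoundedFormula Empty n,
      ∀ (M : Type) [LinearOrder M] [Language.order.Structure M] [StrictlyOrdered M]
        (v : Empty → M) (a : Fin n → M), φ.Realize v a ↔ a j < f.map a := by
    induction f using WithTop.recTopCoe with
    | top => exact ⟨⊤, by simp⟩
    | coe i => simpa using exists_lt_formula j i
  obtain ⟨φ, hφ⟩ := h₁
  obtain ⟨ψ, hψ⟩ := h₂
  exact ⟨φ ⊓ ψ, fun M _ _ _ v a => by rw [BoundedFormula.realize_inf, hφ, hψ, mem_itv]⟩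

theorem exists_tp_formula (k : ℕ) {n : ℕ} (e : WithBot (Fin n)) (f : WithTop (Fin n)) (t : EF k) :
    ∃ φ : Language.order.BoundedFormula Empty n,
    ∀ (M : Type) [LinearOrder M] [Language.order.Structure M] [StrictlyOrdered M]
      (v : Empty → M) (a : Fin n → M), φ.Realize v a ↔ tp k (itv (e.map a) (f.map a)) = t := by
  classical
  induction k generalizing n with
  | zero => exact ⟨⊤, fun M _ _ _ v a => iff_of_true (by simp) (Subsingleton.elim _ _)⟩
  | succ k ih =>
    obtain ⟨φ, hφ⟩ := exists_mem_itv_formula (e.map Fin.castSucc) (f.map Fin.castSucc) (Fin.last n)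
    choose ψ hψ using ih (e.map Fin.castSucc) (Fin.last n)
    choose χ hχ using ih (Fin.last n) (f.map Fin.castSucc)
    let θ : EF k × EF k → Language.order.BoundedFormula Empty n := fun p =>
      (φ ⊓ ψ p.1 ⊓ χ p.2).ex
    have hθ : ∀ p, ∀ (M : Type) [LinearOrder M] [Language.order.Structure M] [StrictlyOrdered M]
        (v : Empty → M) (a : Fin n → M), (θ p).Realize v a ↔
          p ∈ tp (k + 1) (itv (e.map a) (f.map a)) := by
      intro p M _ _ _ v a
      simp only [θ, BoundedFormula.realize_ex, BoundedFormula.realize_inf, hφ, hψ, hχ,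
        WithBot.map_map, WithTop.map_map, WithTop.map_coe, WithBot.map_coe, Fin.snoc_last,
        show ∀ x : M, (Fin.snoc a x : Fin (n + 1) → M) ∘ Fin.castSucc = a from
          fun x => funext fun i => Fin.snoc_castSucc (α := fun _ => M) x a i, mem_tp, and_assoc]
      refine exists_congr fun x => and_congr_right fun hx => ?_
      rw [itv_inter_Iio hx.2, itv_inter_Ioi hx.1, Prod.ext_iff, eq_comm,
        eq_comm (a := tp k (itv (x : WithBot M) _))]
    refine ⟨BoundedFormula.iInf fun p => if p ∈ t then θ p else (θ p).not, fun M _ _ _ v a => ?_⟩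
    rw [BoundedFormula.realize_iInf, EF.ext_iff]
    refine forall_congr' fun p => ?_
    split_ifs with h
    · simp [h, hθ]
    · simp [h, hθ]

/-- Models of a complete theory have the same types. -/
theorem tp_eq_of_isComplete {T : Language.order.Theory} (hT : T.IsComplete) {M N : Type}
    [LinearOrder M] [LinearOrder N] [Nonempty M] [Nonempty N] [Language.order.Structure M]
    [Language.order.Structure N] [StrictlyOrdered M] [StrictlyOrdered N] [M ⊨ T] [N ⊨ T] (k : ℕ) :
    tp k (Set.univ : Set M) = tp k (Set.univ : Set N) := by
  obtain ⟨φ, hφ⟩ := exists_tp_formula k (n := 0) ⊥ ⊤ (tp k (Set.univ : Set M))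
  have h : ∀ (K : Type) [LinearOrder K] [Language.order.Structure K] [StrictlyOrdered K],
      K ⊨ (φ : Language.order.Sentence) ↔ tp k (Set.univ : Set K) = tp k (Set.univ : Set M) := by
    intro K _ _ _
    refine (hφ K _ _).trans ?_
    rw [WithBot.map_bot, WithTop.map_top, itv_bot_top]
  exact ((h N).1 ((hT.realize_sentence_iff φ N).2
    ((hT.realize_sentence_iff φ M).1 ((h M).2 rfl)))).symm

theorem orderIso_of_equiv {M N : Type} [LinearOrder M] [LinearOrder N]
    [Language.order.Structure M] [Language.order.Structure N] [StrictlyOrdered M]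
    [StrictlyOrdered N] (f : M ≃[Language.order] N) : Nonempty (M ≃o N) := by
  refine ⟨StrictMono.orderIsoOfSurjective f (fun a b h => ?_) f.surjective⟩
  have := (f.map_rel relSymb ![a, b]).2 ((relMap_relSymb _).2 h)
  exact (relMap_relSymb _).1 this

theorem equiv_of_orderIso {M N : Type} [LinearOrder M] [LinearOrder N]
    [Language.order.Structure M] [Language.order.Structure N] [StrictlyOrdered M]
    [StrictlyOrdered N] (f : M ≃o N) : Nonempty (M ≃[Language.order] N) :=
  ⟨⟨f.toEquiv, fun g => g.elim, fun r _ => relMap_congr r fun _ _ => f.lt_iff_lt⟩⟩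

/-- The relation symbol is interpreted as a strict linear order. -/
def IsLinear (M : Type w) [Language.order.Structure M] : Prop :=
  IsStrictTotalOrder M fun a b => Structure.RelMap relSymb ![a, b]

theorem IsLinear.exists_linearOrder {M : Type} [Language.order.Structure M] (h : IsLinear M) :
    ∃ _ : LinearOrder M, StrictlyOrdered M := by
  classical
  have : IsStrictTotalOrder M fun a b => Structure.RelMap relSymb ![a, b] := h
  let := linearOrderOfSTO fun a b : M => Structure.RelMap relSymb ![a, b]
  exact ⟨this, ⟨fun _ _ => Iff.rfl⟩⟩

/-- If `T` has only strict linear orders as models in one universe, then so it does in the lowest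
one. -/
theorem isLinear_of_model {T : Language.order.Theory}
    (hlin : ∀ (M : Type w) [Language.order.Structure M], M ⊨ T → IsLinear M)
    (M : Type) [Language.order.Structure M] (hM : M ⊨ T) : IsLinear M := by
  let : Language.order.Structure (ULift.{w} M) := Equiv.ulift.symm.inducedStructure
  let e : M ≃[Language.order] ULift.{w} M := Equiv.inducedStructureEquiv Equiv.ulift.symm
  have h := hlin (ULift.{w} M) (StrongHomClass.theory_model e)
  have he : ∀ a b : M, Structure.RelMap relSymb ![e a, e b] ↔ Structure.RelMap relSymb ![a, b] := by
    intro a b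
    rw [← e.map_rel relSymb]
    congr! 1
    ext i
    fin_cases i <;> rfl
  let f : (fun a b : M => Structure.RelMap relSymb ![a, b]) ↪r
      (fun a b : ULift.{w} M => Structure.RelMap relSymb ![a, b]) :=
    ⟨e.toEquiv.toEmbedding, fun {a b} => he a b⟩
  have : IsStrictTotalOrder (ULift.{w} M) fun a b => Structure.RelMap relSymb ![a, b] := h
  exact f.isStrictTotalOrder

/-- A countable model of a complete theory of linear orders either is the only one, or there is a
family of pairwise non-isomorphic ones indexed by the sets of natural numbers. -/
theorem unique_or_exists_family {T : Language.order.Theory} (hT : T.IsComplete)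
    (hlin : ∀ (M : Type) [Language.order.Structure M], M ⊨ T → IsLinear M)
    (M : Type) [Language.order.Structure M] [Countable M] [Infinite M] [M ⊨ T] :
    (∀ (N : Type) [Language.order.Structure N] [Countable N] [Nonempty N] [N ⊨ T],
      Nonempty (M ≃[Language.order] N)) ∨
    ∃ (K : Set ℕ → Type) (_ : ∀ S, Language.order.Structure (K S)),
      (∀ S, Countable (K S)) ∧ (∀ S, Infinite (K S)) ∧ (∀ S, K S ⊨ T) ∧
      ∀ S S', (K S ≃[Language.order] K S') → S = S' := by
  obtain ⟨_, _⟩ := (hlin M inferInstance).exists_linearOrder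
  by_cases hM : Fine (Set.univ : Set M)
  · left
    intro N _ _ _ _
    obtain ⟨_, _⟩ := (hlin N inferInstance).exists_linearOrder
    obtain ⟨f⟩ := hM.orderIso (tp_eq_of_isComplete hT (M := M) (N := N))
    exact equiv_of_orderIso f
  · right
    obtain ⟨A, W, C, _, _, _, _, _, _, htp, hiso⟩ := exists_encoding hM
    obtain ⟨I, _, _, _, hI⟩ := exists_orders
    let : ∀ S, Language.order.Structure (A ⊕ₗ (I S ×ₗ W) ⊕ₗ C) := fun S => strictStructure _
    have : ∀ S, StrictlyOrdered (A ⊕ₗ (I S ×ₗ W) ⊕ₗ C) :=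
      fun S => strictlyOrdered_strictStructure _
    refine ⟨fun S => A ⊕ₗ (I S ×ₗ W) ⊕ₗ C, inferInstance, fun S => ?_, fun S => ?_, fun S => ?_,
      fun S S' f => ?_⟩
    · exact inferInstanceAs (Countable (A ⊕ ((I S × W) ⊕ C)))
    · have h : M ≅[Language.order] (A ⊕ₗ (I S ×ₗ W) ⊕ₗ C) :=
        elementarilyEquivalent_iff.2 (realize_sentence_iff_of_tp fun k => (htp (I S) k).symm)
      exact h.infinite_iff.1 inferInstance
    · exact model_of_tp fun k => (htp (I S) k).symm
    · obtain ⟨g⟩ := orderIso_of_equiv f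
      obtain ⟨i⟩ := hiso _ _ g
      exact hI S S' i

theorem exists_equiv_nat {T : Language.order.Theory} (K : Type) [Language.order.Structure K]
    [Countable K] [Infinite K] [K ⊨ T] :
    ∃ S : {S : Language.order.Structure ℕ // @Theory.Model Language.order ℕ S T},
      Nonempty (@Language.Equiv Language.order K ℕ _ S.1) := by
  obtain ⟨e⟩ := nonempty_equiv_of_countable (α := K) (β := ℕ)
  let : Language.order.Structure ℕ := e.inducedStructure
  have f : K ≃[Language.order] ℕ := e.inducedStructureEquiv
  exact ⟨⟨this, StrongHomClass.theory_model f⟩, ⟨f⟩⟩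

theorem exists_countable_model {T : Language.order.Theory} {M : Type w}
    [Language.order.Structure M] [Infinite M] [M ⊨ T] :
    ∃ (K : Type) (_ : Language.order.Structure K), Countable K ∧ Infinite K ∧ K ⊨ T := by
  obtain ⟨N, hN, hc⟩ := exists_elementarilyEquivalent_card_eq Language.order M (ℵ₀ : Cardinal.{0})
    le_rfl (by simp)
  exact ⟨N, inferInstance, mk_le_aleph0_iff.1 hc.le, infinite_iff.2 hc.ge, hN.theory_model⟩

theorem relMap_injective {M : Type} : Function.Injective
    fun (S : Language.order.Structure M) => S.RelMap relSymb := by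
  rintro ⟨f, r⟩ ⟨g, s⟩ h
  congr 1
  · ext n x
    exact x.elim
  · ext n x a
    cases x
    exact iff_of_eq (congrFun h a)

theorem numCountableModels_le (T : Language.order.Theory) :
    numCountableModels Language.order T ≤ continuum := by
  refine mk_quot_le.trans ((mk_subtype_le _).trans ((mk_le_of_injective relMap_injective).trans ?_))
  rw [← Cardinal.power_def]
  simp

theorem countableModelClasses_exact {L : FirstOrder.Language.{u, v}} {T : L.Theory}
    {S S' : {S : L.Structure ℕ // @Theory.Model L ℕ S T}}
    (h : (Quot.mk _ S : CountableModelClasses L T) = Quot.mk _ S') :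
    Nonempty (@Language.Equiv L ℕ ℕ S.1 S'.1) := by
  have he : Equivalence (fun S₁ S₂ : {S : L.Structure ℕ // @Theory.Model L ℕ S T} =>
      Nonempty (@Language.Equiv L ℕ ℕ S₁.1 S₂.1)) :=
    { refl := fun S => ⟨@Language.Equiv.refl L ℕ S.1⟩
      symm := fun {S S'} ⟨f⟩ => ⟨@Language.Equiv.symm L ℕ ℕ S.1 S'.1 f⟩
      trans := fun {S S' S''} ⟨f⟩ ⟨g⟩ =>
        ⟨@Language.Equiv.comp L ℕ ℕ S.1 S'.1 ℕ S''.1 g f⟩ }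
  exact he.eqvGen_iff.1 (Quot.eqvGen_exact h)

end LinOrdTheory

/-- **Rubin's theorem.** If `T` is a complete theory in the language with one binary relation
symbol all of whose models are strict linear orders, and `T` has infinite models, then the
number of isomorphism classes of countably infinite models of `T` is `1` or `2^ℵ₀ = 𝔠`. -/
theorem rubin_vaught_conjecture_for_linear_orders
    (T : FirstOrder.Language.order.Theory)
    (hcomplete : T.IsComplete)
    (hlin : ∀ (M : Type w) [iM : FirstOrder.Language.order.Structure M],
      FirstOrder.Language.Theory.Model M T →
      IsStrictTotalOrder M (fun a b =>
        @FirstOrder.Language.Structure.RelMap FirstOrder.Language.order M iM 2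
          FirstOrder.Language.orderRel.le ![a, b]))
    (hinf : ∃ (M : Type w) (_ : FirstOrder.Language.order.Structure M),
      Infinite M ∧ FirstOrder.Language.Theory.Model M T) :
    numCountableModels FirstOrder.Language.order T = 1 ∨
      numCountableModels FirstOrder.Language.order T = Cardinal.continuum := by
  obtain ⟨M, _, _, _⟩ := hinf
  obtain ⟨M, _, _, _, _⟩ := LinOrdTheory.exists_countable_model (T := T) (M := M)
  rcases LinOrdTheory.unique_or_exists_family hcomplete (LinOrdTheory.isLinear_of_model hlin) M with
    h | ⟨K, _, _, _, _, hK⟩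
  · left
    obtain ⟨S, -⟩ := LinOrdTheory.exists_equiv_nat (T := T) M
    refine Cardinal.eq_one_iff_unique.2 ⟨⟨?_⟩, ⟨Quot.mk _ S⟩⟩
    rintro ⟨⟨S₁, h₁⟩⟩ ⟨⟨S₂, h₂⟩⟩
    obtain ⟨f⟩ := @h ℕ S₁ _ _ h₁
    obtain ⟨g⟩ := @h ℕ S₂ _ _ h₂
    exact Quot.sound ⟨@FirstOrder.Language.Equiv.comp _ ℕ M S₁ _ ℕ S₂ g
      (@FirstOrder.Language.Equiv.symm _ M ℕ _ S₁ f)⟩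
  · right
    choose S hS using fun X => LinOrdTheory.exists_equiv_nat (T := T) (K X)
    refine (LinOrdTheory.numCountableModels_le T).antisymm ?_
    have hinj : Function.Injective
        fun X => (Quot.mk _ (S X) : CountableModelClasses FirstOrder.Language.order T) := by
      intro X Y hXY
      obtain ⟨f⟩ := LinOrdTheory.countableModelClasses_exact hXY
      obtain ⟨i⟩ := hS X
      obtain ⟨j⟩ := hS Y
      let := (S Y).1
      exact hK X Y (j.symm.comp (@FirstOrder.Language.Equiv.comp _ _ _ _ (S X).1 _ _ f i))
    rw [← Cardinal.mk_set_nat]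
    exact Cardinal.mk_le_of_injective hinj
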